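/- arXiv:1104.3553 — 3 statements merged into one kernel-verified Lean document; each statement's English description precedes it below -/
import Mathlib

section
/- There exists a constant C > 0 with the following property. Let 0 ≤ α < 1, L > 0, and let f : ℝ → ℝ be a continuous nondecreasing function such that f(t) = 0 for all t ≤ 0, the restriction of f to [0, ∞) is concave, and |f(x) − f(y)| ≤ L·|x − y|^α for all x, y ∈ ℝ. Then for every δ > 0 and all bounded self-adjoint operators A, B on a complex Hilbert space with ‖A − B‖ ≤ δ, one has ‖f(A) − f(B)‖ ≤ C · log(2/(1 − α)) · L · δ^α. -/
open MeasureTheory ENNReal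

/-- `|T| = (T*T)^{1/2}` via the continuous functional calculus. -/
noncomputable def opAbs {H : Type} [NormedAddCommGroup H] [InnerProductSpace ℂ H]
    [CompleteSpace H] (T : H →L[ℂ] H) : H →L[ℂ] H :=
  cfc Real.sqrt (star T * T)

/-- The Hilbert space `ℓ²(ℕ, ℂ)`. -/
noncomputable abbrev ellTwo : Type := lp (fun _ : ℕ => ℂ) 2

section SchurBounds

variable {H : Type*} [NormedAddCommGroup H] [InnerProductSpace ℂ H] [CompleteSpace H]

lemma sum_norm_sq_cfc_apply_le {ι : Type*} (s : Finset ι) (A : H →L[ℂ] H)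
    {r : ι → ℝ → ℝ} (hr : ∀ i, Continuous (r i)) {c : ℝ}
    (h : ∀ x, ∑ i ∈ s, r i x ^ 2 ≤ c ^ 2) (ξ : H) :
    ∑ i ∈ s, ‖cfc (r i) A ξ‖ ^ 2 ≤ c ^ 2 * ‖ξ‖ ^ 2 := by
  have hsum : ∑ i ∈ s, cfc (r i) A * cfc (r i) A = cfc (fun x ↦ ∑ i ∈ s, r i x ^ 2) A := by
    have : (fun x ↦ ∑ i ∈ s, r i x ^ 2) = ∑ i ∈ s, fun x ↦ r i x * r i x := by
      ext x; simp [sq]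
    rw [this, cfc_sum (fun i x ↦ r i x * r i x) A s fun i _ ↦ ((hr i).mul (hr i)).continuousOn]
    exact Finset.sum_congr rfl fun i _ ↦
      (cfc_mul _ _ A (hr i).continuousOn (hr i).continuousOn).symm
  have hnorm : ‖∑ i ∈ s, cfc (r i) A * cfc (r i) A‖ ≤ c ^ 2 := by
    rw [hsum]
    refine norm_cfc_le (sq_nonneg c) fun x _ ↦ ?_
    rw [Real.norm_of_nonneg (Finset.sum_nonneg fun i _ ↦ sq_nonneg _)]
    exact h x
  have hinner : ∑ i ∈ s, ‖cfc (r i) A ξ‖ ^ 2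
      = RCLike.re (inner ℂ ((∑ i ∈ s, cfc (r i) A * cfc (r i) A) ξ) ξ) := by
    rw [sum_apply, sum_inner, map_sum]
    refine Finset.sum_congr rfl fun i _ ↦ ?_
    have hsa : IsSelfAdjoint (cfc (r i) A) := cfc_predicate _ A
    rw [mul_apply_eq_comp, ← ContinuousLinearMap.adjoint_inner_right,
      hsa.adjoint_eq, inner_self_eq_norm_sq]
  rw [hinner]
  calc _ ≤ ‖(∑ i ∈ s, cfc (r i) A * cfc (r i) A) ξ‖ * ‖ξ‖ := re_inner_le_norm _ _
    _ ≤ (c ^ 2 * ‖ξ‖) * ‖ξ‖ := by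
        gcongr
        exact (ContinuousLinearMap.le_opNorm _ _).trans (by gcongr)
    _ = _ := by ring

/-- A Schur multiplier of the form `∑ dᵢ(y) rᵢ(x)` is bounded by the product of the
row and column norms of its factors. -/
lemma norm_sum_cfc_mul_cfc_le {ι : Type*} (s : Finset ι) (A B T : H →L[ℂ] H) {d r : ι → ℝ → ℝ}
    (hd : ∀ i, Continuous (d i)) (hr : ∀ i, Continuous (r i)) {a c : ℝ} (ha : 0 ≤ a) (hc : 0 ≤ c)
    (hda : ∀ x, ∑ i ∈ s, d i x ^ 2 ≤ a ^ 2) (hrc : ∀ x, ∑ i ∈ s, r i x ^ 2 ≤ c ^ 2) :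
    ‖∑ i ∈ s, cfc (d i) B * T * cfc (r i) A‖ ≤ a * c * ‖T‖ := by
  refine ContinuousLinearMap.opNorm_le_of_re_inner_le (by positivity) fun ξ η hξ hη ↦ ?_
  rw [sum_apply, sum_inner, map_sum]
  have hterm : ∀ i ∈ s, RCLike.re (inner ℂ ((cfc (d i) B * T * cfc (r i) A) ξ) η)
      ≤ ‖T‖ * (‖cfc (r i) A ξ‖ * ‖cfc (d i) B η‖) := fun i _ ↦ by
    have hsa : IsSelfAdjoint (cfc (d i) B) := cfc_predicate _ B
    rw [mul_assoc, mul_apply_eq_comp, ← ContinuousLinearMap.adjoint_inner_right,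
      hsa.adjoint_eq, mul_apply_eq_comp, ← mul_assoc]
    exact (re_inner_le_norm _ _).trans (by gcongr; exact ContinuousLinearMap.le_opNorm _ _)
  refine (Finset.sum_le_sum hterm).trans ?_
  rw [← Finset.mul_sum]
  have hcs : ∑ i ∈ s, ‖cfc (r i) A ξ‖ * ‖cfc (d i) B η‖ ≤ (c * ‖ξ‖) * (a * ‖η‖) := by
    refine abs_le_of_sq_le_sq' ?_ (by positivity) |>.2
    calc _ ≤ (∑ i ∈ s, ‖cfc (r i) A ξ‖ ^ 2) * ∑ i ∈ s, ‖cfc (d i) B η‖ ^ 2 :=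
          Finset.sum_mul_sq_le_sq_mul_sq _ _ _
      _ ≤ (c ^ 2 * ‖ξ‖ ^ 2) * (a ^ 2 * ‖η‖ ^ 2) := by
          gcongr
          · exact sum_norm_sq_cfc_apply_le s A hr hrc ξ
          · exact sum_norm_sq_cfc_apply_le s B hd hda η
      _ = _ := by ring
  calc _ ≤ ‖T‖ * ((c * ‖ξ‖) * (a * ‖η‖)) := by gcongr
    _ = _ := by rw [hξ, hη]; ring

lemma sum_range_two_pow_succ {M : Type*} [AddCommMonoid M] (n : ℕ) (u : ℕ → M) :
    ∑ k ∈ Finset.range (2 ^ (n + 1)), u k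
      = ∑ k ∈ Finset.range (2 ^ n), (u (2 * k) + u (2 * k + 1)) := by
  rw [pow_succ, mul_comm]
  generalize 2 ^ n = m
  induction m with
  | zero => simp
  | succ m ih =>
    rw [Finset.sum_range_succ, ← ih, show 2 * (m + 1) = 2 * m + 1 + 1 by ring,
      Finset.sum_range_succ, Finset.sum_range_succ, add_assoc]

/-- A dyadic bound for triangular truncation: multipliers with `2 ^ n` nested factors on the left
have norm of order `n`. -/
lemma norm_sum_cfc_mul_cfc_le_of_monotone (A B T : H →L[ℂ] H) {c : ℝ} (hc : 0 ≤ c) (n : ℕ)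
    {p q : ℕ → ℝ → ℝ} (hp : ∀ k, Continuous (p k)) (hq : ∀ k, Continuous (q k))
    (hp₀ : ∀ k x, 0 ≤ p k x) (hp₁ : ∀ k x, p k x ≤ 1) (hmono : ∀ x, Monotone fun k ↦ p k x)
    (hqc : ∀ x, ∑ k ∈ Finset.range (2 ^ n), |q k x| ≤ c) :
    ‖∑ k ∈ Finset.range (2 ^ n), cfc (p k) B * T * cfc (q k) A‖ ≤ (n + 1) * c * ‖T‖ := by
  induction n generalizing p q with
  | zero =>
    have hq₀ : ∀ x, q 0 x ^ 2 ≤ c ^ 2 := fun x ↦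
      sq_le_sq.2 (((by simpa using hqc x : |q 0 x| ≤ c)).trans (le_abs_self c))
    have h := norm_sum_cfc_mul_cfc_le (Finset.range 1) A B T hp hq zero_le_one hc
      (fun x ↦ by
        rw [Finset.sum_range_one, one_pow]
        exact pow_le_one₀ (hp₀ 0 x) (hp₁ 0 x))
      (fun x ↦ by rw [Finset.sum_range_one]; exact hq₀ x)
    simpa using h
  | succ n ih =>
    have hT : ∑ k ∈ Finset.range (2 ^ (n + 1)), cfc (p k) B * T * cfc (q k) A
        = (∑ k ∈ Finset.range (2 ^ n), cfc (p (2 * k)) B * T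
            * cfc (fun x ↦ q (2 * k) x + q (2 * k + 1) x) A)
          + ∑ k ∈ Finset.range (2 ^ n), cfc (fun x ↦ p (2 * k + 1) x - p (2 * k) x) B * T
            * cfc (q (2 * k + 1)) A := by
      rw [sum_range_two_pow_succ, ← Finset.sum_add_distrib]
      refine Finset.sum_congr rfl fun k _ ↦ ?_
      rw [cfc_add A _ _ (hq _).continuousOn (hq _).continuousOn,
        cfc_sub _ _ B (hp _).continuousOn (hp _).continuousOn]
      noncomm_ring
    have h₁ := ih (p := fun k ↦ p (2 * k)) (q := fun k x ↦ q (2 * k) x + q (2 * k + 1) x)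
      (fun k ↦ hp _) (fun k ↦ (hq _).add (hq _)) (fun k ↦ hp₀ _) (fun k ↦ hp₁ _)
      (fun x i j hij ↦ hmono x (by omega))
      (fun x ↦ by
        refine le_trans ?_ (hqc x)
        rw [sum_range_two_pow_succ]
        exact Finset.sum_le_sum fun k _ ↦ abs_add_le _ _)
    have h₂ := norm_sum_cfc_mul_cfc_le (Finset.range (2 ^ n)) A B T
      (d := fun k x ↦ p (2 * k + 1) x - p (2 * k) x) (r := fun k ↦ q (2 * k + 1))
      (fun k ↦ (hp _).sub (hp _)) (fun k ↦ hq _) zero_le_one hc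
      (fun x ↦ by
        have hle : ∀ k ∈ Finset.range (2 ^ n), (p (2 * k + 1) x - p (2 * k) x) ^ 2
            ≤ p (2 * (k + 1)) x - p (2 * k) x := fun k _ ↦ by
          have e₁ : p (2 * k) x ≤ p (2 * k + 1) x := hmono x (by omega)
          have e₂ : p (2 * k + 1) x ≤ p (2 * (k + 1)) x := hmono x (by omega)
          nlinarith [hp₀ (2 * k) x, hp₁ (2 * k + 1) x]
        refine (Finset.sum_le_sum hle).trans ?_
        rw [Finset.sum_range_sub (fun k ↦ p (2 * k) x)]
        linarith [hp₀ (2 * 0) x, hp₁ (2 * 2 ^ n) x])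
      (fun x ↦ by
        have hle : ∑ k ∈ Finset.range (2 ^ n), |q (2 * k + 1) x| ≤ c := by
          refine le_trans ?_ (hqc x)
          rw [sum_range_two_pow_succ]
          exact Finset.sum_le_sum fun k _ ↦ le_add_of_nonneg_left (abs_nonneg _)
        calc _ = ∑ k ∈ Finset.range (2 ^ n), |q (2 * k + 1) x| ^ 2 := by simp
          _ ≤ (∑ k ∈ Finset.range (2 ^ n), |q (2 * k + 1) x|) ^ 2 :=
            Finset.sum_sq_le_sq_sum_of_nonneg fun k _ ↦ abs_nonneg _
          _ ≤ c ^ 2 := by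
            gcongr)
    rw [hT]
    refine (norm_add_le _ _).trans ((add_le_add h₁ h₂).trans (le_of_eq ?_))
    push_cast
    ring

end SchurBounds


section Lorentzian

/-- The Lorentzian `t² / ((x - s)² + t²)` of width `t` centred at `s`. -/
noncomputable def lorentzian (t s x : ℝ) : ℝ := t ^ 2 / ((x - s) ^ 2 + t ^ 2)

/-- The dispersive companion `t (x - s) / ((x - s)² + t²)` of the Lorentzian. -/
noncomputable def dispersive (t s x : ℝ) : ℝ := t * (x - s) / ((x - s) ^ 2 + t ^ 2)

variable {t : ℝ}

lemma continuous_lorentzian (ht : 0 < t) (s : ℝ) : Continuous (lorentzian t s) := by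
  unfold lorentzian
  exact Continuous.div (by fun_prop) (by fun_prop) fun x ↦ by positivity

lemma continuous_dispersive (ht : 0 < t) (s : ℝ) : Continuous (dispersive t s) := by
  unfold dispersive
  exact Continuous.div (by fun_prop) (by fun_prop) fun x ↦ by positivity

lemma lorentzian_nonneg (t s x : ℝ) : 0 ≤ lorentzian t s x := by
  unfold lorentzian; positivity

lemma lorentzian_le_one (t s x : ℝ) : lorentzian t s x ≤ 1 :=
  div_le_one_of_le₀ (by nlinarith [sq_nonneg (x - s)]) (by positivity)

lemma lorentzian_le_lorentzian {t' : ℝ} (ht : 0 < t) (h : t ≤ t') (s x : ℝ) :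
    lorentzian t s x ≤ lorentzian t' s x := by
  have ht' : 0 < t' := ht.trans_le h
  unfold lorentzian
  rw [div_le_div_iff₀ (by positivity) (by positivity)]
  have : t ^ 2 ≤ t' ^ 2 := by gcongr
  nlinarith [sq_nonneg (x - s)]

lemma abs_dispersive_le_one (ht : 0 < t) (s x : ℝ) : |dispersive t s x| ≤ 1 := by
  unfold dispersive
  rw [abs_div, abs_of_pos (by positivity : 0 < (x - s) ^ 2 + t ^ 2), div_le_one (by positivity),
    abs_le]
  constructor <;> nlinarith [sq_nonneg (x - s + t), sq_nonneg (x - s - t)]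

lemma abs_lorentzian_sub_le (ht : 0 < t) (s s' x : ℝ) :
    |lorentzian t s x - lorentzian t s' x| ≤ |s - s'| / t := by
  unfold lorentzian
  set u := x - s
  set v := x - s'
  have huv : s - s' = v - u := by simp only [u, v]; ring
  have hD : 0 < (u ^ 2 + t ^ 2) * (v ^ 2 + t ^ 2) := by positivity
  have key : t ^ 2 / (u ^ 2 + t ^ 2) - t ^ 2 / (v ^ 2 + t ^ 2)
      = (v - u) / t * ((v + u) * t ^ 3 / ((u ^ 2 + t ^ 2) * (v ^ 2 + t ^ 2))) := by
    field_simp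
    ring
  rw [huv, key, abs_mul, abs_div, abs_of_pos ht]
  refine mul_le_of_le_one_right (by positivity) ?_
  rw [abs_div, abs_of_pos hD, div_le_one hD, abs_mul, abs_of_pos (by positivity : 0 < t ^ 3)]
  have h₁ : |v + u| * t ≤ u ^ 2 + v ^ 2 + t ^ 2 := by
    rcases abs_cases (v + u) with ⟨h, -⟩ | ⟨h, -⟩ <;> rw [h] <;>
      nlinarith [sq_nonneg (2 * u - t), sq_nonneg (2 * v - t), sq_nonneg (2 * u + t),
        sq_nonneg (2 * v + t)]
  nlinarith [mul_le_mul_of_nonneg_right h₁ (sq_nonneg t), sq_nonneg (u * v)]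

lemma abs_dispersive_sub_le (ht : 0 < t) (s s' x : ℝ) :
    |dispersive t s x - dispersive t s' x| ≤ |s - s'| / t := by
  unfold dispersive
  set u := x - s
  set v := x - s'
  have huv : s - s' = v - u := by simp only [u, v]; ring
  have hD : 0 < (u ^ 2 + t ^ 2) * (v ^ 2 + t ^ 2) := by positivity
  have key : t * u / (u ^ 2 + t ^ 2) - t * v / (v ^ 2 + t ^ 2)
      = (v - u) / t * ((u * v - t ^ 2) * t ^ 2 / ((u ^ 2 + t ^ 2) * (v ^ 2 + t ^ 2))) := by
    field_simp
    ring
  rw [huv, key, abs_mul, abs_div, abs_of_pos ht]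
  refine mul_le_of_le_one_right (by positivity) ?_
  rw [abs_div, abs_of_pos hD, div_le_one hD, abs_mul, abs_of_pos (by positivity : 0 < t ^ 2)]
  have h₁ : |u * v - t ^ 2| ≤ u ^ 2 + v ^ 2 + t ^ 2 := by
    rw [abs_le]
    constructor <;> nlinarith [sq_nonneg (u - v), sq_nonneg (u + v)]
  nlinarith [mul_le_mul_of_nonneg_right h₁ (sq_nonneg t), sq_nonneg (u * v)]

lemma sum_abs_dispersive_le (ht : 0 < t) (s x : ℝ) (n : ℕ) :
    ∑ k ∈ Finset.range n, |dispersive (2 ^ k * t) s x| ≤ 7 / 2 := by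
  set y := |x - s| with hy
  have hy₀ : 0 ≤ y := abs_nonneg _
  let F : ℕ → ℝ := fun k ↦ 2 ^ k * t / (y + 2 ^ k * t)
  have hterm : ∀ k ∈ Finset.range n,
      |dispersive (2 ^ k * t) s x| ≤ 7 / 2 * (F (k + 1) - F k) := fun k _ ↦ by
    have hu : 0 < 2 ^ k * t := by positivity
    have hF : F (k + 1) = 2 * (2 ^ k * t) / (y + 2 * (2 ^ k * t)) := by
      simp only [F]
      ring
    rw [hF]
    simp only [F, dispersive]
    generalize 2 ^ k * t = u at hu
    rw [abs_div, abs_mul, ← hy, abs_of_pos hu, abs_of_pos (by positivity : 0 < (x - s) ^ 2 + u ^ 2),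
      ← sq_abs (x - s), ← hy]
    have : 7 / 2 * (2 * u / (y + 2 * u) - u / (y + u))
        = 7 / 2 * (u * y) / ((y + 2 * u) * (y + u)) := by
      field_simp
      ring
    rw [this, div_le_div_iff₀ (by positivity) (by positivity)]
    have h₁ : (y + 2 * u) * (y + u) ≤ 7 / 2 * (y ^ 2 + u ^ 2) := by
      nlinarith [sq_nonneg (y - u), sq_nonneg y, sq_nonneg u]
    nlinarith [mul_le_mul_of_nonneg_left h₁ (by positivity : 0 ≤ u * y)]
  refine (Finset.sum_le_sum hterm).trans ?_
  rw [← Finset.mul_sum, Finset.sum_range_sub]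
  have h₁ : F n ≤ 1 := div_le_one_of_le₀ (by linarith) (by positivity)
  have h₀ : 0 ≤ F 0 := by positivity
  linarith

variable {H : Type*} [NormedAddCommGroup H] [InnerProductSpace ℂ H] [CompleteSpace H]

/-- The resolvent identity for Lorentzians. -/
lemma smul_cfc_lorentzian_sub (ht : 0 < t) (s : ℝ) {A B : H →L[ℂ] H}
    (hA : IsSelfAdjoint A) (hB : IsSelfAdjoint B) :
    t • (cfc (lorentzian t s) B - cfc (lorentzian t s) A)
      = cfc (lorentzian t s) B * (A - B) * cfc (dispersive t s) A
        + cfc (dispersive t s) B * (A - B) * cfc (lorentzian t s) A := by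
  have hp := continuous_lorentzian ht s
  have hq := continuous_dispersive ht s
  have hshift : ∀ {C : H →L[ℂ] H}, IsSelfAdjoint C →
      cfc (fun x ↦ x - s) C = C - s • (1 : H →L[ℂ] H) := fun {C} hC ↦ by
    rw [cfc_sub (fun x ↦ x) (fun _ ↦ s) C, cfc_id' ℝ C, cfc_const s C, Algebra.algebraMap_eq_smul_one]
  have hleft : ∀ {C : H →L[ℂ] H}, IsSelfAdjoint C →
      (C - s • (1 : H →L[ℂ] H)) * cfc (lorentzian t s) C = t • cfc (dispersive t s) C :=
    fun {C} hC ↦ by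
      rw [← hshift hC, ← cfc_mul _ _ C (by fun_prop) hp.continuousOn,
        ← cfc_const_mul t _ C hq.continuousOn]
      congr 1 with x
      simp only [lorentzian, dispersive]
      ring
  have hright : ∀ {C : H →L[ℂ] H}, IsSelfAdjoint C →
      cfc (lorentzian t s) C * (C - s • (1 : H →L[ℂ] H)) = t • cfc (dispersive t s) C :=
    fun {C} hC ↦ by
      rw [← hshift hC, ← cfc_mul _ _ C hp.continuousOn (by fun_prop),
        ← cfc_const_mul t _ C hq.continuousOn]
      congr 1 with x
      simp only [lorentzian, dispersive]
      ring
  have hone : ∀ {C : H →L[ℂ] H}, IsSelfAdjoint C →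
      t • (1 - cfc (lorentzian t s) C) = (C - s • (1 : H →L[ℂ] H)) * cfc (dispersive t s) C :=
    fun {C} hC ↦ by
      rw [← hshift hC, ← cfc_mul _ _ C (by fun_prop) hq.continuousOn, ← cfc_one ℝ C,
        ← cfc_sub _ _ C (by fun_prop) hp.continuousOn,
        ← cfc_const_mul t _ C (by fun_prop)]
      congr 1 with x
      have : (x - s) ^ 2 + t ^ 2 ≠ 0 := by positivity
      simp only [lorentzian, dispersive, Pi.one_apply]
      field_simp
      ring
  have hone' : ∀ {C : H →L[ℂ] H}, IsSelfAdjoint C →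
      t • (1 - cfc (lorentzian t s) C) = cfc (dispersive t s) C * (C - s • (1 : H →L[ℂ] H)) :=
    fun {C} hC ↦ by
      rw [hone hC, ← hshift hC, ← cfc_mul _ _ C (by fun_prop) hq.continuousOn,
        ← cfc_mul _ _ C hq.continuousOn (by fun_prop)]
      simp only [mul_comm]
  have hK : A - B = (A - s • (1 : H →L[ℂ] H)) - (B - s • (1 : H →L[ℂ] H)) := by abel
  have e₁ : cfc (lorentzian t s) B * (A - B) * cfc (dispersive t s) A
      = cfc (lorentzian t s) B * ((A - s • (1 : H →L[ℂ] H)) * cfc (dispersive t s) A)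
        - cfc (lorentzian t s) B * (B - s • (1 : H →L[ℂ] H)) * cfc (dispersive t s) A := by
    rw [hK, mul_sub, sub_mul, mul_assoc, mul_assoc]
  have e₂ : cfc (dispersive t s) B * (A - B) * cfc (lorentzian t s) A
      = cfc (dispersive t s) B * ((A - s • (1 : H →L[ℂ] H)) * cfc (lorentzian t s) A)
        - cfc (dispersive t s) B * (B - s • (1 : H →L[ℂ] H)) * cfc (lorentzian t s) A := by
    rw [hK, mul_sub, sub_mul, mul_assoc, mul_assoc]
  rw [e₁, e₂, ← hone hA, ← hone' hB, hleft hA, hright hB]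
  simp only [mul_sub, sub_mul, smul_mul_assoc, mul_smul_comm, mul_one, one_mul, smul_sub]
  abel

end Lorentzian


section TruncatedAbs

variable {H : Type*} [NormedAddCommGroup H] [InnerProductSpace ℂ H] [CompleteSpace H]

lemma norm_sum_smul_cfc_lorentzian_sub_le {t : ℝ} (ht : 0 < t) (s : ℝ) (n : ℕ)
    {A B : H →L[ℂ] H} (hA : IsSelfAdjoint A) (hB : IsSelfAdjoint B) :
    ‖∑ k ∈ Finset.range (2 ^ n), (2 ^ k * t) •
      (cfc (lorentzian (2 ^ k * t) s) B - cfc (lorentzian (2 ^ k * t) s) A)‖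
      ≤ 7 * (n + 1) * ‖A - B‖ := by
  have htk : ∀ k : ℕ, 0 < 2 ^ k * t := fun k ↦ by positivity
  have hone : ∀ A B T : H →L[ℂ] H, ‖∑ k ∈ Finset.range (2 ^ n),
      cfc (lorentzian (2 ^ k * t) s) B * T * cfc (dispersive (2 ^ k * t) s) A‖
      ≤ (n + 1) * (7 / 2) * ‖T‖ := fun A B T ↦
    norm_sum_cfc_mul_cfc_le_of_monotone A B T (by norm_num) n
      (fun k ↦ continuous_lorentzian (htk k) s) (fun k ↦ continuous_dispersive (htk k) s)
      (fun k x ↦ lorentzian_nonneg _ _ _) (fun k x ↦ lorentzian_le_one _ _ _)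
      (fun x i j hij ↦ lorentzian_le_lorentzian (htk i)
        (by gcongr; norm_num) s x)
      (fun x ↦ sum_abs_dispersive_le ht s x _)
  have hstar : ∑ k ∈ Finset.range (2 ^ n),
      cfc (dispersive (2 ^ k * t) s) B * (A - B) * cfc (lorentzian (2 ^ k * t) s) A
      = star (∑ k ∈ Finset.range (2 ^ n),
        cfc (lorentzian (2 ^ k * t) s) A * star (A - B) * cfc (dispersive (2 ^ k * t) s) B) := by
    rw [star_sum]
    refine Finset.sum_congr rfl fun k _ ↦ ?_
    have h₁ : IsSelfAdjoint (cfc (lorentzian (2 ^ k * t) s) A) := cfc_predicate _ A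
    have h₂ : IsSelfAdjoint (cfc (dispersive (2 ^ k * t) s) B) := cfc_predicate _ B
    rw [star_mul, star_mul, star_star, h₁.star_eq, h₂.star_eq, mul_assoc]
  simp_rw [smul_cfc_lorentzian_sub (htk _) s hA hB]
  rw [Finset.sum_add_distrib, hstar]
  refine (norm_add_le _ _).trans ?_
  rw [norm_star]
  have h₁ := hone A B (A - B)
  have h₂ := hone B A (star (A - B))
  rw [norm_star] at h₂
  linarith

lemma norm_smul_cfc_lorentzian_sub_sub_le {t : ℝ} (ht : 0 < t) (s s' : ℝ)
    {A B : H →L[ℂ] H} (hA : IsSelfAdjoint A) (hB : IsSelfAdjoint B) :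
    ‖t • ((cfc (lorentzian t s) B - cfc (lorentzian t s) A)
      - (cfc (lorentzian t s') B - cfc (lorentzian t s') A))‖ ≤ 4 * (|s - s'| / t) * ‖A - B‖ := by
  have hp : ∀ C : H →L[ℂ] H, ‖cfc (lorentzian t s') C‖ ≤ 1 ∧ ‖cfc (lorentzian t s) C‖ ≤ 1 :=
    fun C ↦ ⟨norm_cfc_le zero_le_one fun x _ ↦ by
      rw [Real.norm_of_nonneg (lorentzian_nonneg _ _ _)]; exact lorentzian_le_one _ _ _,
      norm_cfc_le zero_le_one fun x _ ↦ by
      rw [Real.norm_of_nonneg (lorentzian_nonneg _ _ _)]; exact lorentzian_le_one _ _ _⟩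
  have hq : ∀ C : H →L[ℂ] H, ‖cfc (dispersive t s') C‖ ≤ 1 ∧ ‖cfc (dispersive t s) C‖ ≤ 1 :=
    fun C ↦ ⟨norm_cfc_le zero_le_one fun x _ ↦ abs_dispersive_le_one ht _ _,
      norm_cfc_le zero_le_one fun x _ ↦ abs_dispersive_le_one ht _ _⟩
  have hdp : ∀ C : H →L[ℂ] H,
      ‖cfc (lorentzian t s) C - cfc (lorentzian t s') C‖ ≤ |s - s'| / t := fun C ↦ by
    rw [← cfc_sub _ _ C (continuous_lorentzian ht s).continuousOn
      (continuous_lorentzian ht s').continuousOn]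
    exact norm_cfc_le (by positivity) fun x _ ↦ abs_lorentzian_sub_le ht s s' x
  have hdq : ∀ C : H →L[ℂ] H,
      ‖cfc (dispersive t s) C - cfc (dispersive t s') C‖ ≤ |s - s'| / t := fun C ↦ by
    rw [← cfc_sub _ _ C (continuous_dispersive ht s).continuousOn
      (continuous_dispersive ht s').continuousOn]
    exact norm_cfc_le (by positivity) fun x _ ↦ abs_dispersive_sub_le ht s s' x
  rw [smul_sub, smul_cfc_lorentzian_sub ht s hA hB, smul_cfc_lorentzian_sub ht s' hA hB]
  have hprod : ∀ {X X' Y Y' : H →L[ℂ] H}, ‖X - X'‖ ≤ |s - s'| / t → ‖Y - Y'‖ ≤ |s - s'| / t →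
      ‖Y‖ ≤ 1 → ‖X'‖ ≤ 1 →
      ‖X * (A - B) * Y - X' * (A - B) * Y'‖ ≤ 2 * (|s - s'| / t) * ‖A - B‖ := by
    intro X X' Y Y' h₁ h₂ h₃ h₄
    have e : X * (A - B) * Y - X' * (A - B) * Y'
        = (X - X') * (A - B) * Y + X' * (A - B) * (Y - Y') := by noncomm_ring
    rw [e]
    have i₁ : ‖(X - X') * (A - B) * Y‖ ≤ (|s - s'| / t) * ‖A - B‖ * 1 :=
      (norm_mul₃_le).trans (by gcongr)
    have i₂ : ‖X' * (A - B) * (Y - Y')‖ ≤ 1 * ‖A - B‖ * (|s - s'| / t) :=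
      (norm_mul₃_le).trans (by gcongr)
    linarith [norm_add_le ((X - X') * (A - B) * Y) (X' * (A - B) * (Y - Y'))]
  have k₁ := hprod (hdp B) (hdq A) (hq A).2 (hp B).1
  have k₂ := hprod (hdq B) (hdp A) (hp A).2 (hq B).1
  rw [add_sub_add_comm]
  linarith [norm_add_le_of_le k₁ k₂]

/-- A Riemann sum over octaves for `∫ (s² / (x² + s²) - s² / ((x - a)² + s²)) ds`. -/
noncomputable def octaveSum (M : ℕ) (s t x : ℝ) : ℝ :=
  ∑ k ∈ Finset.range M, 2 ^ k * (lorentzian (2 ^ k * t) 0 x - lorentzian (2 ^ k * t) s x)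

lemma continuous_octaveSum (M : ℕ) (s : ℝ) {t : ℝ} (ht : 0 < t) :
    Continuous (octaveSum M s t) :=
  continuous_finsetSum _ fun _ _ ↦ continuous_const.mul
    ((continuous_lorentzian (by positivity) 0).sub (continuous_lorentzian (by positivity) s))

lemma cfc_octaveSum (M : ℕ) (s : ℝ) {t : ℝ} (ht : 0 < t) (A : H →L[ℂ] H) :
    cfc (octaveSum M s t) A = ∑ k ∈ Finset.range M, (2 ^ k : ℝ) •
      (cfc (lorentzian (2 ^ k * t) 0) A - cfc (lorentzian (2 ^ k * t) s) A) := by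
  have hc : ∀ k : ℕ, ∀ a, Continuous (lorentzian (2 ^ k * t) a) := fun k a ↦
    continuous_lorentzian (by positivity) a
  have : octaveSum M s t = ∑ k ∈ Finset.range M,
      fun x ↦ 2 ^ k * (lorentzian (2 ^ k * t) 0 x - lorentzian (2 ^ k * t) s x) := by
    ext x; simp [octaveSum]
  rw [this, cfc_sum (fun (k : ℕ) x ↦
    2 ^ k * (lorentzian (2 ^ k * t) 0 x - lorentzian (2 ^ k * t) s x)) A _
    fun k _ ↦ (continuous_const.mul ((hc k 0).sub (hc k s))).continuousOn]
  refine Finset.sum_congr rfl fun k _ ↦ ?_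
  rw [cfc_const_mul (2 ^ k)
    (fun x ↦ lorentzian (2 ^ k * t) 0 x - lorentzian (2 ^ k * t) s x) A ((hc k 0).sub (hc k s)).continuousOn,
    cfc_sub _ _ A (hc k 0).continuousOn (hc k s).continuousOn]

lemma norm_smul_cfc_octaveSum_sub_le {t s : ℝ} (ht : 0 < t) {n M : ℕ} (hM : 2 ^ n ≤ M)
    (hs : |s| ≤ 2 ^ 2 ^ n * t) {A B : H →L[ℂ] H} (hA : IsSelfAdjoint A) (hB : IsSelfAdjoint B) :
    ‖t • (cfc (octaveSum M s t) A - cfc (octaveSum M s t) B)‖ ≤ 22 * (n + 1) * ‖A - B‖ := by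
  let D : ℝ → ℕ → H →L[ℂ] H := fun a k ↦ (2 ^ k * t) •
    (cfc (lorentzian (2 ^ k * t) a) B - cfc (lorentzian (2 ^ k * t) a) A)
  have hD : t • (cfc (octaveSum M s t) A - cfc (octaveSum M s t) B)
      = ∑ k ∈ Finset.range M, (D s k - D 0 k) := by
    rw [cfc_octaveSum M s ht, cfc_octaveSum M s ht, ← Finset.sum_sub_distrib, Finset.smul_sum]
    refine Finset.sum_congr rfl fun k _ ↦ ?_
    simp only [D, mul_comm _ t, mul_smul, ← smul_sub]
    congr 2
    abel
  rw [hD, ← Finset.sum_range_add_sum_Ico _ hM, Finset.sum_sub_distrib]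
  have h₁ := norm_sum_smul_cfc_lorentzian_sub_le ht s n hA hB
  have h₂ := norm_sum_smul_cfc_lorentzian_sub_le ht 0 n hA hB
  have h₃ : ‖∑ k ∈ Finset.Ico (2 ^ n) M, (D s k - D 0 k)‖ ≤ 8 * ‖A - B‖ := by
    have hterm : ∀ j ∈ Finset.range (M - 2 ^ n), ‖D s (2 ^ n + j) - D 0 (2 ^ n + j)‖
        ≤ 4 * ‖A - B‖ * (1 / 2) ^ j := fun j _ ↦ by
      have ht' : 0 < 2 ^ (2 ^ n + j) * t := by positivity
      have := norm_smul_cfc_lorentzian_sub_sub_le ht' s 0 hA hB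
      simp only [D, ← smul_sub]
      refine this.trans ?_
      have hle : |s - 0| / (2 ^ (2 ^ n + j) * t) ≤ (1 / 2) ^ j := by
        rw [sub_zero, div_le_iff₀ ht', pow_add, one_div, inv_pow]
        calc |s| ≤ 2 ^ 2 ^ n * t := hs
          _ = _ := by field_simp
      nlinarith [mul_le_mul_of_nonneg_right hle (norm_nonneg (A - B))]
    rw [Finset.sum_Ico_eq_sum_range]
    refine (norm_sum_le_of_le _ hterm).trans ?_
    rw [← Finset.mul_sum]
    have := sum_geometric_two_le (M - 2 ^ n)
    nlinarith [norm_nonneg (A - B)]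
  have h₄ := norm_sub_le (∑ k ∈ Finset.range (2 ^ n), D s k) (∑ k ∈ Finset.range (2 ^ n), D 0 k)
  have h₅ : 8 * ‖A - B‖ ≤ 8 * (n + 1) * ‖A - B‖ := by
    have : (0 : ℝ) ≤ n * ‖A - B‖ := by positivity
    nlinarith
  refine (norm_add_le _ _).trans ?_
  simp only [D] at *
  linarith

end TruncatedAbs


section Clamp

variable {H : Type*} [NormedAddCommGroup H] [InnerProductSpace ℂ H] [CompleteSpace H]

lemma abs_le_norm_of_mem_spectrum {A : H →L[ℂ] H} {x : ℝ} (hx : x ∈ spectrum ℝ A) : |x| ≤ ‖A‖ :=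
  (spectrum.norm_le_norm_mul_of_mem hx).trans
    (mul_le_of_le_one_right (norm_nonneg _) ContinuousLinearMap.norm_id_le)

lemma norm_cfc_sub_cfc_le {f g : ℝ → ℝ} (hf : Continuous f) (hg : Continuous g) {ε : ℝ}
    (hε : 0 ≤ ε) {A : H →L[ℂ] H} (h : ∀ x, |x| ≤ ‖A‖ → |f x - g x| ≤ ε) :
    ‖cfc f A - cfc g A‖ ≤ ε := by
  rw [← cfc_sub f g A hf.continuousOn hg.continuousOn]
  exact norm_cfc_le hε fun x hx ↦ h x (abs_le_norm_of_mem_spectrum hx)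

/-- An antiderivative in the width of the Lorentzian. -/
noncomputable def lorentzianPrimitive (s x t : ℝ) : ℝ := t - (x - s) * Real.arctan (t / (x - s))

lemma hasDerivAt_lorentzianPrimitive (s x : ℝ) {t : ℝ} (ht : 0 < t) :
    HasDerivAt (lorentzianPrimitive s x) (lorentzian t s x) t := by
  unfold lorentzianPrimitive lorentzian
  rcases eq_or_ne (x - s) 0 with h | h
  · have e : (fun t ↦ t - (x - s) * Real.arctan (t / (x - s))) = id := by
      ext; simp [h]
    rw [e, h]
    refine (hasDerivAt_id t).congr_deriv ?_
    field_simp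
    simp
  · have h₁ := ((hasDerivAt_id' t).div_const (x - s)).arctan.const_mul (x - s)
    refine ((hasDerivAt_id' t).sub h₁).congr_deriv ?_
    have : (x - s) ^ 2 + t ^ 2 ≠ 0 := by positivity
    have : 1 + (t / (x - s)) ^ 2 ≠ 0 := by positivity
    field_simp
    ring

lemma hasDerivAt_sum_lorentzianPrimitive (M : ℕ) (s x : ℝ) {t : ℝ} (ht : 0 < t) :
    HasDerivAt (fun t ↦ ∑ k ∈ Finset.range M,
        (lorentzianPrimitive 0 x (2 ^ k * t) - lorentzianPrimitive s x (2 ^ k * t)))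
      (octaveSum M s t x) t := by
  refine HasDerivAt.fun_sum fun k _ ↦ ?_
  have hk : 0 < 2 ^ k * t := by positivity
  have hlin : HasDerivAt (fun t : ℝ ↦ 2 ^ k * t) (2 ^ k) t := by
    simpa using (hasDerivAt_id t).const_mul (2 ^ k : ℝ)
  have h := ((hasDerivAt_lorentzianPrimitive 0 x hk).comp t hlin).sub
    ((hasDerivAt_lorentzianPrimitive s x hk).comp t hlin)
  exact h.congr_deriv (by ring)

lemma continuousOn_uncurry_octaveSum (M : ℕ) (s : ℝ) :
    ContinuousOn (Function.uncurry (octaveSum M s)) (Set.Ioi 0 ×ˢ Set.univ) := by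
  have : Function.uncurry (octaveSum M s) = fun z : ℝ × ℝ ↦ octaveSum M s z.1 z.2 := rfl
  rw [this]
  unfold octaveSum lorentzian
  refine continuousOn_finsetSum _ fun k _ ↦ continuousOn_const.mul (.sub ?_ ?_) <;>
  · refine ContinuousOn.div (by fun_prop) (by fun_prop) fun z hz ↦ ?_
    have : 0 < z.1 := hz.1
    positivity

lemma integral_octaveSum (M : ℕ) (s x : ℝ) {δ : ℝ} (hδ : 0 < δ) :
    ∫ t in Set.Ioc δ (2 * δ), octaveSum M s t x
      = (lorentzianPrimitive 0 x (2 ^ M * δ) - lorentzianPrimitive s x (2 ^ M * δ))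
        - (lorentzianPrimitive 0 x δ - lorentzianPrimitive s x δ) := by
  have hle : δ ≤ 2 * δ := by linarith
  have hpos : ∀ t ∈ Set.uIcc δ (2 * δ), 0 < t := fun t ht ↦ by
    rw [Set.uIcc_of_le hle] at ht
    exact hδ.trans_le ht.1
  rw [← intervalIntegral.integral_of_le hle, intervalIntegral.integral_eq_sub_of_hasDerivAt
    fun t ht ↦ hasDerivAt_sum_lorentzianPrimitive M s x (hpos t ht)]
  · rw [← Finset.sum_sub_distrib]
    have h := Finset.sum_range_sub (fun k : ℕ ↦
      lorentzianPrimitive 0 x (2 ^ k * δ) - lorentzianPrimitive s x (2 ^ k * δ)) M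
    simp only [pow_zero, one_mul] at h
    rw [← h]
    refine Finset.sum_congr rfl fun k _ ↦ ?_
    rw [pow_succ, mul_assoc]
  · refine ContinuousOn.intervalIntegrable ?_
    exact (continuousOn_uncurry_octaveSum M s).comp (f := fun t ↦ (t, x)) (by fun_prop)
      fun t ht ↦ ⟨hpos t ht, Set.mem_univ _⟩

lemma norm_octaveSum_le (M : ℕ) (s t x : ℝ) :
    ‖octaveSum M s t x‖ ≤ ∑ k ∈ Finset.range M, (2 : ℝ) ^ k := by
  refine norm_sum_le_of_le _ fun k _ ↦ ?_
  rw [norm_mul, Real.norm_of_nonneg (by positivity : (0 : ℝ) ≤ 2 ^ k)]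
  refine mul_le_of_le_one_right (by positivity) ?_
  rw [Real.norm_eq_abs, abs_le]
  constructor <;> linarith [lorentzian_nonneg (2 ^ k * t) 0 x, lorentzian_nonneg (2 ^ k * t) s x,
    lorentzian_le_one (2 ^ k * t) 0 x, lorentzian_le_one (2 ^ k * t) s x]

lemma continuous_integral_octaveSum (M : ℕ) (s : ℝ) {δ : ℝ} (hδ : 0 < δ) :
    Continuous fun x ↦ ∫ t in Set.Ioc δ (2 * δ), octaveSum M s t x := by
  have hcont := continuousOn_uncurry_octaveSum M s
  refine continuous_of_dominated (bound := fun _ ↦ ∑ k ∈ Finset.range M, (2 : ℝ) ^ k)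
    (fun x ↦ ContinuousOn.aestronglyMeasurable ?_ measurableSet_Ioc)
    (fun x ↦ .of_forall fun t ↦ norm_octaveSum_le M s t x) (integrable_const _) ?_
  · exact hcont.comp (f := fun t ↦ (t, x)) (by fun_prop)
      fun t ht ↦ ⟨hδ.trans ht.1, Set.mem_univ _⟩
  · exact ae_restrict_of_forall_mem measurableSet_Ioc fun t ht ↦
      continuous_octaveSum M s (hδ.trans ht.1)

lemma norm_cfc_integral_octaveSum_sub_le {δ s : ℝ} (hδ : 0 < δ) {n M : ℕ} (hM : 2 ^ n ≤ M)
    (hs : |s| ≤ 2 ^ 2 ^ n * δ) {A B : H →L[ℂ] H} (hA : IsSelfAdjoint A) (hB : IsSelfAdjoint B) :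
    ‖cfc (fun x ↦ ∫ t in Set.Ioc δ (2 * δ), octaveSum M s t x) A
      - cfc (fun x ↦ ∫ t in Set.Ioc δ (2 * δ), octaveSum M s t x) B‖
      ≤ 22 * (n + 1) * ‖A - B‖ := by
  have hcont : ∀ C : H →L[ℂ] H, ContinuousOn (Function.uncurry (octaveSum M s))
      (Set.Ioc δ (2 * δ) ×ˢ spectrum ℝ C) := fun C ↦
    (continuousOn_uncurry_octaveSum M s).mono
      (Set.prod_mono (fun t ht ↦ hδ.trans ht.1) (Set.subset_univ _))
  have hfin : HasFiniteIntegral (fun _ : ℝ ↦ ∑ k ∈ Finset.range M, (2 : ℝ) ^ k)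
      (volume.restrict (Set.Ioc δ (2 * δ))) := (integrable_const _).hasFiniteIntegral
  have hcfc : ∀ C : H →L[ℂ] H, IsSelfAdjoint C →
      cfc (fun x ↦ ∫ t in Set.Ioc δ (2 * δ), octaveSum M s t x) C
        = ∫ t in Set.Ioc δ (2 * δ), cfc (octaveSum M s t) C := fun C hC ↦
    cfc_setIntegral measurableSet_Ioc _ _ C (hcont C)
      (.of_forall fun t x _ ↦ norm_octaveSum_le M s t x) hfin hC
  have hint : ∀ C : H →L[ℂ] H, IsSelfAdjoint C →
      IntegrableOn (fun t ↦ cfc (octaveSum M s t) C) (Set.Ioc δ (2 * δ)) := fun C hC ↦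
    integrableOn_cfc measurableSet_Ioc _ _ C (hcont C)
      (.of_forall fun t x _ ↦ norm_octaveSum_le M s t x) hfin hC
  rw [hcfc A hA, hcfc B hB, ← integral_sub (hint A hA) (hint B hB)]
  have hle : ∀ t ∈ Set.Ioc δ (2 * δ), ‖cfc (octaveSum M s t) A - cfc (octaveSum M s t) B‖
      ≤ 22 * (n + 1) * ‖A - B‖ / δ := fun t ht ↦ by
    have ht₀ : 0 < t := hδ.trans ht.1
    have h := norm_smul_cfc_octaveSum_sub_le ht₀ hM (hs.trans (by gcongr; exact ht.1.le)) hA hB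
    rw [norm_smul, Real.norm_of_nonneg ht₀.le] at h
    rw [le_div_iff₀ hδ]
    nlinarith [mul_le_mul_of_nonneg_right ht.1.le
      (norm_nonneg (cfc (octaveSum M s t) A - cfc (octaveSum M s t) B))]
  refine (norm_setIntegral_le_of_norm_le_const measure_Ioc_lt_top hle).trans (le_of_eq ?_)
  rw [Real.volume_real_Ioc_of_le (by linarith)]
  field_simp
  ring

lemma arctan_le_self_of_nonneg {x : ℝ} (hx : 0 ≤ x) : Real.arctan x ≤ x := by
  have h := Real.le_tan (Real.arctan_nonneg.2 hx) (Real.arctan_lt_pi_div_two x)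
  rwa [Real.tan_arctan] at h

lemma mul_arctan_div_eq_abs (y t : ℝ) :
    y * Real.arctan (t / y) = |y| * Real.arctan (t / |y|) := by
  rcases abs_choice y with h | h <;> rw [h]
  rw [div_neg, Real.arctan_neg]
  ring

lemma abs_sub_mul_arctan_div_mem (y : ℝ) {t : ℝ} (ht : 0 < t) :
    0 ≤ Real.pi / 2 * |y| - y * Real.arctan (t / y)
      ∧ Real.pi / 2 * |y| - y * Real.arctan (t / y) ≤ y ^ 2 / t := by
  rw [mul_arctan_div_eq_abs, ← sq_abs y]
  rcases (abs_nonneg y).eq_or_lt with h | h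
  · simp [← h]
  · have e : Real.pi / 2 * |y| - |y| * Real.arctan (t / |y|) = |y| * Real.arctan (|y| / t) := by
      rw [← inv_div t |y|, Real.arctan_inv_of_pos (by positivity)]
      ring
    rw [e]
    have h₁ := arctan_le_self_of_nonneg (by positivity : 0 ≤ |y| / t)
    refine ⟨mul_nonneg h.le (Real.arctan_nonneg.2 (by positivity)), ?_⟩
    calc _ ≤ |y| * (|y| / t) := by gcongr
      _ = _ := by ring

lemma mul_arctan_div_mem (y : ℝ) {t : ℝ} (ht : 0 < t) :
    0 ≤ y * Real.arctan (t / y) ∧ y * Real.arctan (t / y) ≤ t := by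
  rw [mul_arctan_div_eq_abs]
  rcases (abs_nonneg y).eq_or_lt with h | h
  · simp [← h, ht.le]
  · have h₁ := arctan_le_self_of_nonneg (by positivity : 0 ≤ t / |y|)
    refine ⟨mul_nonneg h.le (Real.arctan_nonneg.2 (by positivity)), ?_⟩
    calc _ ≤ |y| * (t / |y|) := by gcongr
      _ = t := by field_simp

lemma abs_integral_octaveSum_sub_le (M : ℕ) (s x : ℝ) {δ : ℝ} (hδ : 0 < δ)
    (h₁ : x ^ 2 ≤ 2 ^ M * δ * δ) (h₂ : (x - s) ^ 2 ≤ 2 ^ M * δ * δ) :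
    |(∫ t in Set.Ioc δ (2 * δ), octaveSum M s t x) - Real.pi / 2 * (|x - s| - |x|)| ≤ 2 * δ := by
  have hT : 0 < 2 ^ M * δ := by positivity
  rw [integral_octaveSum M s x hδ]
  simp only [lorentzianPrimitive, sub_zero]
  have a₁ := abs_sub_mul_arctan_div_mem x hT
  have a₂ := abs_sub_mul_arctan_div_mem (x - s) hT
  have a₃ := mul_arctan_div_mem x hδ
  have a₄ := mul_arctan_div_mem (x - s) hδ
  have b₁ : x ^ 2 / (2 ^ M * δ) ≤ δ := by rw [div_le_iff₀ hT]; linarith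
  have b₂ : (x - s) ^ 2 / (2 ^ M * δ) ≤ δ := by rw [div_le_iff₀ hT]; linarith
  rw [abs_le]
  constructor <;> linarith

/-- The clamp `min (x⁺) s`. -/
noncomputable def clampAt (s x : ℝ) : ℝ := min (max x 0) s

lemma continuous_clampAt (s : ℝ) : Continuous (clampAt s) := by
  unfold clampAt; fun_prop

lemma clampAt_eq {s : ℝ} (hs : 0 ≤ s) (x : ℝ) : clampAt s x = s / 2 - (|x - s| - |x|) / 2 := by
  unfold clampAt
  rcases abs_cases x with ⟨e, h⟩ | ⟨e, h⟩ <;> rcases abs_cases (x - s) with ⟨e', h'⟩ | ⟨e', h'⟩ <;>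
    rw [e, e']
  · rw [max_eq_left h, min_eq_right (by linarith)]; ring
  · rw [max_eq_left h, min_eq_left (by linarith)]; ring
  · linarith
  · rw [max_eq_right h.le, min_eq_left hs]; ring

/-- The operator modulus of continuity of a clamp grows like an iterated logarithm. -/
lemma norm_cfc_clampAt_sub_le {δ s : ℝ} (hδ : 0 < δ) (hs₀ : 0 ≤ s) {n : ℕ}
    (hs : s ≤ 2 ^ 2 ^ n * δ) {A B : H →L[ℂ] H} (hA : IsSelfAdjoint A) (hB : IsSelfAdjoint B)
    (hAB : ‖A - B‖ ≤ δ) :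
    ‖cfc (clampAt s) A - cfc (clampAt s) B‖ ≤ 9 * (n + 1) * δ := by
  obtain ⟨M₀, hM₀⟩ := pow_unbounded_of_one_lt ((‖A‖ + ‖B‖ + s) ^ 2 / (δ * δ)) one_lt_two
  let M := max M₀ (2 ^ n)
  have hM : (‖A‖ + ‖B‖ + s) ^ 2 ≤ 2 ^ M * δ * δ := by
    rw [div_lt_iff₀ (by positivity), ← mul_assoc] at hM₀
    refine hM₀.le.trans ?_
    gcongr
    · exact one_le_two
    · exact le_max_left _ _
  let w : ℝ → ℝ := fun x ↦ ∫ t in Set.Ioc δ (2 * δ), octaveSum M s t x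
  have hw : Continuous w := continuous_integral_octaveSum M s hδ
  let g : ℝ → ℝ := fun x ↦ s / 2 - Real.pi⁻¹ * w x
  have hg : Continuous g := by fun_prop
  have hclose : ∀ x, |x| ≤ ‖A‖ + ‖B‖ → |clampAt s x - g x| ≤ 2 * δ / Real.pi := fun x hx ↦ by
    have hx' : |x - s| ≤ ‖A‖ + ‖B‖ + s := by
      refine (abs_sub _ _).trans ?_
      rw [abs_of_nonneg hs₀]
      linarith
    have h := abs_integral_octaveSum_sub_le M s x hδ
      (by rw [← sq_abs]; exact (by gcongr; linarith : |x| ^ 2 ≤ (‖A‖ + ‖B‖ + s) ^ 2).trans hM)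
      (by rw [← sq_abs]; exact (by gcongr : |x - s| ^ 2 ≤ (‖A‖ + ‖B‖ + s) ^ 2).trans hM)
    have e : clampAt s x - g x = (w x - Real.pi / 2 * (|x - s| - |x|)) / Real.pi := by
      rw [clampAt_eq hs₀]
      simp only [g]
      field_simp
      ring
    rw [e, abs_div, abs_of_pos Real.pi_pos]
    gcongr
  have hcA : ‖cfc (clampAt s) A - cfc g A‖ ≤ 2 * δ / Real.pi :=
    norm_cfc_sub_cfc_le (continuous_clampAt s) hg (by positivity)
      fun x hx ↦ hclose x (hx.trans (le_add_of_nonneg_right (norm_nonneg _)))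
  have hcB : ‖cfc (clampAt s) B - cfc g B‖ ≤ 2 * δ / Real.pi :=
    norm_cfc_sub_cfc_le (continuous_clampAt s) hg (by positivity)
      fun x hx ↦ hclose x (hx.trans (le_add_of_nonneg_left (norm_nonneg _)))
  have hgC : ∀ C : H →L[ℂ] H, IsSelfAdjoint C →
      cfc g C = algebraMap ℝ _ (s / 2) - Real.pi⁻¹ • cfc w C := fun C hC ↦ by
    rw [cfc_sub (fun _ ↦ s / 2) (fun x ↦ Real.pi⁻¹ * w x) C (by fun_prop) (by fun_prop),
      cfc_const _ C, cfc_const_mul _ w C hw.continuousOn]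
  have hgAB : ‖cfc g A - cfc g B‖ ≤ Real.pi⁻¹ * (22 * (n + 1) * δ) := by
    have e : cfc g A - cfc g B = -(Real.pi⁻¹ • (cfc w A - cfc w B)) := by
      rw [hgC A hA, hgC B hB, smul_sub]
      abel
    rw [e, norm_neg, norm_smul, Real.norm_of_nonneg (by positivity)]
    have := norm_cfc_integral_octaveSum_sub_le hδ (le_max_right M₀ (2 ^ n))
      (by rwa [abs_of_nonneg hs₀]) hA hB
    gcongr
    exact this.trans (by gcongr)
  have htotal : ‖cfc (clampAt s) A - cfc (clampAt s) B‖
      ≤ 2 * δ / Real.pi + Real.pi⁻¹ * (22 * (n + 1) * δ) + 2 * δ / Real.pi := by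
    have e : cfc (clampAt s) A - cfc (clampAt s) B = (cfc (clampAt s) A - cfc g A)
        + (cfc g A - cfc g B) - (cfc (clampAt s) B - cfc g B) := by abel
    rw [e]
    exact (norm_sub_le _ _).trans
      (add_le_add ((norm_add_le _ _).trans (add_le_add hcA hgAB)) hcB)
  refine htotal.trans ?_
  have e : 2 * δ / Real.pi + Real.pi⁻¹ * (22 * (n + 1) * δ) + 2 * δ / Real.pi
      = (4 + 22 * (n + 1)) * δ / Real.pi := by
    field_simp
    ring
  rw [e, div_le_iff₀ Real.pi_pos]
  have : 0 ≤ (n : ℝ) * δ := by positivity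
  nlinarith [Real.pi_gt_three, mul_le_mul_of_nonneg_left Real.pi_gt_three.le
    (by positivity : 0 ≤ 9 * (n + 1) * δ)]

end Clamp


section GridInterpolation

lemma norm_sum_smul_sub_le {E : Type*} [NormedAddCommGroup E] [NormedSpace ℝ E] {d : ℕ → ℝ}
    (hd : Antitone d) (hd₀ : ∀ i, 0 ≤ d i) {X : ℕ → E} {Φ : ℕ → ℝ} (hX₀ : X 0 = 0) (hΦ₀ : Φ 0 = 0)
    {N : ℕ} (hXΦ : ∀ i ≤ N, ‖X i‖ ≤ Φ i) :
    ‖∑ i ∈ Finset.range N, d i • (X (i + 1) - X i)‖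
      ≤ ∑ i ∈ Finset.range N, d i * (Φ (i + 1) - Φ i) := by
  have key : ∀ n ≤ N, ‖∑ i ∈ Finset.range n, d i • (X (i + 1) - X i) - d n • X n‖
      ≤ ∑ i ∈ Finset.range n, d i * (Φ (i + 1) - Φ i) - d n * Φ n := by
    intro n
    induction n with
    | zero => simp [hX₀, hΦ₀]
    | succ n ih =>
      intro hn
      have e : ∑ i ∈ Finset.range (n + 1), d i • (X (i + 1) - X i) - d (n + 1) • X (n + 1)
          = (∑ i ∈ Finset.range n, d i • (X (i + 1) - X i) - d n • X n)
            + (d n - d (n + 1)) • X (n + 1) := by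
        rw [Finset.sum_range_succ, sub_smul, smul_sub]
        abel
      have h₁ : ‖(d n - d (n + 1)) • X (n + 1)‖ ≤ (d n - d (n + 1)) * Φ (n + 1) := by
        have : 0 ≤ d n - d (n + 1) := sub_nonneg.2 (hd n.le_succ)
        rw [norm_smul, Real.norm_of_nonneg this]
        gcongr
        exact hXΦ _ hn
      rw [e, Finset.sum_range_succ]
      refine (norm_add_le_of_le (ih (by omega)) h₁).trans (le_of_eq ?_)
      ring
  have h₁ := key N le_rfl
  have h₂ : ‖d N • X N‖ ≤ d N * Φ N := by
    rw [norm_smul, Real.norm_of_nonneg (hd₀ N)]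
    exact mul_le_mul_of_nonneg_left (hXΦ N le_rfl) (hd₀ N)
  have h₃ := norm_add_le_of_le h₁ h₂
  rw [sub_add_cancel, sub_add_cancel] at h₃
  exact h₃

lemma sum_mul_min_sub_min (a : ℕ → ℝ) {j N : ℕ} (hj : j ≤ N) :
    ∑ i ∈ Finset.range N, (a (i + 1) - a i) * (min ((i + 1 : ℕ) : ℝ) j - min (i : ℝ) j)
      = a j - a 0 := by
  rw [← Finset.sum_range_add_sum_Ico _ hj, ← Finset.sum_range_sub]
  have h₁ : ∀ i ∈ Finset.range j,
      (a (i + 1) - a i) * (min ((i + 1 : ℕ) : ℝ) j - min (i : ℝ) j) = a (i + 1) - a i := by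
    intro i hi
    have hi' := Finset.mem_range.1 hi
    rw [min_eq_left (by exact_mod_cast hi'), min_eq_left (by exact_mod_cast hi'.le)]
    push_cast
    ring
  have h₂ : ∀ i ∈ Finset.Ico j N,
      (a (i + 1) - a i) * (min ((i + 1 : ℕ) : ℝ) j - min (i : ℝ) j) = 0 := by
    intro i hi
    have hi' := (Finset.mem_Ico.1 hi).1
    rw [min_eq_right (by exact_mod_cast hi'.trans i.le_succ), min_eq_right (by exact_mod_cast hi')]
    ring
  rw [Finset.sum_congr rfl h₁, Finset.sum_eq_zero h₂, add_zero]

lemma monotone_clampAt_sub {s s' : ℝ} (h : s ≤ s') :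
    Monotone fun x ↦ clampAt s' x - clampAt s x := by
  intro x y hxy
  simp only [clampAt]
  have hm : max x 0 ≤ max y 0 := max_le_max_right 0 hxy
  generalize max x 0 = u at hm
  generalize max y 0 = v at hm
  rcases min_cases u s' with ⟨e₁, _⟩ | ⟨e₁, _⟩ <;> rcases min_cases u s with ⟨e₂, _⟩ | ⟨e₂, _⟩ <;>
    rcases min_cases v s' with ⟨e₃, _⟩ | ⟨e₃, _⟩ <;>
    rcases min_cases v s with ⟨e₄, _⟩ | ⟨e₄, _⟩ <;> rw [e₁, e₂, e₃, e₄] <;> linarith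

lemma clampAt_of_nonpos {s x : ℝ} (hs : 0 ≤ s) (hx : x ≤ 0) : clampAt s x = 0 := by
  rw [clampAt, max_eq_right hx, min_eq_left hs]

lemma clampAt_natCast_mul {δ : ℝ} (hδ : 0 ≤ δ) (i j : ℕ) :
    clampAt (i * δ) (j * δ) = min (i : ℝ) j * δ := by
  rw [clampAt, max_eq_left (by positivity), min_comm, min_mul_of_nonneg _ _ hδ]

/-- Piecewise linear interpolation of `f` at the first `N` points of the grid of step `δ`,
written in terms of clamps. -/
noncomputable def gridInterp (f : ℝ → ℝ) (δ : ℝ) (N : ℕ) (x : ℝ) : ℝ :=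
  ∑ i ∈ Finset.range N, (f ((i + 1 : ℕ) * δ) - f (i * δ)) / δ
    * (clampAt ((i + 1 : ℕ) * δ) x - clampAt (i * δ) x)

lemma continuous_gridInterp (f : ℝ → ℝ) (δ : ℝ) (N : ℕ) : Continuous (gridInterp f δ N) :=
  continuous_finsetSum _ fun _ _ ↦
    continuous_const.mul ((continuous_clampAt _).sub (continuous_clampAt _))

lemma gridInterp_natCast_mul (f : ℝ → ℝ) {δ : ℝ} (hδ : 0 < δ) {j N : ℕ} (hj : j ≤ N) :
    gridInterp f δ N (j * δ) = f (j * δ) - f 0 := by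
  have h := sum_mul_min_sub_min (fun i ↦ f (i * δ)) hj
  simp only [Nat.cast_zero, zero_mul] at h
  rw [← h, gridInterp]
  refine Finset.sum_congr rfl fun i _ ↦ ?_
  rw [clampAt_natCast_mul hδ.le, clampAt_natCast_mul hδ.le]
  field_simp

lemma monotone_gridInterp {f : ℝ → ℝ} (hf : Monotone f) {δ : ℝ} (hδ : 0 < δ) (N : ℕ) :
    Monotone (gridInterp f δ N) := by
  intro x y hxy
  refine Finset.sum_le_sum fun i _ ↦ mul_le_mul_of_nonneg_left ?_ ?_
  · exact monotone_clampAt_sub (by push_cast; nlinarith) hxy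
  · exact div_nonneg (sub_nonneg.2 (hf (by push_cast; nlinarith))) hδ.le

lemma antitone_sub_grid {f : ℝ → ℝ} (hconc : ConcaveOn ℝ (Set.Ici 0) f) {δ : ℝ} (hδ : 0 < δ) :
    Antitone fun i : ℕ ↦ f ((i + 1 : ℕ) * δ) - f (i * δ) := by
  refine antitone_nat_of_succ_le fun i ↦ ?_
  have hmem : ∀ k : ℕ, (k * δ : ℝ) ∈ Set.Ici (0 : ℝ) := fun k ↦
    Set.mem_Ici.2 (by positivity)
  have h := hconc.2 (hmem i) (hmem (i + 1 + 1)) (by norm_num : (0 : ℝ) ≤ 1 / 2)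
    (by norm_num : (0 : ℝ) ≤ 1 / 2) (by norm_num)
  have e : (1 / 2 : ℝ) • (i * δ) + (1 / 2 : ℝ) • (((i + 1 + 1 : ℕ) : ℝ) * δ)
      = ((i + 1 : ℕ) : ℝ) * δ := by
    simp only [smul_eq_mul]
    push_cast
    ring
  rw [e] at h
  simp only [smul_eq_mul] at h
  linarith

lemma abs_sub_gridInterp_le {f : ℝ → ℝ} (hf : Monotone f) (hf₀ : ∀ t ≤ 0, f t = 0)
    (hconc : ConcaveOn ℝ (Set.Ici 0) f) {δ : ℝ} (hδ : 0 < δ) {N : ℕ} {x : ℝ} (hx : x < N * δ) :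
    |f x - gridInterp f δ N x| ≤ f δ := by
  rcases le_or_gt x 0 with hx₀ | hx₀
  · have : gridInterp f δ N x = 0 := Finset.sum_eq_zero fun i _ ↦ by
      rw [clampAt_of_nonpos (by positivity) hx₀, clampAt_of_nonpos (by positivity) hx₀]
      ring
    rw [this, hf₀ x hx₀, sub_zero, abs_zero]
    exact (hf₀ 0 le_rfl).symm.trans_le (hf hδ.le)
  · set j := ⌊x / δ⌋₊
    have hj₁ : j * δ ≤ x := (le_div_iff₀ hδ).1 (Nat.floor_le (by positivity))
    have hj₂ : x ≤ (j + 1 : ℕ) * δ := by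
      push_cast
      exact ((div_lt_iff₀ hδ).1 (Nat.lt_floor_add_one _)).le
    have hjN : j < N := by
      have : (j : ℝ) < N := lt_of_mul_lt_mul_right (hj₁.trans_lt hx) hδ.le
      exact_mod_cast this
    have g₁ := monotone_gridInterp hf hδ N hj₁
    have g₂ := monotone_gridInterp hf hδ N hj₂
    rw [gridInterp_natCast_mul f hδ hjN.le, hf₀ 0 le_rfl] at g₁
    rw [gridInterp_natCast_mul f hδ hjN, hf₀ 0 le_rfl] at g₂
    have f₁ := hf hj₁
    have f₂ := hf hj₂
    have hd := antitone_sub_grid hconc hδ j.zero_le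
    simp only [zero_add, Nat.cast_one, one_mul, Nat.cast_zero, zero_mul, hf₀ 0 le_rfl] at hd
    rw [abs_le]
    constructor <;> linarith

end GridInterpolation

section Modulus

variable {H : Type*} [NormedAddCommGroup H] [InnerProductSpace ℂ H] [CompleteSpace H]

/-- A superposition of the functions `min · t` over the sparse scales `t = 1` and
`t = 2 ^ 2 ^ k`; it grows like an iterated logarithm. -/
noncomputable def sparseScaleSum (J i : ℕ) : ℝ :=
  min (i : ℝ) (1 : ℕ)
    + ∑ k ∈ Finset.range J, (2 ^ 2 ^ k : ℝ)⁻¹ * min (i : ℝ) (2 ^ 2 ^ k : ℕ)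

lemma sparseScaleSum_zero (J : ℕ) : sparseScaleSum J 0 = 0 := by
  simp [sparseScaleSum]

lemma exists_le_two_pow_two_pow {J i : ℕ} (hi : 1 ≤ i) (hiJ : i ≤ 2 ^ 2 ^ J) :
    ∃ n : ℕ, i ≤ 2 ^ 2 ^ n ∧ (n + 1 : ℝ) ≤ sparseScaleSum J i := by
  classical
  have hex : ∃ n : ℕ, i ≤ 2 ^ 2 ^ n := ⟨J, hiJ⟩
  refine ⟨Nat.find hex, Nat.find_spec hex, ?_⟩
  have hnJ : Nat.find hex ≤ J := Nat.find_le hiJ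
  have hsum : (Nat.find hex : ℝ)
      ≤ ∑ k ∈ Finset.range J, (2 ^ 2 ^ k : ℝ)⁻¹ * min (i : ℝ) (2 ^ 2 ^ k : ℕ) := by
    calc (Nat.find hex : ℝ) = ∑ k ∈ Finset.range (Nat.find hex), (1 : ℝ) := by simp
      _ ≤ ∑ k ∈ Finset.range (Nat.find hex),
            (2 ^ 2 ^ k : ℝ)⁻¹ * min (i : ℝ) (2 ^ 2 ^ k : ℕ) := by
          refine Finset.sum_le_sum fun k hk ↦ ?_
          have hlt := not_le.1 (Nat.find_min hex (Finset.mem_range.1 hk))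
          rw [min_eq_right (by exact_mod_cast hlt.le)]
          push_cast
          rw [inv_mul_cancel₀ (by positivity)]
      _ ≤ _ := Finset.sum_le_sum_of_subset_of_nonneg (Finset.range_mono hnJ)
          fun k _ _ ↦ by positivity
  have hmin : min (i : ℝ) (1 : ℕ) = 1 := by
    rw [min_eq_right (by exact_mod_cast hi), Nat.cast_one]
  rw [sparseScaleSum, hmin]
  linarith

lemma norm_cfc_clampAt_natCast_mul_sub_le {δ : ℝ} (hδ : 0 < δ) {J i : ℕ} (hiJ : i ≤ 2 ^ 2 ^ J)
    {A B : H →L[ℂ] H} (hA : IsSelfAdjoint A) (hB : IsSelfAdjoint B) (hAB : ‖A - B‖ ≤ δ) :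
    ‖cfc (clampAt (i * δ)) A - cfc (clampAt (i * δ)) B‖ ≤ 9 * δ * sparseScaleSum J i := by
  rcases i.eq_zero_or_pos with rfl | hi
  · have : clampAt (((0 : ℕ) : ℝ) * δ) = fun _ ↦ 0 := by
      ext x
      simp [clampAt]
    rw [this, cfc_const_zero, cfc_const_zero]
    simp [sparseScaleSum_zero]
  · obtain ⟨n, hn, hnΦ⟩ := exists_le_two_pow_two_pow hi hiJ
    have hs : (i : ℝ) * δ ≤ 2 ^ 2 ^ n * δ := by
      gcongr
      exact_mod_cast hn
    refine (norm_cfc_clampAt_sub_le hδ (by positivity) hs hA hB hAB).trans ?_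
    calc 9 * (n + 1 : ℝ) * δ = 9 * δ * (n + 1) := by ring
      _ ≤ _ := by gcongr

lemma norm_cfc_gridInterp_sub_le {f : ℝ → ℝ} (hf : Monotone f) (hf₀ : f 0 = 0)
    (hconc : ConcaveOn ℝ (Set.Ici 0) f) {δ : ℝ} (hδ : 0 < δ) (J : ℕ)
    {A B : H →L[ℂ] H} (hA : IsSelfAdjoint A) (hB : IsSelfAdjoint B) (hAB : ‖A - B‖ ≤ δ) :
    ‖cfc (gridInterp f δ (2 ^ 2 ^ J)) A - cfc (gridInterp f δ (2 ^ 2 ^ J)) B‖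
      ≤ 9 * (f δ + ∑ k ∈ Finset.range J, (2 ^ 2 ^ k : ℝ)⁻¹ * f (2 ^ 2 ^ k * δ)) := by
  let N : ℕ := 2 ^ 2 ^ J
  let d : ℕ → ℝ := fun i ↦ f ((i + 1 : ℕ) * δ) - f (i * δ)
  let X : ℕ → H →L[ℂ] H := fun i ↦ cfc (clampAt (i * δ)) A - cfc (clampAt (i * δ)) B
  have hcfc : ∀ C : H →L[ℂ] H, cfc (gridInterp f δ N) C = ∑ i ∈ Finset.range N,
      (d i / δ) • (cfc (clampAt ((i + 1 : ℕ) * δ)) C - cfc (clampAt (i * δ)) C) := fun C ↦ by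
    have hc := fun s ↦ (continuous_clampAt s).continuousOn (s := spectrum ℝ C)
    have e : gridInterp f δ N = ∑ i ∈ Finset.range N, fun x ↦
        d i / δ * (clampAt ((i + 1 : ℕ) * δ) x - clampAt (i * δ) x) := by
      ext x; simp [gridInterp, d]
    rw [e, cfc_sum (fun (i : ℕ) x ↦ d i / δ * (clampAt ((i + 1 : ℕ) * δ) x - clampAt (i * δ) x))
      C _ fun i _ ↦ continuousOn_const.mul ((hc _).sub (hc _))]
    refine Finset.sum_congr rfl fun i _ ↦ ?_
    rw [cfc_const_mul (d i / δ) (fun x ↦ clampAt ((i + 1 : ℕ) * δ) x - clampAt (i * δ) x) C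
      ((hc _).sub (hc _)), cfc_sub _ _ C (hc _) (hc _)]
  have hX : cfc (gridInterp f δ N) A - cfc (gridInterp f δ N) B
      = ∑ i ∈ Finset.range N, (d i / δ) • (X (i + 1) - X i) := by
    rw [hcfc A, hcfc B, ← Finset.sum_sub_distrib]
    refine Finset.sum_congr rfl fun i _ ↦ ?_
    rw [← smul_sub]
    congr 1
    simp only [X]
    abel
  have hd : Antitone fun i ↦ d i / δ := fun i j hij ↦
    div_le_div_of_nonneg_right (antitone_sub_grid hconc hδ hij) hδ.le
  have hd₀ : ∀ i, 0 ≤ d i / δ := fun i ↦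
    div_nonneg (sub_nonneg.2 (hf (by push_cast; nlinarith))) hδ.le
  have hbound : ∀ i ≤ N, ‖X i‖ ≤ 9 * δ * sparseScaleSum J i := fun i hi ↦
    norm_cfc_clampAt_natCast_mul_sub_le hδ hi hA hB hAB
  have hX₀ : X 0 = 0 := by
    simpa [sparseScaleSum_zero] using hbound 0 N.zero_le
  rw [hX]
  refine (norm_sum_smul_sub_le hd hd₀ hX₀ (by simp [sparseScaleSum_zero]) hbound).trans
    (le_of_eq ?_)
  have hgrid : ∀ j ≤ N, ∑ i ∈ Finset.range N,
      d i * (min ((i + 1 : ℕ) : ℝ) j - min (i : ℝ) j) = f (j * δ) := fun j hj ↦ by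
    have h := sum_mul_min_sub_min (fun i ↦ f (i * δ)) hj
    simpa [hf₀, d] using h
  have hterm : ∀ i : ℕ, d i / δ * (9 * δ * sparseScaleSum J (i + 1) - 9 * δ * sparseScaleSum J i)
      = 9 * (d i * (min ((i + 1 : ℕ) : ℝ) (1 : ℕ) - min (i : ℝ) (1 : ℕ))
        + ∑ k ∈ Finset.range J, (2 ^ 2 ^ k : ℝ)⁻¹
          * (d i * (min ((i + 1 : ℕ) : ℝ) (2 ^ 2 ^ k : ℕ) - min (i : ℝ) (2 ^ 2 ^ k : ℕ)))) := by
    intro i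
    have e : ∑ k ∈ Finset.range J, (2 ^ 2 ^ k : ℝ)⁻¹
          * (d i * (min ((i + 1 : ℕ) : ℝ) (2 ^ 2 ^ k : ℕ) - min (i : ℝ) (2 ^ 2 ^ k : ℕ)))
        = d i * (∑ k ∈ Finset.range J, (2 ^ 2 ^ k : ℝ)⁻¹ * min ((i + 1 : ℕ) : ℝ) (2 ^ 2 ^ k : ℕ)
          - ∑ k ∈ Finset.range J, (2 ^ 2 ^ k : ℝ)⁻¹ * min (i : ℝ) (2 ^ 2 ^ k : ℕ)) := by
      rw [← Finset.sum_sub_distrib, Finset.mul_sum]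
      refine Finset.sum_congr rfl fun k _ ↦ ?_
      ring
    rw [e, sparseScaleSum, sparseScaleSum]
    field_simp
    ring
  rw [Finset.sum_congr rfl fun i _ ↦ hterm i, ← Finset.mul_sum, Finset.sum_add_distrib,
    hgrid 1 Nat.one_le_two_pow, Finset.sum_comm, Nat.cast_one, one_mul]
  congr 2
  refine Finset.sum_congr rfl fun k hk ↦ ?_
  rw [← Finset.mul_sum, hgrid (2 ^ 2 ^ k)]
  · push_cast
    rfl
  · have := (Finset.mem_range.1 hk).le
    simp only [N]
    gcongr <;> norm_num

lemma one_add_sum_two_rpow_le {β : ℝ} (hβ₀ : 0 < β) (hβ₁ : β ≤ 1) (J : ℕ) :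
    1 + ∑ k ∈ Finset.range J, (2 : ℝ) ^ (-(2 ^ k * β)) ≤ 5 * Real.log (2 / β) := by
  set m := ⌈Real.logb 2 (1 / β)⌉₊
  have hlogb : 0 ≤ Real.logb 2 (1 / β) :=
    Real.logb_nonneg one_lt_two (by rw [le_div_iff₀ hβ₀]; linarith)
  have hm₁ : (m : ℝ) < Real.logb 2 (1 / β) + 1 := Nat.ceil_lt_add_one hlogb
  have hm₂ : 1 ≤ 2 ^ m * β := by
    have h : Real.logb 2 (1 / β) ≤ m := Nat.le_ceil _
    rw [Real.logb_le_iff_le_rpow one_lt_two (by positivity), Real.rpow_natCast,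
      div_le_iff₀ hβ₀] at h
    exact h
  have hle : ∑ k ∈ Finset.range J, (2 : ℝ) ^ (-(2 ^ k * β)) ≤ m + 1 := by
    calc _ ≤ ∑ k ∈ Finset.range (m + J), (2 : ℝ) ^ (-(2 ^ k * β)) :=
          Finset.sum_le_sum_of_subset_of_nonneg (Finset.range_mono (by omega))
            fun k _ _ ↦ by positivity
      _ = ∑ k ∈ Finset.range m, (2 : ℝ) ^ (-(2 ^ k * β))
          + ∑ i ∈ Finset.range J, (2 : ℝ) ^ (-(2 ^ (m + i) * β)) := Finset.sum_range_add _ _ _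
      _ ≤ ∑ k ∈ Finset.range m, (1 : ℝ) + ∑ i ∈ Finset.range J, 1 / 2 * (1 / 2 : ℝ) ^ i := by
          gcongr with k _ i _
          · exact Real.rpow_le_one_of_one_le_of_nonpos one_le_two
              (neg_nonpos.2 (by positivity))
          · have h₁ : (i + 1 : ℝ) ≤ 2 ^ (m + i) * β := by
              have : (i + 1 : ℝ) ≤ 2 ^ i := by exact_mod_cast i.lt_two_pow_self
              rw [pow_add]
              nlinarith [mul_le_mul_of_nonneg_right hm₂ (by positivity : (0 : ℝ) ≤ 2 ^ i)]
            calc (2 : ℝ) ^ (-(2 ^ (m + i) * β)) ≤ (2 : ℝ) ^ (-(i + 1 : ℝ)) :=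
                  Real.rpow_le_rpow_of_exponent_le one_le_two (neg_le_neg h₁)
              _ = 1 / 2 * (1 / 2 : ℝ) ^ i := by
                  rw [Real.rpow_neg zero_le_two]
                  have : (2 : ℝ) ^ (i + 1 : ℝ) = 2 ^ (i + 1) := by
                    exact_mod_cast Real.rpow_natCast 2 (i + 1)
                  rw [this, pow_succ, one_div, inv_pow, mul_inv, mul_comm]
      _ ≤ m + 1 := by
          rw [← Finset.mul_sum]
          have := sum_geometric_two_le J
          simp only [Finset.sum_const, Finset.card_range, nsmul_eq_mul, mul_one]
          linarith
  have hlog2 : 0.69 < Real.log 2 := by linarith [Real.log_two_gt_d9]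
  have e₁ : Real.logb 2 (1 / β) * Real.log 2 = Real.log (1 / β) := by
    rw [Real.logb]
    field_simp
  have e₂ : Real.log (2 / β) = Real.log 2 + Real.log (1 / β) := by
    rw [← Real.log_mul two_ne_zero (by positivity)]
    congr 1
    ring
  rw [e₂, ← e₁]
  nlinarith

end Modulus

theorem stmt9 :
    ∃ C : ℝ, 0 < C ∧
      ∀ α L : ℝ, 0 ≤ α → α < 1 → 0 < L →
        ∀ f : ℝ → ℝ, Continuous f → Monotone f → (∀ t ≤ (0 : ℝ), f t = 0) →
          ConcaveOn ℝ (Set.Ici 0) f →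
          (∀ x y : ℝ, |f x - f y| ≤ L * |x - y| ^ α) →
          ∀ δ : ℝ, 0 < δ →
          ∀ (H : Type) [NormedAddCommGroup H] [InnerProductSpace ℂ H] [CompleteSpace H]
            (A B : H →L[ℂ] H), IsSelfAdjoint A → IsSelfAdjoint B → ‖A - B‖ ≤ δ →
            ‖cfc f A - cfc f B‖ ≤ C * Real.log (2 / (1 - α)) * L * δ ^ α := by
  refine ⟨55, by norm_num, ?_⟩
  intro α L hα₀ hα₁ hL f hfc hf hf₀ hconc hhol δ hδ H _ _ _ A B hA hB hAB
  obtain ⟨J, hJ⟩ : ∃ J : ℕ, (‖A‖ + ‖B‖) / δ < 2 ^ 2 ^ J := by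
    obtain ⟨J, hJ⟩ := pow_unbounded_of_one_lt ((‖A‖ + ‖B‖) / δ) one_lt_two
    exact ⟨J, hJ.trans (pow_lt_pow_right₀ one_lt_two J.lt_two_pow_self)⟩
  rw [div_lt_iff₀ hδ] at hJ
  have hfle : ∀ t, 0 ≤ t → f t ≤ L * t ^ α := fun t ht ↦ by
    have h := (le_abs_self _).trans (hhol t 0)
    rwa [hf₀ 0 le_rfl, sub_zero, sub_zero, abs_of_nonneg ht] at h
  let g := gridInterp f δ (2 ^ 2 ^ J)
  have hfδ₀ : 0 ≤ f δ := (hf₀ 0 le_rfl).symm.trans_le (hf hδ.le)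
  have happrox : ∀ C : H →L[ℂ] H, ‖C‖ ≤ ‖A‖ + ‖B‖ → ‖cfc f C - cfc g C‖ ≤ f δ := fun C hC ↦
    norm_cfc_sub_cfc_le hfc (continuous_gridInterp _ _ _) hfδ₀ fun x hx ↦
      abs_sub_gridInterp_le hf hf₀ hconc hδ
        (((le_abs_self x).trans (hx.trans hC)).trans_lt (by exact_mod_cast hJ))
  have h₁ := happrox A (le_add_of_nonneg_right (norm_nonneg _))
  have h₂ := happrox B (le_add_of_nonneg_left (norm_nonneg _))
  have h₃ : ‖cfc g A - cfc g B‖ ≤ _ :=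
    norm_cfc_gridInterp_sub_le hf (hf₀ 0 le_rfl) hconc hδ J hA hB hAB
  have hterm : ∀ k ∈ Finset.range J, (2 ^ 2 ^ k : ℝ)⁻¹ * f (2 ^ 2 ^ k * δ)
      ≤ L * δ ^ α * (2 : ℝ) ^ (-(2 ^ k * (1 - α))) := fun k _ ↦ by
    have e₀ : (2 ^ 2 ^ k : ℝ) = (2 : ℝ) ^ (2 ^ k : ℝ) := by
      exact_mod_cast (Real.rpow_natCast 2 (2 ^ k)).symm
    have e₁ : (2 ^ 2 ^ k : ℝ)⁻¹ * (2 ^ 2 ^ k : ℝ) ^ α = (2 : ℝ) ^ (-(2 ^ k * (1 - α))) := by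
      rw [e₀, ← Real.rpow_neg zero_le_two, ← Real.rpow_mul zero_le_two,
        ← Real.rpow_add two_pos]
      congr 1
      ring
    rw [← e₁]
    calc _ ≤ (2 ^ 2 ^ k : ℝ)⁻¹ * (L * (2 ^ 2 ^ k * δ) ^ α) := by
          gcongr
          exact hfle _ (by positivity)
      _ = _ := by
          rw [Real.mul_rpow (by positivity) hδ.le]
          ring
  have hsum := Finset.sum_le_sum hterm
  rw [← Finset.mul_sum] at hsum
  have hlog := one_add_sum_two_rpow_le (sub_pos.2 hα₁) (by linarith) J
  have hS₀ : 0 ≤ ∑ k ∈ Finset.range J, (2 : ℝ) ^ (-(2 ^ k * (1 - α))) :=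
    Finset.sum_nonneg fun k _ ↦ by positivity
  have hP : 0 ≤ L * δ ^ α := by positivity
  have hfδ := hfle δ hδ.le
  have htri : ‖cfc f A - cfc f B‖ ≤ f δ
      + 9 * (f δ + ∑ k ∈ Finset.range J, (2 ^ 2 ^ k : ℝ)⁻¹ * f (2 ^ 2 ^ k * δ)) + f δ := by
    have e : cfc f A - cfc f B
        = (cfc f A - cfc g A) + (cfc g A - cfc g B) - (cfc f B - cfc g B) := by abel
    rw [e]
    exact (norm_sub_le _ _).trans (add_le_add ((norm_add_le _ _).trans (add_le_add h₁ h₃)) h₂)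
  have hone : L * δ ^ α * (1 + ∑ k ∈ Finset.range J, (2 : ℝ) ^ (-(2 ^ k * (1 - α))))
      ≤ L * δ ^ α * (5 * Real.log (2 / (1 - α))) := by gcongr
  nlinarith [mul_nonneg hP hS₀]
end

section
/- Let 𝔉 be a closed subset of ℝ which is unbounded, i.e., for every R > 0 there exists t ∈ 𝔉 with |t| > R, and let f : ℝ → ℂ be continuous. Suppose there is M ∈ ℝ such that ‖f(A) − f(B)‖ ≤ M for all bounded self-adjoint operators A, B on ℓ²(ℕ, ℂ) whose spectra are contained in 𝔉 and which satisfy ‖A − B‖ ≤ 1. Then there exists L ∈ ℂ such that f(t)/t → L as |t| → ∞ along 𝔉; that is, for every ε > 0 there is R > 0 such that |f(t)/t − L| ≤ ε for all t ∈ 𝔉 with |t| ≥ R. -/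
open MeasureTheory ENNReal

/-- Application of a function `f : ℝ → ℂ` to a (self-adjoint) operator via the
continuous functional calculus. -/
noncomputable def cfcC {H : Type} [NormedAddCommGroup H] [InnerProductSpace ℂ H]
    [CompleteSpace H] (f : ℝ → ℂ) (A : H →L[ℂ] H) : H →L[ℂ] H :=
  cfc (fun z : ℂ => f z.re) A

/-- The Cayley transform of a small self-adjoint `K` is a unitary `U` for which `U T U* - T` is
comparable in norm with the commutator of `K` and `T`. -/
theorem IsSelfAdjoint.exists_unitary_conj_sub_norm_le {𝒜 : Type*} [CStarAlgebra 𝒜] [Nontrivial 𝒜]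
    {K : 𝒜} (hK : IsSelfAdjoint K) (hK' : ‖K‖ ≤ 1 / 2) :
    ∃ U : unitary 𝒜, ∀ T : 𝒜, ‖(U : 𝒜) * T * star (U : 𝒜) - T‖ ≤ 8 * ‖K * T - T * K‖ ∧
      ‖K * T - T * K‖ ≤ 2 * ‖(U : 𝒜) * T * star (U : 𝒜) - T‖ := by
  set J : 𝒜 := Complex.I • K with hJ
  have hJn : ‖J‖ ≤ 1 / 2 := by simpa [hJ, norm_smul] using hK'
  have hJs : star J = -J := by simp [hJ, hK.star_eq]
  obtain ⟨u, hu⟩ : IsUnit (1 - J) := isUnit_one_sub_of_norm_lt_one (by linarith)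
  set W : 𝒜 := ↑u⁻¹ with hW
  have h1 : W * (1 - J) = 1 := by rw [hW, ← hu]; simp
  have h2 : (1 - J) * W = 1 := by rw [hW, ← hu]; simp
  have hWJ : W * J = J * W := by
    linear_combination (norm := noncomm_ring) h2 - h1
  have hWs1 : star W * (1 + J) = 1 := by
    have := congrArg star h2
    simpa [hJs] using this
  have hWs2 : (1 + J) * star W = 1 := by
    have := congrArg star h1
    simpa [hJs] using this
  have hWn : ‖W‖ ≤ 2 := by
    have e : W = 1 + W * J := by linear_combination (norm := noncomm_ring) h1
    have : ‖W‖ ≤ 1 + ‖W‖ * (1 / 2) := by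
      calc ‖W‖ = ‖1 + W * J‖ := by rw [← e]
        _ ≤ ‖(1 : 𝒜)‖ + ‖W * J‖ := norm_add_le _ _
        _ ≤ 1 + ‖W‖ * (1 / 2) := by
          rw [norm_one]
          gcongr
          exact (norm_mul_le _ _).trans (by gcongr)
    linarith
  have hUs : star ((1 + J) * W) = star W * (1 - J) := by simp [hJs, sub_eq_add_neg]
  have hcomm : (1 + J) * (1 - J) = (1 - J) * (1 + J) := by noncomm_ring
  have hU1 : star ((1 + J) * W) * ((1 + J) * W) = 1 := by
    rw [hUs]
    calc star W * (1 - J) * ((1 + J) * W) = star W * ((1 - J) * (1 + J)) * W := by noncomm_ring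
      _ = (star W * (1 + J)) * ((1 - J) * W) := by rw [← hcomm]; noncomm_ring
      _ = 1 := by rw [hWs1, h2, one_mul]
  have hWJ' : (1 + J) * W = W * (1 + J) := by
    linear_combination (norm := noncomm_ring) -hWJ
  have hU2 : ((1 + J) * W) * star ((1 + J) * W) = 1 := by
    rw [hUs, hWJ']
    calc W * (1 + J) * (star W * (1 - J)) = W * ((1 + J) * star W) * (1 - J) := by noncomm_ring
      _ = 1 := by rw [hWs2, mul_one, h1]
  refine ⟨⟨(1 + J) * W, hU1, hU2⟩, fun T ↦ ?_⟩
  set U : 𝒜 := (1 + J) * W with hU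
  have hUn : ‖U‖ ≤ 1 := CStarRing.norm_of_mem_unitary (U := U) ⟨hU1, hU2⟩ |>.le
  have hUn' : ‖star U‖ ≤ 1 := by rwa [norm_star]
  have hJK : ‖J * T - T * J‖ = ‖K * T - T * K‖ := by
    have : J * T - T * J = Complex.I • (K * T - T * K) := by simp [hJ, smul_sub]
    rw [this, norm_smul, Complex.norm_I, one_mul]
  have hUW : U = 2 * W - 1 := by
    rw [hU]; linear_combination (norm := noncomm_ring) -h2
  have e1 : U * T - T * U = 2 * (W * (J * T - T * J) * W) := by
    have hT : W * T - T * W = W * (J * T - T * J) * W := by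
      calc W * T - T * W = W * T * ((1 - J) * W) - (W * (1 - J)) * T * W := by
            rw [h1, h2]; simp
        _ = _ := by noncomm_ring
    rw [← hT, hUW]; noncomm_ring
  have e2 : U * T * star U - T = (U * T - T * U) * star U := by
    rw [sub_mul, mul_assoc T U, hU2, mul_one]
  have e3 : U * T - T * U = (U * T * star U - T) * U := by
    rw [sub_mul, mul_assoc _ (star U), hU1, mul_one]
  have e4 : (2 : ℂ) • (J * T - T * J) = (1 - J) * (U * T - T * U) * (1 - J) := by
    rw [e1]
    calc (2 : ℂ) • (J * T - T * J) = 2 * (J * T - T * J) := by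
          rw [two_smul, two_mul]
      _ = 2 * (((1 - J) * W) * (J * T - T * J) * (W * (1 - J))) := by rw [h1, h2]; simp
      _ = _ := by noncomm_ring
  have hJ1 : ‖1 - J‖ ≤ 3 / 2 := by
    refine (norm_sub_le _ _).trans ?_
    rw [norm_one]; linarith
  rw [← hJK]
  constructor
  · have h22 : ‖(2 : 𝒜) * (W * (J * T - T * J) * W)‖ = 2 * ‖W * (J * T - T * J) * W‖ := by
      rw [two_mul, ← two_smul ℂ, norm_smul]; simp
    calc ‖U * T * star U - T‖ ≤ ‖U * T - T * U‖ * ‖star U‖ := by rw [e2]; exact norm_mul_le _ _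
      _ ≤ ‖U * T - T * U‖ := mul_le_of_le_one_right (norm_nonneg _) hUn'
      _ = 2 * ‖W * (J * T - T * J) * W‖ := by rw [e1, h22]
      _ ≤ 2 * (2 * ‖J * T - T * J‖ * 2) := by
        gcongr
        refine (norm_mul_le _ _).trans ?_
        gcongr
        refine (norm_mul_le _ _).trans ?_
        gcongr
      _ = _ := by ring
  · have : 2 * ‖J * T - T * J‖ ≤ 3 / 2 * (‖U * T * star U - T‖ * 1) * (3 / 2) := by
      calc 2 * ‖J * T - T * J‖ = ‖(2 : ℂ) • (J * T - T * J)‖ := by rw [norm_smul]; simp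
        _ = ‖(1 - J) * (U * T - T * U) * (1 - J)‖ := by rw [e4]
        _ ≤ _ := by
          refine (norm_mul_le _ _).trans ?_
          gcongr
          refine (norm_mul_le _ _).trans ?_
          gcongr
          rw [e3]
          refine (norm_mul_le _ _).trans ?_
          gcongr
    linarith [norm_nonneg (U * T * star U - T)]

/-- If `f` has bounded operator oscillation, then a small commutator of `K` with `A` forces a bounded
commutator of `K` with `f(A)`. -/
theorem norm_commutator_cfcC_le {H : Type} [NormedAddCommGroup H] [InnerProductSpace ℂ H]
    [CompleteSpace H] [Nontrivial H] {F : Set ℝ} {f : ℝ → ℂ} (hf : Continuous f) {M : ℝ}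
    (hM : ∀ A B : H →L[ℂ] H, IsSelfAdjoint A → IsSelfAdjoint B →
      spectrum ℝ A ⊆ F → spectrum ℝ B ⊆ F → ‖A - B‖ ≤ 1 →
      ‖cfcC f A - cfcC f B‖ ≤ M)
    {A K : H →L[ℂ] H} (hA : IsSelfAdjoint A) (hAF : spectrum ℝ A ⊆ F) (hK : IsSelfAdjoint K)
    (hK' : ‖K‖ ≤ 1 / 2) (hKA : ‖K * A - A * K‖ ≤ 1 / 8) :
    ‖K * cfcC f A - cfcC f A * K‖ ≤ 2 * M := by
  obtain ⟨U, hU⟩ := hK.exists_unitary_conj_sub_norm_le hK'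
  let φ := Unitary.conjStarAlgAut ℂ (H →L[ℂ] H) U
  have hφ : ∀ T, φ T = (U : H →L[ℂ] H) * T * star (U : H →L[ℂ] H) := fun T ↦ rfl
  have hc : φ (cfcC f A) = cfcC f (φ A) := by
    unfold cfcC
    have : IsStarNormal A := hA.isStarNormal
    refine StarAlgHomClass.map_cfc φ (fun z : ℂ => f z.re) A
      (hφ := ?_) (hφa := ?_)
    · simp only [funext hφ]; fun_prop
    · exact (hA.map φ).isStarNormal
  refine (hU _).2.trans ?_
  gcongr
  rw [← hφ, hc]
  refine hM _ _ (hA.map φ) hA ?_ hAF ?_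
  · have := spectrum.units_conjugate (R := ℝ) (a := A) (u := Unitary.toUnits U)
    exact this.trans_subset hAF
  · refine (hU A).1.trans (by linarith)

section RankOne

open InnerProductSpace

/-- Any finite orthonormal family consists of eigenvectors, for prescribed eigenvalues in `F`, of a
self-adjoint operator with spectrum in `F`. -/
theorem exists_isSelfAdjoint_eigenvectors {H : Type} [NormedAddCommGroup H] [InnerProductSpace ℂ H]
    [CompleteSpace H] {κ : Type} [Fintype κ] {e : κ → H} (he : Orthonormal ℂ e)
    {F : Set ℝ} (hF : F.Nonempty) {τ : κ → ℝ} (hτ : ∀ i, τ i ∈ F) {f : ℝ → ℂ} (hf : Continuous f) :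
    ∃ A : H →L[ℂ] H, IsSelfAdjoint A ∧ spectrum ℝ A ⊆ F ∧ (∀ i, A (e i) = (τ i : ℂ) • e i) ∧
      ∀ i, cfcC f A (e i) = f (τ i) • e i := by
  classical
  obtain ⟨c, hc⟩ := hF
  let P : κ → H →L[ℂ] H := fun i ↦ rankOne ℂ (e i) (e i)
  have hPP : ∀ i j, P i * P j = if i = j then P i else 0 := by
    intro i j
    have : P i * P j = inner ℂ (e i) (e j) • rankOne ℂ (e i) (e j) := rankOne_comp_rankOne _ _ _ _
    rw [this, orthonormal_iff_ite.1 he]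
    split_ifs with h
    · subst h; simp [P]
    · simp
  have hPe : ∀ i j, P i (e j) = if i = j then e j else 0 := by
    intro i j
    simp only [P, rankOne_apply, orthonormal_iff_ite.1 he]
    split_ifs with h
    · simp [h]
    · simp
  have hPs : ∀ i, star (P i) = P i := fun i ↦ adjoint_rankOne _ _
  let φ : (Option κ → ℂ) →⋆ₐ[ℂ] (H →L[ℂ] H) :=
    { toFun := fun d ↦ d none • 1 + ∑ i, (d (some i) - d none) • P i
      map_one' := by simp
      map_zero' := by simp
      map_add' := fun d d' ↦ by
        simp only [Pi.add_apply, add_smul, sub_smul, Finset.sum_add_distrib, Finset.sum_sub_distrib]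
        abel
      map_mul' := fun d d' ↦ by
        simp only [Pi.mul_apply, add_mul, mul_add, Finset.sum_mul_sum, hPP,
          smul_ite, smul_zero, Finset.sum_ite_eq, Finset.mem_univ, if_true, mul_one, one_mul,
          smul_mul_assoc, mul_smul_comm, Finset.smul_sum, smul_smul, smul_add, add_assoc,
          ← Finset.sum_add_distrib, ← add_smul]
        rw [mul_comm (d' none)]
        congr 1
        refine Finset.sum_congr rfl fun i _ ↦ ?_
        congr 1
        ring
      commutes' := fun r ↦ by
        simp [Algebra.algebraMap_eq_smul_one]
      map_star' := fun d ↦ by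
        simp [hPs, star_sum] }
  have hφ : ∀ d, φ d = d none • 1 + ∑ i, (d (some i) - d none) • P i := fun d ↦ rfl
  have hφe : ∀ d i, φ d (e i) = d (some i) • e i := by
    intro d i
    simp [hφ, hPe, sub_smul]
  have hφc : Continuous φ := by
    change Continuous fun d : Option κ → ℂ ↦ d none • (1 : H →L[ℂ] H) +
      ∑ i, (d (some i) - d none) • P i
    fun_prop
  let s : Option κ → ℝ := fun o ↦ o.elim c τ
  have hs : ∀ o, s o ∈ F := by rintro (_ | i) <;> simp [s, hc, hτ]
  let a : Option κ → ℂ := fun o ↦ (s o : ℂ)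
  have ha : IsSelfAdjoint a := by
    ext o; simp [a]
  have hcfc : cfcC f (φ a) = φ (fun o ↦ f (s o)) := by
    unfold cfcC
    have hf' : Continuous fun z : ℂ ↦ f z.re := by fun_prop
    rw [← StarAlgHomClass.map_cfc φ (fun z : ℂ ↦ f z.re) a (hf'.continuousOn)
      hφc ha.isStarNormal (ha.map φ).isStarNormal]
    congr 1
    rw [cfc_map_pi (S := ℂ) (fun z : ℂ ↦ f z.re) a hf'.continuousOn ha.isStarNormal
      (q := fun _ ↦ IsStarNormal) (fun o ↦ inferInstance)]
    ext o
    have := cfc_algebraMap (p := IsStarNormal) (A := ℂ) (a o) (fun z : ℂ ↦ f z.re)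
    simpa [a] using this
  refine ⟨φ a, ha.map φ, ?_, fun i ↦ hφe a i, fun i ↦ ?_⟩
  · intro r hr
    by_contra hrF
    refine hr ?_
    have hu : IsUnit (algebraMap ℂ (Option κ → ℂ) r - a) := by
      rw [Pi.isUnit_iff]
      intro o
      rw [isUnit_iff_ne_zero]
      simp only [a, Pi.sub_apply, Pi.algebraMap_apply, Algebra.algebraMap_self, RingHom.id_apply,
        ne_eq, sub_eq_zero, Complex.ofReal_inj]
      rintro rfl
      exact hrF (hs o)
    have := hu.map φ
    rw [map_sub, AlgHomClass.commutes] at this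
    exact this
  · rw [hcfc, hφe]
    rfl

/-- For each `k` there is an antisymmetric matrix `X` with `X * X = -k` all of whose eigenvalues
have modulus `√k`, while the entries of its lower triangular part (with respect to `r`) have sum
`k / 2` times the size. The reflection `R` anticommutes with `X` and drives the induction. -/
theorem exists_matrix_mul_self_eq_neg (k : ℕ) :
    ∃ (ι : Type) (_ : Fintype ι) (_ : DecidableEq ι) (r : ι → ℕ) (X R : Matrix ι ι ℝ),
      0 < Fintype.card ι ∧ (∀ i, r i < Fintype.card ι) ∧
      X.transpose = -X ∧ X * X = -(k : ℝ) • (1 : Matrix ι ι ℝ) ∧ R * R = 1 ∧ X * R = -(R * X) ∧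
      R.transpose = R ∧ (∑ i, ∑ j, R i j = Fintype.card ι) ∧
      (∑ i, ∑ j, if r j < r i then X i j else 0) = k * Fintype.card ι / 2 := by
  induction k with
  | zero =>
    refine ⟨Unit, inferInstance, inferInstance, fun _ ↦ 0, 0, 1, ?_⟩
    simp
  | succ k ih =>
    obtain ⟨ι, _, _, r, X, R, hpos, hr, hXt, hXX, hRR, hXR, hRt, hRs, hs⟩ := ih
    refine ⟨ι ⊕ ι, inferInstance, inferInstance, Sum.elim r (fun i ↦ r i + Fintype.card ι),
      Matrix.fromBlocks X (-R) R X, Matrix.fromBlocks 0 R R 0, ?_, ?_, ?_, ?_, ?_, ?_, ?_, ?_, ?_⟩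
    · simp [hpos]
    · rintro (i | i) <;> simp <;> linarith [hr i]
    · simp [Matrix.fromBlocks_transpose, Matrix.fromBlocks_neg, hXt, hRt]
    · simp only [Matrix.fromBlocks_multiply, hXX, hXR, neg_mul, mul_neg, hRR, ← Matrix.fromBlocks_one,
        Matrix.fromBlocks_smul, neg_neg, smul_zero]
      congr 1
      · push_cast; module
      · abel
      · abel
      · push_cast; module
    · simp [Matrix.fromBlocks_multiply, hRR]
    · simp [Matrix.fromBlocks_multiply, Matrix.fromBlocks_neg, hRR, hXR]
    · simp [Matrix.fromBlocks_transpose, hRt]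
    · simp [hRs]
    · have h1 : ∀ i j, ¬ (r j + Fintype.card ι < r i) := fun i j ↦ by have := hr i; omega
      have h2 : ∀ i j, r j < r i + Fintype.card ι := fun i j ↦ by have := hr j; omega
      simp [hs, hRs, h1, h2, Finset.sum_add_distrib]
      erw [hs]
      ring

theorem norm_sum_smul_rankOne_le {H : Type} [NormedAddCommGroup H] [InnerProductSpace ℂ H]
    [CompleteSpace H] {ι : Type} [Fintype ι] [DecidableEq ι] {u v : ι → H} (hu : Orthonormal ℂ u)
    (hv : Orthonormal ℂ v) {X : Matrix ι ι ℝ} {s : ℝ} (hs : 0 ≤ s)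
    (hX : X.transpose * X = s ^ 2 • (1 : Matrix ι ι ℝ)) :
    ‖∑ i, ∑ j, (X i j : ℂ) • rankOne ℂ (u i) (v j)‖ ≤ s := by
  refine ContinuousLinearMap.opNorm_le_bound _ hs fun x ↦ ?_
  refine abs_le_of_sq_le_sq' ?_ (by positivity) |>.2
  set y : ι → ℂ := fun j ↦ inner ℂ (v j) x with hy
  have hXe : ∀ j l, ∑ i, (X i j : ℂ) * X i l = if j = l then (s : ℂ) ^ 2 else 0 := by
    intro j l
    have := congrFun (congrFun hX j) l
    simp only [Matrix.mul_apply, Matrix.transpose_apply, Matrix.smul_apply, Matrix.one_apply,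
      smul_eq_mul, mul_ite, mul_one, mul_zero] at this
    rw [← Complex.ofReal_pow, ← Complex.ofReal_zero, ← apply_ite Complex.ofReal, ← this]
    push_cast
    rfl
  have h1 : (∑ i, ∑ j, (X i j : ℂ) • rankOne ℂ (u i) (v j)) x
      = ∑ i, (∑ j, (X i j : ℂ) * y j) • u i := by
    simp only [hy, sum_apply, smul_apply, rankOne_apply, Finset.sum_smul, smul_smul]
  have h2 : ((‖∑ i, (∑ j, (X i j : ℂ) * y j) • u i‖ ^ 2 : ℝ) : ℂ)
      = ((s ^ 2 * ∑ j, ‖y j‖ ^ 2 : ℝ) : ℂ) := by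
    have := inner_self_eq_norm_sq_to_K (𝕜 := ℂ) (∑ i, (∑ j, (X i j : ℂ) * y j) • u i)
    rw [hu.inner_sum] at this
    push_cast
    simp only [← Complex.conj_mul']
    refine this.symm.trans ?_
    simp only [map_sum, map_mul, Complex.conj_ofReal, Finset.sum_mul_sum]
    rw [Finset.sum_comm]
    have : ∀ j, ∑ i, ∑ l, (X i j : ℂ) * (starRingEnd ℂ) (y j) * ((X i l : ℂ) * y l)
        = s ^ 2 * ((starRingEnd ℂ) (y j) * y j) := by
      intro j
      rw [Finset.sum_comm]
      calc _ = ∑ l, (∑ i, (X i j : ℂ) * X i l) * ((starRingEnd ℂ) (y j) * y l) := by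
            refine Finset.sum_congr rfl fun l _ ↦ ?_
            rw [Finset.sum_mul]
            exact Finset.sum_congr rfl fun i _ ↦ by ring
        _ = _ := by simp [hXe]
    rw [Finset.mul_sum]
    exact Finset.sum_congr rfl fun j _ ↦ this j
  rw [h1, Complex.ofReal_injective h2, mul_pow]
  gcongr
  exact hv.sum_inner_products_le x

/-- The divided differences of `f` act as a bounded Schur multiplier on `X`, tested against the
vectors with all entries one. -/
theorem norm_sum_mul_dividedDifference_le {H : Type} [NormedAddCommGroup H] [InnerProductSpace ℂ H]
    [CompleteSpace H] [Nontrivial H] {F : Set ℝ} {f : ℝ → ℂ} (hf : Continuous f) {M : ℝ}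
    (hM : ∀ A B : H →L[ℂ] H, IsSelfAdjoint A → IsSelfAdjoint B →
      spectrum ℝ A ⊆ F → spectrum ℝ B ⊆ F → ‖A - B‖ ≤ 1 →
      ‖cfcC f A - cfcC f B‖ ≤ M)
    {ι : Type} [Fintype ι] [DecidableEq ι] [Nonempty ι] {e : ι ⊕ ι → H} (he : Orthonormal ℂ e)
    {X : Matrix ι ι ℝ} {s : ℝ} (hs : 0 < s)
    (hX : X.transpose * X = s ^ 2 • (1 : Matrix ι ι ℝ)) {a b : ι → ℝ} (ha : ∀ i, a i ∈ F)
    (hb : ∀ i, b i ∈ F) (hab : ∀ i j, a i ≠ b j)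
    (hsmall : ∑ i, ∑ j, |X i j / (b j - a i)| ≤ 4 * s) :
    ‖∑ i, ∑ j, (X i j : ℂ) * ((f (b j) - f (a i)) / (b j - a i))‖
      ≤ 32 * s * M * Fintype.card ι := by
  obtain ⟨A, hA, hAF, hAe, hfe⟩ := exists_isSelfAdjoint_eigenvectors he
    ⟨_, ha (Classical.arbitrary ι)⟩ (τ := Sum.elim a b) (by simpa using ⟨ha, hb⟩) hf
  set u : ι → H := fun i ↦ e (Sum.inl i) with hu
  set v : ι → H := fun i ↦ e (Sum.inr i) with hv
  have hAu : ∀ i, A (u i) = (a i : ℂ) • u i := fun i ↦ hAe _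
  have hAv : ∀ i, A (v i) = (b i : ℂ) • v i := fun i ↦ hAe _
  have hfu : ∀ i, cfcC f A (u i) = f (a i) • u i := fun i ↦ hfe _
  have hfv : ∀ i, cfcC f A (v i) = f (b i) • v i := fun i ↦ hfe _
  have hou : Orthonormal ℂ u := he.comp _ Sum.inl_injective
  have hov : Orthonormal ℂ v := he.comp _ Sum.inr_injective
  have huv : ∀ i j, inner ℂ (u i) (v j) = 0 := fun i j ↦ he.2 (by simp)
  have hd : ∀ i j, (b j : ℂ) - a i ≠ 0 := fun i j ↦ by
    rw [sub_ne_zero]; exact_mod_cast (hab i j).symm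
  set x : ι → ι → ℝ := fun i j ↦ X i j / (b j - a i) / (16 * s) with hx
  set Y : H →L[ℂ] H := ∑ i, ∑ j, (X i j : ℂ) • rankOne ℂ (u i) (v j) with hY
  have hYn : ‖Y‖ ≤ s := norm_sum_smul_rankOne_le hou hov hs.le hX
  have hst : ∀ p q : H, star (rankOne ℂ p q) = rankOne ℂ q p := fun p q ↦ adjoint_rankOne p q
  set K : H →L[ℂ] H := ∑ i, ∑ j, (x i j : ℂ) • (rankOne ℂ (u i) (v j) + rankOne ℂ (v j) (u i))
    with hK
  have hKs : IsSelfAdjoint K := by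
    simp [IsSelfAdjoint, hK, star_sum, hst, add_comm]
  have hKn : ‖K‖ ≤ 1 / 2 := by
    calc ‖K‖ ≤ ∑ i, ∑ j, |x i j| * (1 + 1) := by
          refine norm_sum_le_of_le _ fun i _ ↦ norm_sum_le_of_le _ fun j _ ↦ ?_
          rw [norm_smul, Complex.norm_real, Real.norm_eq_abs]
          gcongr
          refine norm_add_le_of_le ?_ ?_ <;> simp [hou.1, hov.1]
      _ = (∑ i, ∑ j, |X i j / (b j - a i)|) / (8 * s) := by
          simp only [hx, Finset.sum_div]
          refine Finset.sum_congr rfl fun i _ ↦ Finset.sum_congr rfl fun j _ ↦ ?_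
          rw [abs_div _ (16 * s), abs_of_pos (a := 16 * s) (by positivity)]
          field_simp
          ring
      _ ≤ 1 / 2 := by
          rw [div_le_div_iff₀ (by positivity) (by norm_num)]
          linarith
  have hAr : ∀ p q : H, A * rankOne ℂ p q = rankOne ℂ (A p) q := fun p q ↦
    comp_rankOne p q A
  have hrA : ∀ p q : H, rankOne ℂ p q * A = rankOne ℂ p (A q) := fun p q ↦ by
    have := rankOne_comp p q A
    rwa [hA.adjoint_eq] at this
  have hKA : K * A - A * K = ((1 / (16 * s) : ℝ) : ℂ) • (Y - star Y) := by
    simp only [hK, hY, star_sum, star_smul, hst, Finset.sum_mul, Finset.mul_sum, smul_mul_assoc,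
      mul_smul_comm, add_mul, mul_add, hAr, hrA, hAu, hAv, ← Finset.sum_sub_distrib,
      Finset.smul_sum]
    refine Finset.sum_congr rfl fun i _ ↦ Finset.sum_congr rfl fun j _ ↦ ?_
    have : (x i j : ℂ) * (b j - a i) = ((1 / (16 * s) : ℝ) : ℂ) * X i j := by
      have := hd i j
      have hs' : (s : ℂ) ≠ 0 := by exact_mod_cast hs.ne'
      simp only [hx]
      push_cast
      field_simp
    simp only [map_smul, map_smulₛₗ, smul_apply, Complex.conj_ofReal,
      RCLike.star_def, smul_sub, smul_smul, ← this]
    module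
  have hKAn : ‖K * A - A * K‖ ≤ 1 / 8 := by
    rw [hKA, norm_smul, Complex.norm_real, Real.norm_of_nonneg (by positivity)]
    have : ‖Y - star Y‖ ≤ s + s := norm_sub_le_of_le hYn (by rwa [norm_star])
    calc 1 / (16 * s) * ‖Y - star Y‖ ≤ 1 / (16 * s) * (s + s) := by gcongr
      _ = 1 / 8 := by field_simp; norm_num
  have key := norm_commutator_cfcC_le hf hM hA hAF hKs hKn hKAn
  set T := K * cfcC f A - cfcC f A * K with hT
  have hKv : ∀ j, K (v j) = ∑ i, (x i j : ℂ) • u i := by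
    intro j
    simp [hK, huv, orthonormal_iff_ite.1 hov]
  have hTv : T (∑ j, v j) = ∑ i, (∑ j, (x i j : ℂ) * (f (b j) - f (a i))) • u i := by
    simp only [map_sum, hT, sub_apply, mul_apply_eq_comp,
      hfv, hKv, map_smul, hfu, Finset.sum_smul, Finset.smul_sum, ← Finset.sum_sub_distrib]
    rw [Finset.sum_comm]
    refine Finset.sum_congr rfl fun i _ ↦ Finset.sum_congr rfl fun j _ ↦ ?_
    module
  have hin : inner ℂ (∑ i, u i) (T (∑ j, v j))
      = (1 / (16 * s) : ℂ) * ∑ i, ∑ j, (X i j : ℂ) * ((f (b j) - f (a i)) / (b j - a i)) := by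
    have := hou.inner_sum (fun _ ↦ 1) (fun i ↦ ∑ j, (x i j : ℂ) * (f (b j) - f (a i))) Finset.univ
    simp only [one_smul, map_one, one_mul] at this
    rw [hTv, this, Finset.mul_sum]
    refine Finset.sum_congr rfl fun i _ ↦ ?_
    rw [Finset.mul_sum]
    refine Finset.sum_congr rfl fun j _ ↦ ?_
    simp only [hx]
    push_cast
    ring
  have hsum : ∀ {w : ι → H}, Orthonormal ℂ w → ‖∑ i, w i‖ = √(Fintype.card ι) := by
    intro w hw
    have h1 := hw.inner_sum (fun _ ↦ 1) (fun _ ↦ 1) Finset.univ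
    have h2 := inner_self_eq_norm_sq_to_K (𝕜 := ℂ) (∑ i, w i)
    simp only [one_smul, map_one, Finset.sum_const, nsmul_eq_mul, mul_one] at h1
    rw [h1, Finset.card_univ] at h2
    refine (Real.sqrt_eq_iff_mul_self_eq (by positivity) (by positivity)).2 ?_ |>.symm
    rw [← sq]
    have h3 : ((Fintype.card ι : ℝ) : ℂ) = ((‖∑ i, w i‖ ^ 2 : ℝ) : ℂ) := by
      push_cast
      exact h2
    exact Complex.ofReal_injective h3
  have hbound := (norm_inner_le_norm (𝕜 := ℂ) (∑ i, u i) (T (∑ j, v j))).trans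
    (mul_le_mul_of_nonneg_left (T.le_opNorm _) (norm_nonneg _))
  rw [hin, hsum hou, hsum hov, norm_mul] at hbound
  have hc : ‖(1 / (16 * s) : ℂ)‖ = 1 / (16 * s) := by
    simp [abs_of_pos hs]
  rw [hc] at hbound
  have hcard : √(Fintype.card ι) * (‖T‖ * √(Fintype.card ι)) ≤ 2 * M * Fintype.card ι := by
    have := Real.mul_self_sqrt (Nat.cast_nonneg (α := ℝ) (Fintype.card ι))
    calc _ = ‖T‖ * (√(Fintype.card ι) * √(Fintype.card ι)) := by ring
      _ ≤ _ := by rw [this]; gcongr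
  have := hbound.trans hcard
  rw [div_mul_eq_mul_div, one_mul, div_le_iff₀ (by positivity)] at this
  linarith

end RankOne

theorem exists_orthonormal_ellTwo (κ : Type) [Fintype κ] :
    ∃ e : κ → ellTwo, Orthonormal ℂ e := by
  let b : HilbertBasis ℕ ℂ ellTwo := HilbertBasis.ofRepr (LinearIsometryEquiv.refl ℂ _)
  exact ⟨_, b.orthonormal.comp (fun i ↦ (Fintype.equivFin κ i : ℕ))
    (Fin.val_injective.comp (Fintype.equivFin κ).injective)⟩

section AtInfinity

open Filter Topology

/-- The filter of points of `F` tending to infinity in absolute value. -/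
def atInftyWithin (F : Set ℝ) : Filter ℝ := comap abs atTop ⊓ 𝓟 F

theorem atInftyWithin_neBot {F : Set ℝ} (hF : ∀ R : ℝ, 0 < R → ∃ t ∈ F, R < |t|) :
    (atInftyWithin F).NeBot := by
  rw [atInftyWithin, ← frequently_mem_iff_neBot, (atTop_basis.comap _).frequently_iff]
  intro R _
  obtain ⟨t, ht, hRt⟩ := hF (max R 1) (by positivity)
  exact ⟨t, (le_max_left _ _).trans hRt.le, ht⟩

theorem eventually_mem_atInftyWithin (F : Set ℝ) : ∀ᶠ t in atInftyWithin F, t ∈ F :=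
  mem_inf_of_right (mem_principal_self F)

theorem tendsto_abs_sub_atInftyWithin (F : Set ℝ) (s : ℝ) :
    Tendsto (fun t ↦ |t - s|) (atInftyWithin F) atTop := by
  have h : Tendsto (fun t : ℝ ↦ |t| - |s|) (atInftyWithin F) atTop :=
    tendsto_atTop_add_const_right _ (-|s|) (tendsto_comap.mono_left inf_le_left)
  exact tendsto_atTop_mono (fun t ↦ abs_sub_abs_le_abs_sub t s) h

theorem tendsto_dividedDifference_sub {F : Set ℝ} {f : ℝ → ℂ} {C : ℝ}
    (hC : ∀ᶠ t in atInftyWithin F, ‖f t / (t : ℂ)‖ ≤ C) (s : ℝ) :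
    Tendsto (fun t : ℝ ↦ (f t - f s) / ((t : ℂ) - s) - f t / t) (atInftyWithin F) (𝓝 0) := by
  have h0 : Tendsto (fun t ↦ (|s| * C + ‖f s‖) / |t - s|) (atInftyWithin F) (𝓝 0) :=
    (tendsto_abs_sub_atInftyWithin F s).const_div_atTop _
  refine squeeze_zero_norm' ?_ h0
  filter_upwards [hC, (tendsto_abs_sub_atInftyWithin F s).eventually_gt_atTop 0,
    (tendsto_abs_sub_atInftyWithin F 0).eventually_gt_atTop 0] with t ht hts ht0
  have hts' : (t : ℂ) - s ≠ 0 := by exact_mod_cast abs_pos.1 hts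
  have ht0' : (t : ℂ) ≠ 0 := by simpa using ht0
  have e : (f t - f s) / ((t : ℂ) - s) - f t / t = (s * (f t / t) - f s) / ((t : ℂ) - s) := by
    field_simp
    ring
  rw [e, norm_div]
  have : ‖(t : ℂ) - s‖ = |t - s| := by
    rw [← Complex.ofReal_sub, Complex.norm_real, Real.norm_eq_abs]
  rw [this]
  gcongr
  refine (norm_sub_le _ _).trans ?_
  rw [norm_mul, Complex.norm_real, Real.norm_eq_abs]
  gcongr

variable {F : Set ℝ} {f : ℝ → ℂ} {M : ℝ}

theorem exists_eventually_norm_div_le (hF : F.Nonempty) (hf : Continuous f)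
    (hM : ∀ A B : ellTwo →L[ℂ] ellTwo, IsSelfAdjoint A → IsSelfAdjoint B →
      spectrum ℝ A ⊆ F → spectrum ℝ B ⊆ F → ‖A - B‖ ≤ 1 →
      ‖cfcC f A - cfcC f B‖ ≤ M) :
    ∃ C : ℝ, ∀ᶠ t in atInftyWithin F, ‖f t / (t : ℂ)‖ ≤ C := by
  obtain ⟨s, hs⟩ := hF
  obtain ⟨e, he⟩ := exists_orthonormal_ellTwo (Unit ⊕ Unit)
  have : Nontrivial ellTwo := ⟨e (Sum.inl ()), 0, he.ne_zero _⟩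
  refine ⟨32 * M * (1 + |s|) + ‖f s‖, ?_⟩
  filter_upwards [eventually_mem_atInftyWithin F,
    (tendsto_abs_sub_atInftyWithin F s).eventually_ge_atTop 1,
    (tendsto_abs_sub_atInftyWithin F 0).eventually_ge_atTop 1] with t htF hts ht0
  rw [sub_zero] at ht0
  have h := norm_sum_mul_dividedDifference_le hf hM he (X := 1) one_pos (by simp)
    (a := fun _ ↦ s) (b := fun _ ↦ t) (fun _ ↦ hs) (fun _ ↦ htF)
    (fun _ _ h ↦ by rw [h] at hts; norm_num at hts) (by
      simp only [Finset.univ_unique, Matrix.one_apply, Finset.sum_singleton, if_true,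
        abs_div, abs_one]
      exact (div_le_self zero_le_one hts).trans (by norm_num))
  simp only [Finset.univ_unique, Matrix.one_apply, Finset.sum_singleton, if_true,
    Complex.ofReal_one, one_mul, mul_one, Fintype.card_unit, Nat.cast_one, norm_div] at h
  have hn : ‖(t : ℂ) - s‖ = |t - s| := by
    rw [← Complex.ofReal_sub, Complex.norm_real, Real.norm_eq_abs]
  rw [hn, div_le_iff₀ (by linarith)] at h
  have hM0 : 0 ≤ M := by
    have : 0 ≤ 32 * M * |t - s| := (norm_nonneg _).trans h
    by_contra! hneg
    nlinarith
  rw [norm_div, Complex.norm_real, Real.norm_eq_abs, div_le_iff₀ (by linarith)]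
  calc ‖f t‖ = ‖(f t - f s) + f s‖ := by rw [sub_add_cancel]
    _ ≤ 32 * M * |t - s| + ‖f s‖ := norm_add_le_of_le h le_rfl
    _ ≤ 32 * M * (|t| + |s|) + ‖f s‖ := by gcongr; exact abs_sub t s
    _ ≤ 32 * M * (|t| + |s| * |t|) + ‖f s‖ * |t| := by
      gcongr
      · exact le_mul_of_one_le_right (abs_nonneg _) ht0
      · exact le_mul_of_one_le_right (norm_nonneg _) ht0
    _ = _ := by ring

/-- If `L₁` and `L₂` are cluster points of `f t / t` at infinity in `F`, there are points
`a 0, b 0, a 1, b 1, …` of `F`, pairwise far apart, such that the divided differences of `f`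
between an `a` and a `b` are close to `L₁` or to `L₂` according to which of the two comes later. -/
theorem exists_interlacing_seq {C : ℝ} (hC : ∀ᶠ t in atInftyWithin F, ‖f t / (t : ℂ)‖ ≤ C)
    {L₁ L₂ : ℂ} (h₁ : MapClusterPt L₁ (atInftyWithin F) fun t ↦ f t / (t : ℂ))
    (h₂ : MapClusterPt L₂ (atInftyWithin F) fun t ↦ f t / (t : ℂ)) (D : ℝ) {ε : ℝ} (hε : 0 < ε) :
    ∃ a b : ℕ → ℝ, (∀ n, a n ∈ F) ∧ (∀ n, b n ∈ F) ∧ (∀ m n, D ≤ |b n - a m|) ∧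
      ∀ m n, ‖(f (b n) - f (a m)) / ((b n : ℂ) - a m) - if n < m then L₁ else L₂‖ ≤ ε := by
  let G : ℂ → ℝ → ℝ → Prop := fun L t s ↦
    D ≤ |t - s| ∧ ‖(f t - f s) / ((t : ℂ) - s) - L‖ ≤ ε
  have key : ∀ L, MapClusterPt L (atInftyWithin F) (fun t ↦ f t / (t : ℂ)) →
      ∀ S : Finset ℝ, ∃ t ∈ F, ∀ s ∈ S, G L t s := by
    intro L hL S
    have hfr : ∃ᶠ t in atInftyWithin F, ‖f t / (t : ℂ) - L‖ < ε / 2 := by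
      have := hL.frequently (Metric.ball_mem_nhds L (half_pos hε))
      simpa [dist_eq_norm] using this
    have hev : ∀ᶠ t in atInftyWithin F, ∀ s ∈ S, D ≤ |t - s| ∧
        ‖(f t - f s) / ((t : ℂ) - s) - f t / t‖ < ε / 2 := by
      rw [Finset.eventually_all]
      intro s _
      refine ((tendsto_abs_sub_atInftyWithin F s).eventually_ge_atTop D).and ?_
      simpa using (tendsto_dividedDifference_sub hC s).norm.eventually_lt_const
        (by simpa using half_pos hε)
    obtain ⟨t, ht, htF, hts⟩ := (hfr.and_eventually
      ((eventually_mem_atInftyWithin F).and hev)).exists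
    refine ⟨t, htF, fun s hs ↦ ⟨(hts s hs).1, ?_⟩⟩
    have := norm_add_le_of_le (hts s hs).2.le ht.le
    rwa [sub_add_sub_cancel, add_halves] at this
  classical
  obtain ⟨z, hz, hz'⟩ := exists_seq_of_forall_finset_exists
    (fun x : ℝ × ℝ ↦ x.1 ∈ F ∧ x.2 ∈ F ∧ G L₂ x.2 x.1)
    (fun x y ↦ G L₁ y.1 x.2 ∧ G L₂ y.2 x.1) (fun S _ ↦ by
      obtain ⟨p, hpF, hp⟩ := key L₁ h₁ (S.image Prod.snd)
      obtain ⟨q, hqF, hq⟩ := key L₂ h₂ (insert p (S.image Prod.fst))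
      exact ⟨(p, q), ⟨hpF, hqF, hq p (by simp)⟩, fun x hx ↦
        ⟨hp _ (Finset.mem_image_of_mem _ hx),
          hq _ (Finset.mem_insert_of_mem (Finset.mem_image_of_mem _ hx))⟩⟩)
  have hG : ∀ m n, D ≤ |(z n).2 - (z m).1| ∧ ‖(f (z n).2 - f (z m).1) /
      (((z n).2 : ℂ) - (z m).1) - if n < m then L₁ else L₂‖ ≤ ε := by
    intro m n
    rcases lt_trichotomy n m with h | rfl | h
    · obtain ⟨h1, h2⟩ := (hz' n m h).1
      rw [if_pos h, abs_sub_comm, ← neg_sub (f (z m).1), ← neg_sub ((z m).1 : ℂ), neg_div_neg_eq]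
      exact ⟨h1, h2⟩
    · simpa using (hz n).2.2
    · rw [if_neg h.not_gt]
      exact (hz' m n h).2
  exact ⟨fun n ↦ (z n).1, fun n ↦ (z n).2, fun n ↦ (hz n).1, fun n ↦ (hz n).2.1,
    fun m n ↦ (hG m n).1, fun m n ↦ (hG m n).2⟩

theorem norm_sub_mul_le_of_mapClusterPt (hf : Continuous f)
    (hM : ∀ A B : ellTwo →L[ℂ] ellTwo, IsSelfAdjoint A → IsSelfAdjoint B →
      spectrum ℝ A ⊆ F → spectrum ℝ B ⊆ F → ‖A - B‖ ≤ 1 →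
      ‖cfcC f A - cfcC f B‖ ≤ M)
    {C : ℝ} (hC : ∀ᶠ t in atInftyWithin F, ‖f t / (t : ℂ)‖ ≤ C)
    {L₁ L₂ : ℂ} (h₁ : MapClusterPt L₁ (atInftyWithin F) fun t ↦ f t / (t : ℂ))
    (h₂ : MapClusterPt L₂ (atInftyWithin F) fun t ↦ f t / (t : ℂ)) {k : ℕ} (hk : 1 ≤ k) :
    ‖L₁ - L₂‖ * (k / 2) ≤ 32 * √k * M + 1 := by
  obtain ⟨ι, _, _, r, X, R, hpos, -, hXt, hXX, -, -, -, -, hs⟩ := exists_matrix_mul_self_eq_neg k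
  have : Nonempty ι := Fintype.card_pos_iff.1 hpos
  have hN : (1 : ℝ) ≤ Fintype.card ι := by exact_mod_cast hpos
  have hk' : (1 : ℝ) ≤ √k := Real.one_le_sqrt.2 (by exact_mod_cast hk)
  obtain ⟨e, he⟩ := exists_orthonormal_ellTwo (ι ⊕ ι)
  have : Nontrivial ellTwo := ⟨e (Sum.inl (Classical.arbitrary ι)), 0, he.ne_zero _⟩
  set S : ℝ := ∑ i, ∑ j, |X i j| with hS
  have hS0 : 0 ≤ S := Finset.sum_nonneg fun i _ ↦ Finset.sum_nonneg fun j _ ↦ abs_nonneg _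
  obtain ⟨a, b, ha, hb, hD, hL⟩ := exists_interlacing_seq hC h₁ h₂ (1 + S)
    (ε := 1 / (1 + S)) (by positivity)
  have hX : X.transpose * X = √k ^ 2 • (1 : Matrix ι ι ℝ) := by
    rw [hXt, neg_mul, hXX, Real.sq_sqrt (Nat.cast_nonneg k), neg_smul, neg_neg]
  have hS1 : S / (1 + S) ≤ 1 := (div_le_one (by positivity)).2 (by linarith)
  have hmain := norm_sum_mul_dividedDifference_le hf hM he (by linarith : 0 < √(k : ℝ)) hX
    (a := fun i ↦ a (r i)) (b := fun j ↦ b (r j)) (fun i ↦ ha _) (fun j ↦ hb _)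
    (fun i j h ↦ by have := hD (r i) (r j); rw [h, sub_self, abs_zero] at this; linarith) (by
      calc ∑ i, ∑ j, |X i j / (b (r j) - a (r i))| ≤ ∑ i, ∑ j, |X i j| / (1 + S) := by
            refine Finset.sum_le_sum fun i _ ↦ Finset.sum_le_sum fun j _ ↦ ?_
            rw [abs_div]
            gcongr
            exact hD _ _
        _ = S / (1 + S) := by simp only [hS, Finset.sum_div]
        _ ≤ 4 * √k := by linarith)
  have hX0 : ∑ i, ∑ j, (X i j : ℂ) = 0 := by
    have h : ∑ i, ∑ j, (X i j : ℂ) = ∑ i, ∑ j, -(X i j : ℂ) := by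
      rw [Finset.sum_comm]
      refine Finset.sum_congr rfl fun i _ ↦ Finset.sum_congr rfl fun j _ ↦ ?_
      have := congrFun (congrFun hXt i) j
      rw [Matrix.transpose_apply, Matrix.neg_apply] at this
      exact_mod_cast this
    simp only [Finset.sum_neg_distrib] at h
    exact self_eq_neg.1 h
  have hXL : ∑ i, ∑ j, (X i j : ℂ) * (if r j < r i then L₁ else L₂)
      = (L₁ - L₂) * (k * Fintype.card ι / 2) := by
    have hs' : (∑ i, ∑ j, if r j < r i then (X i j : ℂ) else 0) = k * Fintype.card ι / 2 := by
      have := congrArg Complex.ofReal hs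
      push_cast at this
      simpa only [apply_ite Complex.ofReal, Complex.ofReal_zero] using this
    calc _ = ∑ i, ∑ j, (L₂ * (X i j : ℂ) + (L₁ - L₂) * if r j < r i then (X i j : ℂ) else 0) := by
          refine Finset.sum_congr rfl fun i _ ↦ Finset.sum_congr rfl fun j _ ↦ ?_
          split_ifs <;> ring
      _ = _ := by
          simp only [Finset.sum_add_distrib, ← Finset.mul_sum, hX0, hs', mul_zero, zero_add]
  have herr : ‖∑ i, ∑ j, (X i j : ℂ) * (if r j < r i then L₁ else L₂) - ∑ i, ∑ j, (X i j : ℂ) *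
      ((f (b (r j)) - f (a (r i))) / ((b (r j) : ℂ) - a (r i)))‖ ≤ 1 := by
    simp only [← Finset.sum_sub_distrib, ← mul_sub]
    calc _ ≤ ∑ i, ∑ j, |X i j| * (1 / (1 + S)) := by
          refine norm_sum_le_of_le _ fun i _ ↦ norm_sum_le_of_le _ fun j _ ↦ ?_
          rw [norm_mul, Complex.norm_real, Real.norm_eq_abs, norm_sub_rev]
          gcongr
          exact hL _ _
      _ = S / (1 + S) := by simp only [← Finset.sum_mul, hS]; ring
      _ ≤ 1 := hS1
  rw [hXL] at herr
  have hfin := (norm_le_norm_add_norm_sub' _ _).trans (add_le_add hmain herr)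
  rw [norm_mul] at hfin
  have hn : ‖(k * Fintype.card ι / 2 : ℂ)‖ = k * Fintype.card ι / 2 := by simp
  rw [hn] at hfin
  refine le_of_mul_le_mul_right ?_ (by linarith : (0 : ℝ) < Fintype.card ι)
  linarith

theorem eq_of_mapClusterPt_div (hf : Continuous f)
    (hM : ∀ A B : ellTwo →L[ℂ] ellTwo, IsSelfAdjoint A → IsSelfAdjoint B →
      spectrum ℝ A ⊆ F → spectrum ℝ B ⊆ F → ‖A - B‖ ≤ 1 →
      ‖cfcC f A - cfcC f B‖ ≤ M)
    {C : ℝ} (hC : ∀ᶠ t in atInftyWithin F, ‖f t / (t : ℂ)‖ ≤ C)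
    {L₁ L₂ : ℂ} (h₁ : MapClusterPt L₁ (atInftyWithin F) fun t ↦ f t / (t : ℂ))
    (h₂ : MapClusterPt L₂ (atInftyWithin F) fun t ↦ f t / (t : ℂ)) : L₁ = L₂ := by
  by_contra hne
  have hpos : 0 < ‖L₁ - L₂‖ := norm_pos_iff.2 (sub_ne_zero.2 hne)
  obtain ⟨m, hm⟩ := exists_nat_gt (2 * (32 * |M| + 1) / ‖L₁ - L₂‖)
  rw [div_lt_iff₀ hpos] at hm
  have hm0 : (0 : ℝ) < m := by
    have : 0 < (m : ℝ) * ‖L₁ - L₂‖ := lt_of_le_of_lt (by positivity) hm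
    exact pos_of_mul_pos_left this hpos.le
  have hm1 : 1 ≤ m := by exact_mod_cast hm0
  have hm1' : (1 : ℝ) ≤ m := by exact_mod_cast hm1
  have h := norm_sub_mul_le_of_mapClusterPt hf hM hC h₁ h₂ (one_le_pow₀ hm1 : 1 ≤ m ^ 2)
  rw [Nat.cast_pow, Real.sqrt_sq hm0.le] at h
  have h2 : 32 * m * M ≤ 32 * m * |M| := by gcongr; exact le_abs_self M
  nlinarith

/-- If `f` has bounded operator oscillation on `F`, then `f t / t` converges at infinity in `F`. -/
theorem exists_tendsto_div_atInftyWithin (hFunb : ∀ R : ℝ, 0 < R → ∃ t ∈ F, R < |t|)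
    (hf : Continuous f)
    (hM : ∀ A B : ellTwo →L[ℂ] ellTwo, IsSelfAdjoint A → IsSelfAdjoint B →
      spectrum ℝ A ⊆ F → spectrum ℝ B ⊆ F → ‖A - B‖ ≤ 1 →
      ‖cfcC f A - cfcC f B‖ ≤ M) :
    ∃ L : ℂ, Tendsto (fun t ↦ f t / (t : ℂ)) (atInftyWithin F) (𝓝 L) := by
  have hne := atInftyWithin_neBot hFunb
  obtain ⟨t₀, ht₀, -⟩ := hFunb 1 one_pos
  obtain ⟨C, hC⟩ := exists_eventually_norm_div_le ⟨t₀, ht₀⟩ hf hM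
  have hmem : Metric.closedBall (0 : ℂ) C ∈ map (fun t ↦ f t / (t : ℂ)) (atInftyWithin F) := by
    exact mem_map.2 (hC.mono fun t ht ↦ mem_closedBall_zero_iff.2 ht)
  have hcpt := isCompact_closedBall (0 : ℂ) C
  obtain ⟨L, -, hL⟩ := hcpt.exists_clusterPt (le_principal_iff.2 hmem)
  exact ⟨L, hcpt.le_nhds_of_unique_clusterPt hmem
    fun L' _ hL' ↦ eq_of_mapClusterPt_div hf hM hC hL' hL⟩

end AtInfinity

theorem stmt11 (F : Set ℝ) (hFclosed : IsClosed F)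
    (hFunb : ∀ R : ℝ, 0 < R → ∃ t ∈ F, R < |t|)
    (f : ℝ → ℂ) (hf : Continuous f) (M : ℝ)
    (hM : ∀ A B : ellTwo →L[ℂ] ellTwo, IsSelfAdjoint A → IsSelfAdjoint B →
      spectrum ℝ A ⊆ F → spectrum ℝ B ⊆ F → ‖A - B‖ ≤ 1 →
      ‖cfcC f A - cfcC f B‖ ≤ M) :
    ∃ L : ℂ, ∀ ε : ℝ, 0 < ε → ∃ R : ℝ, 0 < R ∧
      ∀ t ∈ F, R ≤ |t| → ‖f t / (t : ℂ) - L‖ ≤ ε := by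
  obtain ⟨L, hlim⟩ := exists_tendsto_div_atInftyWithin hFunb hf hM
  refine ⟨L, fun ε hε ↦ ?_⟩
  have hev := hlim.eventually (Metric.closedBall_mem_nhds L hε)
  rw [atInftyWithin, Filter.eventually_inf_principal,
    (Filter.atTop_basis.comap _).eventually_iff] at hev
  obtain ⟨R, -, hR⟩ := hev
  refine ⟨max R 1, by positivity, fun t ht hRt ↦ ?_⟩
  have := hR (show t ∈ abs ⁻¹' Set.Ici R from (le_max_left _ _).trans hRt) ht
  rwa [dist_eq_norm] at this
end

section
/- There exist a constant c > 0 and an infinitely differentiable function f : ℝ → ℂ with |f(x)| ≤ 1 and |f'(x)| ≤ 1 for all x ∈ ℝ (in particular f is 1-Lipschitz), such that for every δ ∈ (0, 1] there exist bounded self-adjoint operators A, B on the Hilbert space ℓ²(ℕ, ℂ) with ‖A − B‖ ≤ δ and ‖f(A) − f(B)‖ ≥ c · δ · √(log(2/δ)). -/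
open MeasureTheory ENNReal

section

open Polynomial

/-- The Hilbert space `ℓ²(ℤ, ℂ)`. -/
abbrev EllTwoInt : Type := lp (fun _ : ℤ => ℂ) 2

lemma sum_sq_comp_le {v : ℤ → ℝ} {σ : ℤ → ℤ} {C : ℝ} (hv : ∀ j, |v j| ≤ C)
    (hσ : Set.InjOn σ {j | v j ≠ 0}) (x : EllTwoInt) :
    (Summable fun j => ‖(v j : ℂ) * x (σ j)‖ ^ 2) ∧
      ∑' j, ‖(v j : ℂ) * x (σ j)‖ ^ 2 ≤ C ^ 2 * ‖x‖ ^ 2 := by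
  have hx : Summable fun j => ‖x j‖ ^ 2 := by
    have := (lp.memℓp x).summable (by simp)
    simpa using this
  have hC : 0 ≤ C := (abs_nonneg _).trans (hv 0)
  have hnorm : ‖x‖ ^ 2 = ∑' j, ‖x j‖ ^ 2 := by
    have := lp.norm_rpow_eq_tsum (p := 2) (by simp) x
    simpa using this
  have key : ∀ s : Finset ℤ, ∑ j ∈ s, ‖(v j : ℂ) * x (σ j)‖ ^ 2 ≤ C ^ 2 * ‖x‖ ^ 2 := by
    intro s
    have h1 : ∑ j ∈ s, ‖(v j : ℂ) * x (σ j)‖ ^ 2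
        = ∑ j ∈ s with v j ≠ 0, ‖(v j : ℂ) * x (σ j)‖ ^ 2 := by
      rw [Finset.sum_filter_of_ne]
      intro j _ h h0
      exact h (by simp [h0])
    have h2 : ∑ j ∈ s with v j ≠ 0, ‖(v j : ℂ) * x (σ j)‖ ^ 2
        ≤ ∑ j ∈ s with v j ≠ 0, C ^ 2 * ‖x (σ j)‖ ^ 2 := by
      refine Finset.sum_le_sum fun j _ => ?_
      rw [norm_mul, mul_pow, Complex.norm_real, Real.norm_eq_abs]
      gcongr
      exact hv j
    have h3 : ∑ j ∈ s with v j ≠ 0, ‖x (σ j)‖ ^ 2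
        = ∑ k ∈ (s.filter fun j => v j ≠ 0).image σ, ‖x k‖ ^ 2 := by
      rw [Finset.sum_image]
      intro a ha b hb
      exact hσ (Finset.mem_filter.1 ha).2 (Finset.mem_filter.1 hb).2
    rw [h1]
    refine h2.trans ?_
    rw [← Finset.mul_sum, h3, hnorm]
    gcongr
    exact hx.sum_le_tsum _ fun _ _ => by positivity
  have hs := summable_of_sum_le (fun j => by positivity) key
  exact ⟨hs, hs.tsum_le_of_sum_le key⟩

lemma opNorm_le_of_apply_eq {T : EllTwoInt →L[ℂ] EllTwoInt} {v : ℤ → ℝ} {σ : ℤ → ℤ} {C : ℝ}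
    (hv : ∀ j, |v j| ≤ C) (hσ : Set.InjOn σ {j | v j ≠ 0})
    (hT : ∀ x j, T x j = v j * x (σ j)) : ‖T‖ ≤ C := by
  have hC : 0 ≤ C := (abs_nonneg _).trans (hv 0)
  refine T.opNorm_le_bound hC fun x => ?_
  have hnorm : ‖T x‖ ^ 2 = ∑' j, ‖T x j‖ ^ 2 := by
    have := lp.norm_rpow_eq_tsum (p := 2) (by simp) (T x)
    simpa using this
  refine le_of_sq_le_sq ?_ (by positivity)
  rw [hnorm, mul_pow]
  simp only [hT]
  exact (sum_sq_comp_le hv hσ x).2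

/-- The weighted shift `e_k ↦ w k • e_{k+m}`. -/
noncomputable def weightedShift (w : ℤ → ℝ) (C : ℝ) (hw : ∀ k, |w k| ≤ C) (m : ℤ) :
    EllTwoInt →L[ℂ] EllTwoInt :=
  have inj : Set.InjOn (fun j : ℤ => j - m) {j | w (j - m) ≠ 0} := fun a _ b _ h => by
    simpa using h
  LinearMap.mkContinuous
    { toFun := fun x => ⟨fun j => (w (j - m) : ℂ) * x (j - m), by
        refine memℓp_gen ?_
        simpa using (sum_sq_comp_le (fun j => hw (j - m)) inj x).1⟩
      map_add' := fun x y => by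
        ext j
        exact mul_add _ _ _
      map_smul' := fun c x => by
        ext j
        simp [mul_left_comm] } C (fun x => by
      have hC : 0 ≤ C := (abs_nonneg _).trans (hw 0)
      refine le_of_sq_le_sq ?_ (by positivity)
      have := lp.norm_rpow_eq_tsum (p := 2) (by simp)
        (⟨fun j => (w (j - m) : ℂ) * x (j - m), by
          refine memℓp_gen ?_
          simpa using (sum_sq_comp_le (fun j => hw (j - m)) inj x).1⟩ : EllTwoInt)
      rw [mul_pow]
      simp only [ENNReal.toReal_ofNat, Real.rpow_ofNat] at this
      refine this.trans_le ?_
      exact (sum_sq_comp_le (fun j => hw (j - m)) inj x).2)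

@[simp]
lemma weightedShift_apply (w : ℤ → ℝ) (C : ℝ) (hw : ∀ k, |w k| ≤ C) (m : ℤ) (x : EllTwoInt)
    (j : ℤ) : weightedShift w C hw m x j = w (j - m) * x (j - m) := rfl

lemma norm_weightedShift_le (w : ℤ → ℝ) (C : ℝ) (hw : ∀ k, |w k| ≤ C) (m : ℤ) :
    ‖weightedShift w C hw m‖ ≤ C :=
  opNorm_le_of_apply_eq (v := fun j => w (j - m)) (σ := fun j => j - m) (fun j => hw (j - m))
    (fun a _ b _ h => by simpa using h) fun x j => rfl

lemma star_weightedShift (w : ℤ → ℝ) (C : ℝ) (hw : ∀ k, |w k| ≤ C) (m : ℤ) :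
    star (weightedShift w C hw m)
      = weightedShift (fun k => w (k - m)) C (fun k => hw (k - m)) (-m) := by
  rw [ContinuousLinearMap.star_eq_adjoint, eq_comm, ContinuousLinearMap.eq_adjoint_iff]
  intro x y
  rw [lp.inner_eq_tsum, lp.inner_eq_tsum, ← (Equiv.subRight m).tsum_eq]
  refine tsum_congr fun j => ?_
  simp
  ring

/-- The bilateral shift. -/
noncomputable def bilateralShift : EllTwoInt →L[ℂ] EllTwoInt :=
  weightedShift (fun _ => 1) 1 (by simp) 1

lemma bilateralShift_apply (x : EllTwoInt) (j : ℤ) : bilateralShift x j = x (j - 1) := by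
  simp [bilateralShift]

lemma star_bilateralShift_apply (x : EllTwoInt) (j : ℤ) :
    star bilateralShift x j = x (j + 1) := by
  simp [bilateralShift, star_weightedShift]

lemma star_bilateralShift_mul_self : star bilateralShift * bilateralShift = 1 := by
  ext x j
  simp [star_bilateralShift_apply, bilateralShift_apply]

lemma bilateralShift_mul_star_self : bilateralShift * star bilateralShift = 1 := by
  ext x j
  simp [star_bilateralShift_apply, bilateralShift_apply]

lemma norm_bilateralShift_le : ‖bilateralShift‖ ≤ 1 := norm_weightedShift_le _ _ _ _

/-- The real part of the bilateral shift, i.e. multiplication by `cos` in the Fourier picture. -/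
noncomputable def reShift : EllTwoInt →L[ℂ] EllTwoInt :=
  (1 / 2 : ℂ) • (bilateralShift + star bilateralShift)

lemma reShift_apply (x : EllTwoInt) (j : ℤ) : reShift x j = (x (j - 1) + x (j + 1)) / 2 := by
  have h : reShift x j = (1 / 2 : ℂ) * (bilateralShift x j + star bilateralShift x j) := rfl
  rw [h, star_bilateralShift_apply, bilateralShift_apply]
  ring

lemma isSelfAdjoint_reShift : IsSelfAdjoint reShift := by
  simp [reShift, isSelfAdjoint_iff, add_comm]

lemma norm_reShift_le : ‖reShift‖ ≤ 1 := by
  have h := norm_add_le bilateralShift (star bilateralShift)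
  have h' : ‖star bilateralShift‖ = ‖bilateralShift‖ :=
    LinearIsometryEquiv.norm_map _ _
  rw [reShift, norm_smul]
  have := norm_bilateralShift_le
  norm_num
  linarith

/-- The standard basis vector `e_m`. -/
noncomputable def basisVec (m : ℤ) : EllTwoInt := lp.single 2 m 1

lemma basisVec_apply (m j : ℤ) : basisVec m j = if j = m then 1 else 0 := by
  simp [basisVec, Pi.single_apply]

lemma norm_basisVec (m : ℤ) : ‖basisVec m‖ = 1 := by
  simp [basisVec, lp.norm_single]

/-- The Fourier coefficient of `F ∘ cos` at `m`. -/
noncomputable def cosCoeff (F : ℂ[X]) (m : ℤ) : ℂ := aeval reShift F (basisVec 0) m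

lemma cosCoeff_add (F G : ℂ[X]) (m : ℤ) : cosCoeff (F + G) m = cosCoeff F m + cosCoeff G m := by
  simp [cosCoeff]

lemma cosCoeff_sub (F G : ℂ[X]) (m : ℤ) : cosCoeff (F - G) m = cosCoeff F m - cosCoeff G m := by
  simp [cosCoeff]

lemma cosCoeff_C_mul (a : ℂ) (F : ℂ[X]) (m : ℤ) : cosCoeff (C a * F) m = a * cosCoeff F m := by
  simp [cosCoeff, Algebra.algebraMap_eq_smul_one]

lemma cosCoeff_X_mul (F : ℂ[X]) (m : ℤ) :
    cosCoeff (X * F) m = (cosCoeff F (m - 1) + cosCoeff F (m + 1)) / 2 := by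
  simp [cosCoeff, reShift_apply]

lemma cosCoeff_one (m : ℤ) : cosCoeff 1 m = if m = 0 then 1 else 0 := by
  simp [cosCoeff, basisVec_apply]

lemma Polynomial.induction_X_mul {P : ℂ[X] → Prop} (F : ℂ[X]) (h1 : P 1)
    (hadd : ∀ F G, P F → P G → P (F + G)) (hC : ∀ a F, P F → P (C a * F))
    (hX : ∀ F, P F → P (X * F)) : P F := by
  have hpow : ∀ n : ℕ, P (X ^ n) := by
    intro n
    induction n with
    | zero => simpa using h1
    | succ n ih => rw [pow_succ']; exact hX _ ih
  induction F using Polynomial.induction_on' with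
  | add F G hF hG => exact hadd F G hF hG
  | monomial n a => rw [← C_mul_X_pow_eq_monomial]; exact hC _ _ (hpow n)

lemma cosCoeff_neg_index (F : ℂ[X]) (m : ℤ) : cosCoeff F (-m) = cosCoeff F m := by
  induction F using Polynomial.induction_X_mul generalizing m with
  | h1 => simp [cosCoeff_one]
  | hadd F G hF hG => simp [cosCoeff_add, hF, hG]
  | hC a F hF => simp [cosCoeff_C_mul, hF]
  | hX F hF =>
    rw [cosCoeff_X_mul, cosCoeff_X_mul, ← hF (m - 1), ← hF (m + 1)]
    ring_nf

lemma aeval_reShift_basisVec (F : ℂ[X]) (m j : ℤ) :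
    aeval reShift F (basisVec m) j = cosCoeff F (j - m) := by
  induction F using Polynomial.induction_X_mul generalizing j with
  | h1 => simp [cosCoeff_one, basisVec_apply, sub_eq_zero]
  | hadd F G hF hG => simp [cosCoeff_add, hF, hG]
  | hC a F hF => simp [cosCoeff_C_mul, hF, Algebra.algebraMap_eq_smul_one]
  | hX F hF =>
    simp only [cosCoeff_X_mul, map_mul, aeval_X, mul_apply_eq_comp, reShift_apply, hF]
    ring_nf

lemma mul_cosCoeff (F : ℂ[X]) (m : ℤ) :
    m * cosCoeff F m = (cosCoeff (derivative F) (m - 1) - cosCoeff (derivative F) (m + 1)) / 2 := by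
  induction F using Polynomial.induction_X_mul generalizing m with
  | h1 =>
    rw [cosCoeff_one]
    rcases eq_or_ne m 0 with rfl | hm <;> simp [cosCoeff, *]
  | hadd F G hF hG => simp [cosCoeff_add, hF, hG, mul_add]; ring
  | hC a F hF =>
    simp only [cosCoeff_C_mul, derivative_C_mul]
    linear_combination a * hF m
  | hX F hF =>
    simp only [derivative_mul, derivative_X, one_mul, cosCoeff_add, cosCoeff_X_mul]
    have h1 := hF (m - 1)
    have h2 := hF (m + 1)
    push_cast at h1 h2
    ring_nf at h1 h2 ⊢
    linear_combination h1 / 2 + h2 / 2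

lemma cosCoeff_T_mul (k : ℤ) (F : ℂ[X]) (m : ℤ) :
    cosCoeff (Chebyshev.T ℂ k * F) m = (cosCoeff F (m - k) + cosCoeff F (m + k)) / 2 := by
  induction k using Polynomial.Chebyshev.induct generalizing m with
  | zero => simp
  | one => simp [cosCoeff_X_mul]
  | add_two n h1 h0 =>
    rw [Chebyshev.T_add_two, show (2 * X * Chebyshev.T ℂ (n + 1) - Chebyshev.T ℂ n) * F
      = C 2 * (X * (Chebyshev.T ℂ (n + 1) * F)) - Chebyshev.T ℂ n * F by
        rw [show (C 2 : ℂ[X]) = 2 from rfl]; ring]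
    rw [cosCoeff_sub, cosCoeff_C_mul, cosCoeff_X_mul, h1, h1, h0]
    ring_nf
  | neg_add_one n h0 h1 =>
    rw [Chebyshev.T_sub_one, show (2 * X * Chebyshev.T ℂ (-n) - Chebyshev.T ℂ (-n + 1)) * F
      = C 2 * (X * (Chebyshev.T ℂ (-n) * F)) - Chebyshev.T ℂ (-n + 1) * F by
        rw [show (C 2 : ℂ[X]) = 2 from rfl]; ring]
    rw [cosCoeff_sub, cosCoeff_C_mul, cosCoeff_X_mul, h0, h0, h1]
    ring_nf

/-- The Riesz product `∏_{k < n} (1 + i α T_{4 * 8 ^ k - 1})`. -/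
noncomputable def rieszProduct (α : ℝ) (n : ℕ) : ℂ[X] :=
  ∏ k ∈ Finset.range n, (1 + C (Complex.I * α) * Chebyshev.T ℂ (4 * 8 ^ k - 1))

lemma cosCoeff_rieszProduct_succ (α : ℝ) (n : ℕ) (m : ℤ) :
    cosCoeff (rieszProduct α (n + 1)) m = cosCoeff (rieszProduct α n) m + Complex.I * α / 2 *
      (cosCoeff (rieszProduct α n) (m - (4 * 8 ^ n - 1))
        + cosCoeff (rieszProduct α n) (m + (4 * 8 ^ n - 1))) := by
  rw [rieszProduct, Finset.prod_range_succ, ← rieszProduct, mul_comm, add_mul, one_mul, mul_assoc,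
    cosCoeff_add, cosCoeff_C_mul, cosCoeff_T_mul]
  ring

lemma cosCoeff_rieszProduct_eq_zero (α : ℝ) (n : ℕ) (m : ℤ) (hm : 8 ^ n ≤ |m|) :
    cosCoeff (rieszProduct α n) m = 0 := by
  induction n generalizing m with
  | zero =>
    rw [rieszProduct, Finset.prod_range_zero, cosCoeff_one, if_neg]
    rintro rfl
    simp at hm
  | succ n ih =>
    have h8 : (1 : ℤ) ≤ 8 ^ n := one_le_pow₀ (by norm_num)
    rw [pow_succ] at hm
    rw [cosCoeff_rieszProduct_succ, ih, ih, ih] <;> grind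

lemma cosCoeff_rieszProduct_succ_of_le (α : ℝ) (n : ℕ) (m : ℤ) (hm : |m| ≤ 3 * 8 ^ n - 1) :
    cosCoeff (rieszProduct α (n + 1)) m = cosCoeff (rieszProduct α n) m := by
  rw [cosCoeff_rieszProduct_succ, cosCoeff_rieszProduct_eq_zero α n (m - _),
    cosCoeff_rieszProduct_eq_zero α n (m + _)] <;> grind

lemma cosCoeff_rieszProduct_of_le (α : ℝ) {n N : ℕ} (hn : n ≤ N) (m : ℤ)
    (hm : |m| ≤ 3 * 8 ^ n - 1) :
    cosCoeff (rieszProduct α N) m = cosCoeff (rieszProduct α n) m := by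
  induction N, hn using Nat.le_induction with
  | base => rfl
  | succ N hN ih =>
    rw [cosCoeff_rieszProduct_succ_of_le, ih]
    have : (8 : ℤ) ^ n ≤ 8 ^ N := pow_le_pow_right₀ (by norm_num) hN
    linarith

lemma cosCoeff_rieszProduct_zero (α : ℝ) (n : ℕ) : cosCoeff (rieszProduct α n) 0 = 1 := by
  rw [cosCoeff_rieszProduct_of_le α (Nat.zero_le n) 0 (by simp), rieszProduct,
    Finset.prod_range_zero, cosCoeff_one, if_pos rfl]

lemma cosCoeff_rieszProduct_two (α : ℝ) (n : ℕ) : cosCoeff (rieszProduct α n) 2 = 0 := by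
  rw [cosCoeff_rieszProduct_of_le α (Nat.zero_le n) 2 (by simp), rieszProduct,
    Finset.prod_range_zero, cosCoeff_one, if_neg (by norm_num)]

lemma cosCoeff_rieszProduct_sub_one (α : ℝ) {n N : ℕ} (hn : n < N) :
    cosCoeff (rieszProduct α N) (4 * 8 ^ n - 1) = Complex.I * α / 2 := by
  have h8 : (1 : ℤ) ≤ 8 ^ n := one_le_pow₀ (by norm_num)
  rw [cosCoeff_rieszProduct_of_le α (Nat.succ_le_of_lt hn) _
      (by rw [Nat.succ_eq_add_one, pow_succ]; grind),
    cosCoeff_rieszProduct_succ, sub_self, cosCoeff_rieszProduct_zero,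
    cosCoeff_rieszProduct_eq_zero α n _ (by grind),
    cosCoeff_rieszProduct_eq_zero α n (_ + _) (by grind)]
  ring

lemma cosCoeff_rieszProduct_add_one (α : ℝ) {n N : ℕ} (hn : n < N) :
    cosCoeff (rieszProduct α N) (4 * 8 ^ n + 1) = 0 := by
  have h8 : (1 : ℤ) ≤ 8 ^ n := one_le_pow₀ (by norm_num)
  rw [cosCoeff_rieszProduct_of_le α (Nat.succ_le_of_lt hn) _
      (by rw [Nat.succ_eq_add_one, pow_succ]; grind),
    cosCoeff_rieszProduct_succ,
    cosCoeff_rieszProduct_eq_zero α n _ (by grind),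
    cosCoeff_rieszProduct_eq_zero α n (_ + _) (by grind),
    show (4 * 8 ^ n + 1 - (4 * 8 ^ n - 1) : ℤ) = 2 by ring, cosCoeff_rieszProduct_two]
  ring

lemma cosCoeff_primitive_rieszProduct (α : ℝ) {n N : ℕ} (hn : n < N) (F : ℂ[X])
    (hF : derivative F = rieszProduct α N) :
    8 ^ n * cosCoeff F (4 * 8 ^ n) = Complex.I * α / 16 := by
  have h := mul_cosCoeff F (4 * 8 ^ n)
  rw [hF, cosCoeff_rieszProduct_sub_one α hn, cosCoeff_rieszProduct_add_one α hn] at h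
  push_cast at h
  linear_combination h / 4

/-- The ramp that is `0` left of `-2 * 8 ^ n` and `8 ^ n` right of `-8 ^ n`. -/
noncomputable def ramp (n : ℕ) (k : ℤ) : ℝ := ((max 0 (min (8 ^ n) (k + 2 * 8 ^ n)) : ℤ) : ℝ)

lemma abs_ramp_le (n : ℕ) (k : ℤ) : |ramp n k| ≤ 8 ^ n := by
  have h8 : (1 : ℤ) ≤ 8 ^ n := one_le_pow₀ (by norm_num)
  rw [ramp]
  norm_cast
  push_cast
  grind

lemma abs_ramp_sub_ramp_le (n : ℕ) (k : ℤ) : |ramp n k - ramp n (k + 1)| ≤ 1 := by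
  have h8 : (1 : ℤ) ≤ 8 ^ n := one_le_pow₀ (by norm_num)
  rw [ramp, ramp]
  norm_cast
  push_cast
  grind

lemma mem_Ico_of_ramp_sub_ramp_ne_zero {n : ℕ} {k : ℤ} (h : ramp n k - ramp n (k + 1) ≠ 0) :
    k ∈ Set.Ico (-2 * 8 ^ n) (-8 ^ n : ℤ) := by
  have h8 : (1 : ℤ) ≤ 8 ^ n := one_le_pow₀ (by norm_num)
  rw [ramp, ramp] at h
  norm_cast at h
  push_cast at h
  grind

lemma ramp_zero (n : ℕ) : ramp n 0 = 8 ^ n := by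
  have h8 : (1 : ℤ) ≤ 8 ^ n := one_le_pow₀ (by norm_num)
  rw [ramp, show (max 0 (min (8 ^ n) (0 + 2 * 8 ^ n)) : ℤ) = 8 ^ n by grind]
  norm_cast

lemma ramp_neg (n : ℕ) : ramp n (-(4 * 8 ^ n)) = 0 := by
  have h8 : (1 : ℤ) ≤ 8 ^ n := one_le_pow₀ (by norm_num)
  rw [ramp, show (max 0 (min (8 ^ n) (-(4 * 8 ^ n) + 2 * 8 ^ n)) : ℤ) = 0 by grind]
  norm_cast

/-- Two numbers in dyadic-type blocks of ratio `8` lie in the same block. -/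
lemma eq_of_mem_blocks {n m : ℕ} {a : ℤ} {b : ℤ} (hn : b * 8 ^ n ≤ a) (hn' : a ≤ 2 * b * 8 ^ n)
    (hm : b * 8 ^ m ≤ a) (hm' : a ≤ 2 * b * 8 ^ m) (hb : 0 < b) : n = m := by
  have aux : ∀ {n m : ℕ}, b * 8 ^ m ≤ a → a ≤ 2 * b * 8 ^ n → m ≤ n := by
    intro n m h1 h2
    by_contra! hlt
    have h3 : (8 : ℤ) ^ (n + 1) ≤ 8 ^ m := pow_le_pow_right₀ (by norm_num) hlt
    have h8 : (1 : ℤ) ≤ 8 ^ n := one_le_pow₀ (by norm_num)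
    rw [pow_succ] at h3
    nlinarith
  exact le_antisymm (aux hn hm') (aux hm hn')

/-- The sum of the `N` ramp-weighted shifts of lengths `4 * 8 ^ n`. -/
noncomputable def rampSum (N : ℕ) : EllTwoInt →L[ℂ] EllTwoInt :=
  ∑ n ∈ Finset.range N, weightedShift (ramp n) (8 ^ n) (abs_ramp_le n) (4 * 8 ^ n)

lemma rampSum_apply (N : ℕ) (x : EllTwoInt) : rampSum N x =
    ∑ n ∈ Finset.range N, weightedShift (ramp n) (8 ^ n) (abs_ramp_le n) (4 * 8 ^ n) x := by
  simp [rampSum]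

lemma star_rampSum_apply (N : ℕ) (x : EllTwoInt) : star (rampSum N) x =
    ∑ n ∈ Finset.range N, weightedShift (fun k => ramp n (k - 4 * 8 ^ n)) (8 ^ n)
      (fun _ => abs_ramp_le n _) (-(4 * 8 ^ n)) x := by
  simp [rampSum, star_sum, star_weightedShift]

lemma sum_apply_coord (N : ℕ) (f : ℕ → EllTwoInt) (j : ℤ) :
    (∑ n ∈ Finset.range N, f n) j = ∑ n ∈ Finset.range N, f n j := by
  induction N with
  | zero => simp
  | succ N ih => rw [Finset.sum_range_succ, Finset.sum_range_succ, ← ih]; rfl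

lemma norm_rampSum_le (N : ℕ) : ‖rampSum N‖ ≤ 8 ^ N / 2 := by
  have h : ‖rampSum N‖ ≤ ∑ n ∈ Finset.range N, (8 : ℝ) ^ n :=
    norm_sum_le_of_le _ fun n _ => norm_weightedShift_le _ _ _ _
  refine h.trans ?_
  rw [geom_sum_eq (by norm_num)]
  have : (0 : ℝ) < 8 ^ N := by positivity
  linarith

lemma norm_commutator_bilateralShift_rampSum_le (N : ℕ) :
    ‖bilateralShift * rampSum N - rampSum N * bilateralShift‖ ≤ 1 := by
  classical
  set d : ℕ → ℤ → ℝ := fun n k => ramp n k - ramp n (k + 1) with hd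
  have key : ∀ x j, (bilateralShift * rampSum N - rampSum N * bilateralShift) x j
      = ∑ n ∈ Finset.range N, (d n (j - 1 - 4 * 8 ^ n) : ℂ) * x (j - 1 - 4 * 8 ^ n) := by
    intro x j
    have h : (bilateralShift * rampSum N - rampSum N * bilateralShift) x j
      = bilateralShift (rampSum N x) j - rampSum N (bilateralShift x) j := rfl
    rw [h, bilateralShift_apply, rampSum_apply, rampSum_apply, sum_apply_coord, sum_apply_coord,
      ← Finset.sum_sub_distrib]
    refine Finset.sum_congr rfl fun n _ => ?_
    rw [weightedShift_apply, weightedShift_apply, bilateralShift_apply, hd]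
    dsimp only
    rw [show j - 1 - 4 * 8 ^ n + 1 = j - 4 * 8 ^ n by ring,
      show j - 4 * 8 ^ n - 1 = j - 1 - 4 * 8 ^ n by ring]
    push_cast
    ring
  have huniq : ∀ j n m, d n (j - 1 - 4 * 8 ^ n) ≠ 0 → d m (j - 1 - 4 * 8 ^ m) ≠ 0 → n = m := by
    intro j n m hn hm
    have hn := mem_Ico_of_ramp_sub_ramp_ne_zero hn
    have hm := mem_Ico_of_ramp_sub_ramp_ne_zero hm
    have h8 : (1 : ℤ) ≤ 8 ^ n := one_le_pow₀ (by norm_num)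
    have h8' : (1 : ℤ) ≤ 8 ^ m := one_le_pow₀ (by norm_num)
    rw [Set.mem_Ico] at hn hm
    refine eq_of_mem_blocks (a := j - 1) (b := 2) ?_ ?_ ?_ ?_ (by norm_num) <;> linarith
  have hex : ∀ j, ∃ n, ∀ m ∈ Finset.range N, m ≠ n → d m (j - 1 - 4 * 8 ^ m) = 0 := by
    intro j
    by_cases h : ∃ n ∈ Finset.range N, d n (j - 1 - 4 * 8 ^ n) ≠ 0
    · obtain ⟨n, -, hn⟩ := h
      exact ⟨n, fun m _ hm => by_contra fun h0 => hm (huniq j m n h0 hn)⟩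
    · push Not at h
      exact ⟨0, fun m hm _ => h m hm⟩
  choose ν hν using hex
  refine opNorm_le_of_apply_eq
    (v := fun j => if ν j ∈ Finset.range N then d (ν j) (j - 1 - 4 * 8 ^ ν j) else 0)
    (σ := fun j => j - 1 - 4 * 8 ^ ν j) (fun j => ?_) ?_ fun x j => ?_
  · split_ifs
    · exact abs_ramp_sub_ramp_le _ _
    · simp
  · intro i hi j hj hij
    simp only [Set.mem_ofPred_eq] at hi hj hij
    have hi' := mem_Ico_of_ramp_sub_ramp_ne_zero (ite_ne_right_iff.1 hi).2
    have hj' := mem_Ico_of_ramp_sub_ramp_ne_zero (ite_ne_right_iff.1 hj).2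
    rw [← hij] at hj'
    rw [Set.mem_Ico] at hi' hj'
    have : ν i = ν j := by
      refine eq_of_mem_blocks (a := -(i - 1 - 4 * 8 ^ ν i)) (b := 1) ?_ ?_ ?_ ?_ (by norm_num) <;>
        linarith
    rw [this] at hij
    linarith
  · rw [key]
    dsimp only
    by_cases h : ν j ∈ Finset.range N
    · rw [if_pos h]
      exact Finset.sum_eq_single_of_mem _ h fun m hm hne => by simp [hν j m hm hne]
    · rw [if_neg h]
      simp only [Complex.ofReal_zero, zero_mul]
      refine Finset.sum_eq_zero fun m hm => ?_
      rw [hν j m hm (by rintro rfl; exact h hm)]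
      simp

/-- The skew-adjoint operator almost commuting with `reShift`. -/
noncomputable def skewRamp (N : ℕ) : EllTwoInt →L[ℂ] EllTwoInt := rampSum N - star (rampSum N)

lemma star_skewRamp (N : ℕ) : star (skewRamp N) = -skewRamp N := by
  simp [skewRamp]

lemma norm_star_ellTwoInt (T : EllTwoInt →L[ℂ] EllTwoInt) : ‖star T‖ = ‖T‖ :=
  LinearIsometryEquiv.norm_map _ _

lemma norm_skewRamp_le (N : ℕ) : ‖skewRamp N‖ ≤ 8 ^ N := by
  have h := norm_sub_le (rampSum N) (star (rampSum N))
  have h' := norm_star_ellTwoInt (rampSum N)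
  have := norm_rampSum_le N
  rw [skewRamp]
  linarith

lemma norm_commutator_reShift_skewRamp_le (N : ℕ) :
    ‖reShift * skewRamp N - skewRamp N * reShift‖ ≤ 2 := by
  set S := bilateralShift
  set R := rampSum N
  set E := S * R - R * S with hE
  have hE1 : ‖E‖ ≤ 1 := norm_commutator_bilateralShift_rampSum_le N
  have hS : star S * S = 1 := star_bilateralShift_mul_self
  have hS' : S * star S = 1 := bilateralShift_mul_star_self
  have hS1 : ‖S‖ ≤ 1 := norm_bilateralShift_le
  have hS2 : ‖star S‖ ≤ 1 := (norm_star_ellTwoInt S).trans_le hS1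
  have h1 : star S * R - R * star S = -(star S * E * star S) := by
    have e1 : star S * E * star S = star S * S * R * star S - star S * R * (S * star S) := by
      rw [hE]; noncomm_ring
    rw [e1, hS, hS']
    noncomm_ring
  have hD : ‖star S * R - R * star S‖ ≤ 1 := by
    rw [h1, norm_neg]
    calc ‖star S * E * star S‖ ≤ ‖star S‖ * ‖E‖ * ‖star S‖ :=
          (norm_mul_le _ _).trans (by gcongr; exact norm_mul_le _ _)
      _ ≤ 1 * 1 * 1 := by gcongr
      _ = 1 := by norm_num
  have hA : ‖reShift * R - R * reShift‖ ≤ 1 := by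
    have : reShift * R - R * reShift = (1 / 2 : ℂ) • (E + (star S * R - R * star S)) := by
      rw [reShift, smul_mul_assoc, mul_smul_comm, ← smul_sub, hE]
      congr 1
      noncomm_ring
    rw [this, norm_smul]
    have := norm_add_le E (star S * R - R * star S)
    norm_num
    linarith
  have hfin : reShift * skewRamp N - skewRamp N * reShift
      = (reShift * R - R * reShift) + star (reShift * R - R * reShift) := by
    rw [star_sub, star_mul, star_mul, isSelfAdjoint_reShift.star_eq, skewRamp]
    noncomm_ring
  rw [hfin]
  have := norm_add_le (reShift * R - R * reShift) (star (reShift * R - R * reShift))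
  have := norm_star_ellTwoInt (reShift * R - R * reShift)
  linarith

lemma weightedShift_basisVec (w : ℤ → ℝ) (C : ℝ) (hw : ∀ k, |w k| ≤ C) (m k : ℤ) :
    weightedShift w C hw m (basisVec k) = (w k : ℂ) • basisVec (k + m) := by
  ext j
  have h : ((w k : ℂ) • basisVec (k + m)) j = (w k : ℂ) * basisVec (k + m) j := rfl
  rw [h, weightedShift_apply, basisVec_apply, basisVec_apply]
  by_cases hj : j = k + m
  · subst hj; simp
  · rw [if_neg hj, if_neg (by omega)]; simp

lemma norm_coord_le (x : EllTwoInt) (j : ℤ) : ‖x j‖ ≤ ‖x‖ := lp.norm_apply_le_norm (by simp) x j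

lemma le_norm_commutator_aeval_skewRamp (α : ℝ) (N : ℕ) (F : ℂ[X])
    (hF : derivative F = rieszProduct α N) :
    N * α / 8 ≤ ‖aeval reShift F * skewRamp N - skewRamp N * aeval reShift F‖ := by
  set G := aeval reShift F with hG
  have hR : rampSum N (basisVec 0) = ∑ n ∈ Finset.range N, (8 ^ n : ℂ) • basisVec (4 * 8 ^ n) := by
    rw [rampSum_apply]
    refine Finset.sum_congr rfl fun n _ => ?_
    rw [weightedShift_basisVec, ramp_zero, zero_add]
    push_cast
    rfl
  have hR' : star (rampSum N) (basisVec 0) = 0 := by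
    rw [star_rampSum_apply]
    refine Finset.sum_eq_zero fun n _ => ?_
    rw [weightedShift_basisVec, zero_sub, ramp_neg]
    simp
  have h1 : G (rampSum N (basisVec 0)) 0 = N * (Complex.I * α / 16) := by
    rw [hR, map_sum, sum_apply_coord]
    refine (Finset.sum_congr rfl (g := fun _ => Complex.I * α / 16) fun n hn => ?_).trans (by simp)
    rw [map_smul, ← cosCoeff_primitive_rieszProduct α (Finset.mem_range.1 hn) F hF,
      ← cosCoeff_neg_index, ← zero_sub, ← aeval_reShift_basisVec]
    rfl
  have h2 : rampSum N (G (basisVec 0)) 0 = 0 := by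
    rw [rampSum_apply, sum_apply_coord]
    refine Finset.sum_eq_zero fun n _ => ?_
    rw [weightedShift_apply, zero_sub, ramp_neg]
    simp
  have h3 : star (rampSum N) (G (basisVec 0)) 0 = N * (Complex.I * α / 16) := by
    rw [star_rampSum_apply, sum_apply_coord]
    refine (Finset.sum_congr rfl (g := fun _ => Complex.I * α / 16) fun n hn => ?_).trans (by simp)
    rw [← cosCoeff_primitive_rieszProduct α (Finset.mem_range.1 hn) F hF, weightedShift_apply,
      zero_sub, neg_neg, sub_self, ramp_zero]
    push_cast
    rfl
  have h4 : (G * skewRamp N - skewRamp N * G) (basisVec 0) 0 = N * (Complex.I * α / 8) := by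
    have h : (G * skewRamp N - skewRamp N * G) (basisVec 0) 0
      = G (rampSum N (basisVec 0) - star (rampSum N) (basisVec 0)) 0
        - (rampSum N (G (basisVec 0)) 0 - star (rampSum N) (G (basisVec 0)) 0) := rfl
    rw [h, hR', sub_zero, h1, h2, h3]
    ring
  have h5 := (norm_coord_le _ 0).trans ((G * skewRamp N - skewRamp N * G).le_opNorm (basisVec 0))
  rw [h4, norm_basisVec, mul_one] at h5
  refine le_trans ?_ h5
  have : ‖(N : ℂ) * (Complex.I * α / 8)‖ = N * |α| / 8 := by
    simp
    ring
  rw [this]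
  gcongr
  exact le_abs_self α

lemma exists_derivative_eq (p : ℂ[X]) : ∃ F : ℂ[X], derivative F = p := by
  induction p using Polynomial.induction_on' with
  | add p q hp hq =>
    obtain ⟨F, rfl⟩ := hp
    obtain ⟨G, rfl⟩ := hq
    exact ⟨F + G, derivative_add⟩
  | monomial n a =>
    refine ⟨monomial (n + 1) (a / (n + 1)), ?_⟩
    rw [derivative_monomial]
    have : (n : ℂ) + 1 ≠ 0 := by exact_mod_cast n.succ_ne_zero
    push_cast
    rw [div_mul_cancel₀ _ this]

/-- On a self-adjoint operator within distance one of a scalar, a function which is polynomial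
near that scalar acts as the polynomial. -/
lemma cfcC_eq_aeval {H : Type} [NormedAddCommGroup H] [InnerProductSpace ℂ H] [CompleteSpace H]
    {A : H →L[ℂ] H} (hA : IsSelfAdjoint A) (hA1 : ‖A‖ ≤ 1) (f : ℝ → ℂ) (r : ℝ) (F : ℂ[X])
    (hf : ∀ s ∈ Set.Icc (-1 : ℝ) 1, f (r + s) = F.eval (s : ℂ)) :
    cfcC f (algebraMap ℂ (H →L[ℂ] H) r + A) = aeval A F := by
  have hr : IsSelfAdjoint (algebraMap ℂ (H →L[ℂ] H) r) := by
    rw [isSelfAdjoint_iff, ← algebraMap_star_comm]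
    simp
  have hT : IsSelfAdjoint (algebraMap ℂ (H →L[ℂ] H) r + A) := hr.add hA
  have h1 : aeval A F = aeval (algebraMap ℂ (H →L[ℂ] H) r + A) (F.comp (X - C (r : ℂ))) := by
    rw [aeval_comp]
    simp
  rw [h1, ← cfc_polynomial _ _ hT.isStarNormal, cfcC]
  refine cfc_congr fun z hz => ?_
  have hre : z = z.re := hT.mem_spectrum_eq_re hz
  have hmem : z - r ∈ spectrum ℂ A := by
    rwa [← spectrum.add_mem_add_iff (s := (r : ℂ)), sub_add_cancel]
  have hle : ‖z - r‖ ≤ 1 :=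
    (spectrum.norm_le_norm_mul_of_mem hmem).trans (by
      have : ‖(1 : H →L[ℂ] H)‖ ≤ 1 := ContinuousLinearMap.norm_id_le
      nlinarith [norm_nonneg A])
  rw [hre, ← Complex.ofReal_sub, Complex.norm_real, Real.norm_eq_abs, abs_le] at hle
  have := hf (z.re - r) hle
  simp only [add_sub_cancel] at this
  rw [this, eval_comp]
  conv_rhs => rw [hre]
  simp

/-- The Cayley transform of a small skew-adjoint operator `V` is a unitary whose commutators are
comparable with those of `V`. -/
lemma exists_unitary_of_skewAdjoint {H : Type} [NormedAddCommGroup H] [InnerProductSpace ℂ H]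
    [CompleteSpace H] (V : H →L[ℂ] H) (hV : star V = -V) (hV1 : ‖V‖ ≤ 1 / 2) :
    ∃ U ∈ unitary (H →L[ℂ] H), ∀ Q : H →L[ℂ] H, ‖Q * U - U * Q‖ ≤ 8 * ‖Q * V - V * Q‖ ∧
      (8 / 9) * ‖Q * V - V * Q‖ ≤ ‖Q * U - U * Q‖ := by
  have hone : ‖(1 : H →L[ℂ] H)‖ ≤ 1 := ContinuousLinearMap.norm_id_le
  set G : H →L[ℂ] H := ↑(Units.oneSub V (by linarith))⁻¹ with hG
  have hG1 : G * (1 - V) = 1 := (Units.oneSub V (by linarith)).inv_mul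
  have hG2 : (1 - V) * G = 1 := (Units.oneSub V (by linarith)).mul_inv
  have hs1 : (1 + V) * star G = 1 := by
    have := congrArg star hG1
    rwa [star_mul, star_sub, hV, star_one, sub_neg_eq_add] at this
  have hs2 : star G * (1 + V) = 1 := by
    have := congrArg star hG2
    rwa [star_mul, star_sub, hV, star_one, sub_neg_eq_add] at this
  have hGn : ‖G‖ ≤ 2 := by
    have h : G = 1 + V * G := by
      rw [sub_mul, one_mul] at hG2
      rw [← hG2]; abel
    have h1 : ‖G‖ ≤ 1 + 1 / 2 * ‖G‖ := by
      calc ‖G‖ = ‖1 + V * G‖ := by rw [← h]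
        _ ≤ ‖(1 : H →L[ℂ] H)‖ + ‖V‖ * ‖G‖ :=
          (norm_add_le _ _).trans (by gcongr; exact norm_mul_le _ _)
        _ ≤ 1 + 1 / 2 * ‖G‖ := by gcongr
    linarith
  have hVn : ‖1 - V‖ ≤ 3 / 2 := by
    have := norm_sub_le (1 : H →L[ℂ] H) V
    linarith
  have e1 : (1 + V) * G = 2 • G - 1 := by
    have : (1 + V) * G = 2 • G - (1 - V) * G := by noncomm_ring
    rw [this, hG2]
  have e2 : star (2 • G - 1 : H →L[ℂ] H) = star G * (1 - V) := by
    have : star G * (1 - V) = 2 • star G - star G * (1 + V) := by noncomm_ring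
    rw [this, hs2, star_sub, star_one, star_nsmul]
  have e3 : star (2 • G - 1 : H →L[ℂ] H) = (1 - V) * star G := by
    have : (1 - V) * star G = 2 • star G - (1 + V) * star G := by noncomm_ring
    rw [this, hs1, star_sub, star_one, star_nsmul]
  have e4 : G * (1 + V) = 2 • G - 1 := by
    have : G * (1 + V) = 2 • G - G * (1 - V) := by noncomm_ring
    rw [this, hG1]
  refine ⟨2 • G - 1, ?_, fun Q => ?_⟩
  · rw [Unitary.mem_iff]
    constructor
    · rw [e2, ← e1]
      calc star G * (1 - V) * ((1 + V) * G) = star G * (1 + V) * ((1 - V) * G) := by noncomm_ring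
        _ = 1 := by rw [hs2, hG2, one_mul]
    · rw [e3, ← e4]
      calc G * (1 + V) * ((1 - V) * star G) = G * (1 - V) * ((1 + V) * star G) := by noncomm_ring
        _ = 1 := by rw [hG1, hs1, one_mul]
  · have c1 : Q * (2 • G - 1) - (2 • G - 1) * Q = 2 • (Q * G - G * Q) := by noncomm_ring
    have c2 : Q * G - G * Q = G * (Q * V - V * Q) * G := by
      have : G * (Q * V - V * Q) * G = (G * (1 - V)) * Q * G - G * Q * ((1 - V) * G) := by
        noncomm_ring
      rw [this, hG1, hG2]; simp
    have c3 : Q * V - V * Q = (1 - V) * (Q * G - G * Q) * (1 - V) := by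
      rw [c2]
      have : (1 - V) * (G * (Q * V - V * Q) * G) * (1 - V)
        = ((1 - V) * G) * (Q * V - V * Q) * (G * (1 - V)) := by noncomm_ring
      rw [this, hG1, hG2]; simp
    have c4 : ‖(2 • (Q * G - G * Q) : H →L[ℂ] H)‖ = 2 * ‖Q * G - G * Q‖ := by
      rw [← Nat.cast_smul_eq_nsmul ℂ, norm_smul]; simp
    rw [c1, c4]
    constructor
    · have : ‖Q * G - G * Q‖ ≤ 2 * ‖Q * V - V * Q‖ * 2 := by
        rw [c2]
        refine (norm_mul_le _ _).trans ?_
        gcongr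
        refine (norm_mul_le _ _).trans ?_
        gcongr
      linarith
    · have : ‖Q * V - V * Q‖ ≤ 3 / 2 * ‖Q * G - G * Q‖ * (3 / 2) := by
        rw [c3]
        refine (norm_mul_le _ _).trans ?_
        gcongr
        refine (norm_mul_le _ _).trans ?_
        gcongr
      linarith

lemma aeval_mul_eq_mul_aeval {R : Type*} [Ring R] [Algebra ℂ R] {A B U : R} (h : B * U = U * A)
    (F : ℂ[X]) : aeval B F * U = U * aeval A F := by
  have hpow : ∀ n : ℕ, B ^ n * U = U * A ^ n := fun n =>
    ((show SemiconjBy U A B from h.symm).pow_right n).eq.symm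
  induction F using Polynomial.induction_on' with
  | add F G hF hG => rw [map_add, map_add, add_mul, mul_add, hF, hG]
  | monomial n a =>
    rw [aeval_monomial, aeval_monomial, mul_assoc, hpow, ← mul_assoc, Algebra.commutes, mul_assoc]

lemma norm_mul_mem_unitary_eq {H : Type} [NormedAddCommGroup H] [InnerProductSpace ℂ H]
    [CompleteSpace H] (Q : H →L[ℂ] H) {U : H →L[ℂ] H} (hU : U ∈ unitary (H →L[ℂ] H)) :
    ‖Q - U * Q * star U‖ = ‖Q * U - U * Q‖ := by
  rw [← CStarRing.norm_mul_mem_unitary (Q - U * Q * star U) hU, sub_mul, mul_assoc _ (star U),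
    Unitary.star_mul_self_of_mem hU, mul_one]

lemma exists_selfAdjoint_pair {H : Type} [NormedAddCommGroup H] [InnerProductSpace ℂ H]
    [CompleteSpace H] {A V : H →L[ℂ] H} (hA : IsSelfAdjoint A) (hA1 : ‖A‖ ≤ 1)
    (hV : star V = -V) (hV1 : ‖V‖ ≤ 1 / 2) (f : ℝ → ℂ) (r : ℝ) (F : ℂ[X])
    (hf : ∀ s ∈ Set.Icc (-1 : ℝ) 1, f (r + s) = F.eval (s : ℂ)) :
    ∃ A' B' : H →L[ℂ] H, IsSelfAdjoint A' ∧ IsSelfAdjoint B' ∧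
      ‖A' - B'‖ ≤ 8 * ‖A * V - V * A‖ ∧
      (8 / 9) * ‖aeval A F * V - V * aeval A F‖ ≤ ‖cfcC f A' - cfcC f B'‖ := by
  obtain ⟨U, hU, hUV⟩ := exists_unitary_of_skewAdjoint V hV hV1
  obtain ⟨B, hBapp⟩ : ∃ B, B = U * A * star U := ⟨_, rfl⟩
  have hr : IsSelfAdjoint (algebraMap ℂ (H →L[ℂ] H) r) := by
    rw [isSelfAdjoint_iff, ← algebraMap_star_comm]
    simp
  have hB : IsSelfAdjoint B := hBapp ▸ hA.conjugate U
  have hB1 : ‖B‖ ≤ 1 := by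
    rw [hBapp, CStarRing.norm_mul_mem_unitary _ (Unitary.star_mem hU),
      CStarRing.norm_mem_unitary_mul _ hU]
    exact hA1
  refine ⟨algebraMap ℂ _ r + A, algebraMap ℂ _ r + B, hr.add hA, hr.add hB, ?_, ?_⟩
  · rw [add_sub_add_left_eq_sub, hBapp, norm_mul_mem_unitary_eq _ hU]
    exact (hUV A).1
  · have hBF : aeval B F = U * aeval A F * star U := by
      have hBU : B * U = U * A := by
        rw [hBapp, mul_assoc, Unitary.star_mul_self_of_mem hU, mul_one]
      rw [← aeval_mul_eq_mul_aeval hBU, mul_assoc, Unitary.mul_star_self_of_mem hU, mul_one]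
    rw [cfcC_eq_aeval hA hA1 f r F hf, cfcC_eq_aeval hB hB1 f r F hf, hBF,
      norm_mul_mem_unitary_eq _ hU]
    exact (hUV _).2

lemma nonempty_ellTwoInt_equiv : Nonempty (EllTwoInt ≃ₗᵢ[ℂ] ellTwo) := by
  let b : HilbertBasis ℕ ℂ ellTwo := HilbertBasis.ofRepr (LinearIsometryEquiv.refl ℂ _)
  let e : ℤ ≃ ℕ := (Denumerable.eqv ℤ)
  have h : Orthonormal ℂ (b ∘ e) := b.orthonormal.comp e e.injective
  refine ⟨(HilbertBasis.mk h ?_).repr.symm⟩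
  rw [e.surjective.range_comp, b.dense_span]

/-- A smooth compactly supported function with prescribed derivative on `[-1, 1]`, whose derivative
is the difference of a cut-off of `p` and a translate of it. -/
lemma exists_smooth_bump (p : ℝ → ℂ) (hp : ContDiff ℝ (⊤ : ℕ∞) p)
    (hp2 : ∀ s ∈ Set.Icc (-1 : ℝ) 1, ‖p s‖ < 2) :
    ∃ h : ℝ → ℂ, ContDiff ℝ (⊤ : ℕ∞) h ∧ (∀ s, ‖h s‖ ≤ 8) ∧ (∀ s, ‖deriv h s‖ ≤ 8) ∧
      (∀ s ≤ -2, h s = 0) ∧ (∀ s, 6 ≤ s → h s = 0) ∧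
      ∀ s ∈ Set.Icc (-1 : ℝ) 1, HasDerivAt h (p s) s := by
  have hO : IsOpen {s | ‖p s‖ < 2} := isOpen_lt hp.continuous.norm continuous_const
  obtain ⟨ε, hε, hεO⟩ := isCompact_Icc.exists_cthickening_subset_open hO hp2
  have hmin : 0 < min ε 1 := lt_min hε one_pos
  let χ : ContDiffBump (0 : ℝ) := ⟨1, 1 + min ε 1, one_pos, by linarith⟩
  have hχ0 : ∀ s, 1 + min ε 1 ≤ |s| → χ s = 0 := fun s hs =>
    χ.zero_of_le_dist (by simpa using hs)
  have hχ1 : ∀ s ∈ Set.Icc (-1 : ℝ) 1, χ s = 1 := fun s hs =>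
    χ.one_of_mem_closedBall (by simpa [abs_le] using hs)
  let q : ℝ → ℂ := fun s => (χ s : ℂ) * p s
  have hq : ContDiff ℝ (⊤ : ℕ∞) q := (Complex.ofRealCLM.contDiff.comp χ.contDiff).mul hp
  have hq0 : ∀ s, 2 ≤ |s| → q s = 0 := fun s hs => by
    simp [q, hχ0 s (by linarith [min_le_right ε 1])]
  have hq1 : ∀ s ∈ Set.Icc (-1 : ℝ) 1, q s = p s := fun s hs => by simp [q, hχ1 s hs]
  have hq2 : ∀ s, ‖q s‖ ≤ 2 := by
    intro s
    rcases le_or_gt (1 + min ε 1) |s| with hs | hs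
    · simp [q, hχ0 s hs]
    · have hmem : ‖p s‖ < 2 := by
        refine hεO (Metric.mem_cthickening_of_dist_le s (max (-1) (min 1 s)) ε _
          ⟨le_max_left _ _, max_le (by norm_num) (min_le_left _ _)⟩ ?_)
        rw [Real.dist_eq]
        have := min_le_left ε 1
        grind
      have h1 : ‖(χ s : ℂ)‖ ≤ 1 := by
        rw [Complex.norm_real, Real.norm_eq_abs, abs_of_nonneg χ.nonneg]
        exact χ.le_one
      calc ‖q s‖ = ‖(χ s : ℂ)‖ * ‖p s‖ := norm_mul _ _
        _ ≤ 1 * 2 := by gcongr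
        _ = 2 := by norm_num
  let G : ℝ → ℂ := fun s => ∫ t in (0 : ℝ)..s, q t
  have hG : ∀ s, HasDerivAt G (q s) s := fun s =>
    intervalIntegral.integral_hasDerivAt_right (hq.continuous.intervalIntegrable _ _)
      (hq.continuous.stronglyMeasurableAtFilter _ _) hq.continuous.continuousAt
  have hGs : ContDiff ℝ (⊤ : ℕ∞) G := by
    rw [contDiff_infty_iff_deriv]
    refine ⟨fun s => (hG s).differentiableAt, ?_⟩
    rwa [show deriv G = q from funext fun s => (hG s).deriv]
  have hsub : ∀ s, G s - G (s - 4) = ∫ t in (s - 4)..s, q t := fun s =>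
    intervalIntegral.integral_interval_sub_left (hq.continuous.intervalIntegrable _ _)
      (hq.continuous.intervalIntegrable _ _)
  have hder : ∀ s, HasDerivAt (fun s => G s - G (s - 4)) (q s - q (s - 4)) s := fun s =>
    (hG s).sub ((hG (s - 4)).comp_sub_const s 4)
  refine ⟨fun s => G s - G (s - 4), hGs.sub (hGs.comp (contDiff_id.sub contDiff_const)),
    fun s => ?_, fun s => ?_, fun s hs => ?_, fun s hs => ?_, fun s hs => ?_⟩
  · change ‖G s - G (s - 4)‖ ≤ 8
    rw [hsub]
    refine (intervalIntegral.norm_integral_le_of_norm_le_const fun t _ => hq2 t).trans ?_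
    norm_num
  · rw [(hder s).deriv]
    refine (norm_sub_le _ _).trans ?_
    linarith [hq2 s, hq2 (s - 4)]
  · change G s - G (s - 4) = 0
    rw [hsub]
    refine intervalIntegral.integral_zero_ae (Filter.Eventually.of_forall fun t ht => hq0 t ?_)
    rw [Set.uIoc_of_le (by linarith)] at ht
    rw [abs_of_nonpos (by linarith [ht.2])]
    linarith [ht.2]
  · change G s - G (s - 4) = 0
    rw [hsub]
    refine intervalIntegral.integral_zero_ae (Filter.Eventually.of_forall fun t ht => hq0 t ?_)
    rw [Set.uIoc_of_le (by linarith)] at ht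
    rw [abs_of_nonneg (by linarith [ht.1])]
    linarith [ht.1]
  · have := hder s
    rwa [hq1 s hs, hq0 (s - 4) (by rw [abs_of_nonpos (by linarith [hs.2])]; linarith [hs.2]),
      sub_zero] at this

lemma exists_smooth_gluing (h : ℕ → ℝ → ℂ) (hs : ∀ n, ContDiff ℝ (⊤ : ℕ∞) (h n))
    {M : ℝ} (h1 : ∀ n s, ‖h n s‖ ≤ M) (h2 : ∀ n s, ‖deriv (h n) s‖ ≤ M)
    (h3 : ∀ n, ∀ s ≤ -2, h n s = 0) (h4 : ∀ n s, 6 ≤ s → h n s = 0) :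
    ∃ f : ℝ → ℂ, ContDiff ℝ (⊤ : ℕ∞) f ∧ (∀ x, ‖f x‖ ≤ M) ∧ (∀ x, ‖deriv f x‖ ≤ M) ∧
      ∀ n : ℕ, ∀ s ∈ Set.Icc (-1 : ℝ) 1, f (10 * n + s) = h n s := by
  let ν : ℝ → ℤ := fun x => ⌊(x + 3) / 10⌋
  let f : ℝ → ℂ := fun x => h (ν x).natAbs (x - 10 * ν x)
  have hloc : ∀ n : ℤ, ∀ x ∈ Set.Ioo (10 * n - 3.5 : ℝ) (10 * n + 7.5),
      f x = h n.natAbs (x - 10 * n) := by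
    intro n x hx
    have hl : (ν x : ℝ) ≤ (x + 3) / 10 := Int.floor_le _
    have hr : (x + 3) / 10 < ν x + 1 := Int.lt_floor_add_one _
    obtain ⟨hx1, hx2⟩ := hx
    have a1 : n - 2 < ν x := by
      have : (n : ℝ) - 2 < ν x := by linarith
      exact_mod_cast this
    have a2 : ν x < n + 2 := by
      have : (ν x : ℝ) < n + 2 := by linarith
      exact_mod_cast this
    have a3 : ν x = n - 1 ∨ ν x = n ∨ ν x = n + 1 := by omega
    change h (ν x).natAbs (x - 10 * ν x) = _
    rcases a3 with a | a | a
    · have a' : (ν x : ℝ) = n - 1 := by exact_mod_cast a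
      rw [h4 _ _ (by linarith), h3 _ _ (by linarith)]
    · rw [a]
    · have a' : (ν x : ℝ) = n + 1 := by exact_mod_cast a
      rw [h3 _ _ (by linarith), h4 _ _ (by linarith)]
  have hev : ∀ x, ∃ n : ℤ, f =ᶠ[nhds x] fun y => h n.natAbs (y - 10 * n) := by
    intro x
    have hl : (ν x : ℝ) ≤ (x + 3) / 10 := Int.floor_le _
    have hr : (x + 3) / 10 < ν x + 1 := Int.lt_floor_add_one _
    exact ⟨ν x, Filter.eventually_of_mem (Ioo_mem_nhds (by linarith) (by linarith)) (hloc _)⟩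
  refine ⟨f, contDiff_iff_contDiffAt.2 fun x => ?_, fun x => h1 _ _, fun x => ?_, fun n s hs => ?_⟩
  · obtain ⟨n, hn⟩ := hev x
    exact ((hs _).comp (contDiff_id.sub contDiff_const)).contDiffAt.congr_of_eventuallyEq hn
  · obtain ⟨n, hn⟩ := hev x
    rw [hn.deriv_eq, deriv_comp_sub_const]
    exact h2 _ _
  · have := hloc n (10 * n + s) ⟨by push_cast; linarith [hs.1], by push_cast; linarith [hs.2]⟩
    simpa using this

lemma norm_eval_rieszProduct_lt_two (n : ℕ) {s : ℝ} (hs : s ∈ Set.Icc (-1 : ℝ) 1) :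
    ‖(rieszProduct (1 / √n) n).eval (s : ℂ)‖ < 2 := by
  rcases n.eq_zero_or_pos with rfl | hn
  · simp [rieszProduct]
  set α : ℝ := 1 / √n
  have hn' : (0 : ℝ) < n := by exact_mod_cast hn
  have hα : α ^ 2 = 1 / n := by rw [div_pow, one_pow, Real.sq_sqrt hn'.le]
  have hfac : ∀ k ∈ Finset.range n, ‖(1 + C (Complex.I * α) *
      Chebyshev.T ℂ (4 * 8 ^ k - 1)).eval (s : ℂ)‖ ^ 2 ≤ Real.exp (1 / n) := by
    intro k _
    set t := (Chebyshev.T ℝ (4 * 8 ^ k - 1)).eval s with ht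
    have ht1 : t ^ 2 ≤ 1 :=
      (sq_le_one_iff_abs_le_one _).2 (Chebyshev.abs_eval_T_real_le_one _ (abs_le.2 hs))
    have h : (1 + C (Complex.I * α) * Chebyshev.T ℂ (4 * 8 ^ k - 1)).eval (s : ℂ)
        = (1 : ℝ) + (α * t : ℝ) * Complex.I := by
      simp only [eval_add, eval_one, eval_mul, eval_C, ← Chebyshev.complex_ofReal_eval_T, ← ht]
      push_cast
      ring
    rw [h, Complex.sq_norm, Complex.normSq_add_mul_I]
    have h2 : (α * t) ^ 2 ≤ 1 / n := by
      rw [mul_pow, hα]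
      exact mul_le_of_le_one_right (by positivity) ht1
    linarith [Real.add_one_le_exp (1 / n : ℝ)]
  have hsq : ‖(rieszProduct α n).eval (s : ℂ)‖ ^ 2 ≤ Real.exp 1 := by
    rw [rieszProduct, eval_prod, norm_prod, ← Finset.prod_pow]
    refine (Finset.prod_le_prod (fun _ _ => by positivity) hfac).trans_eq ?_
    rw [Finset.prod_const, Finset.card_range, ← Real.exp_nat_mul, mul_one_div_cancel hn'.ne']
  refine lt_of_pow_lt_pow_left₀ 2 zero_le_two (hsq.trans_lt ?_)
  linarith [Real.exp_one_lt_d9]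

lemma exists_smooth_eq_primitive_rieszProduct :
    ∃ f : ℝ → ℂ, ContDiff ℝ (⊤ : ℕ∞) f ∧ (∀ x, ‖f x‖ ≤ 8) ∧ (∀ x, ‖deriv f x‖ ≤ 8) ∧
      ∀ n : ℕ, ∃ F : ℂ[X], derivative F = rieszProduct (1 / √n) n ∧
        ∀ s ∈ Set.Icc (-1 : ℝ) 1, f (10 * n + s) = F.eval (s : ℂ) := by
  have hd : ∀ (F : ℂ[X]) (s : ℝ),
      HasDerivAt (fun s : ℝ => F.eval (s : ℂ)) ((derivative F).eval (s : ℂ)) s :=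
    fun F s => (F.hasDerivAt (s : ℂ)).comp_ofReal
  have hc : ∀ F : ℂ[X], ContDiff ℝ (⊤ : ℕ∞) fun s : ℝ => F.eval (s : ℂ) := fun F => by
    have h : ContDiff ℝ (⊤ : ℕ∞) fun z : ℂ => aeval z F := F.contDiff_aeval _ |>.restrict_scalars ℝ
    simpa [Function.comp_def] using h.comp Complex.ofRealCLM.contDiff
  choose h h1 h2 h3 h4 h5 h6 using fun n : ℕ =>
    exists_smooth_bump _ (hc (rieszProduct (1 / √n) n))
      fun s hs => norm_eval_rieszProduct_lt_two n hs
  obtain ⟨f, hf1, hf2, hf3, hf4⟩ := exists_smooth_gluing h h1 h2 h3 h4 h5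
  refine ⟨f, hf1, hf2, hf3, fun n => ?_⟩
  obtain ⟨F, hF⟩ := exists_derivative_eq (rieszProduct (1 / √n) n)
  refine ⟨F + C (h n 0 - F.eval 0), by simp [hF], fun s hs => ?_⟩
  have hconst : h n s - F.eval (s : ℂ) = h n 0 - F.eval ((0 : ℝ) : ℂ) := by
    refine (convex_Icc (-1 : ℝ) 1).is_const_of_fderivWithin_eq_zero
      (𝕜 := ℝ) (f := fun s : ℝ => h n s - F.eval (s : ℂ)) ?_ ?_ hs (by simp)
    · exact fun t ht =>
        ((h6 n t ht).sub (hd F t)).differentiableAt.differentiableWithinAt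
    · intro t ht
      have : HasDerivAt (fun s : ℝ => h n s - F.eval (s : ℂ)) _ t := (h6 n t ht).sub (hd F t)
      rw [hF, sub_self] at this
      have hfd := this.hasFDerivAt.hasFDerivWithinAt (s := Set.Icc (-1 : ℝ) 1)
      rw [hfd.fderivWithin (uniqueDiffOn_Icc (by norm_num) t ht)]
      ext
      simp
  rw [hf4 n s hs]
  simp only [eval_add, eval_C]
  rw [Complex.ofReal_zero] at hconst
  linear_combination hconst

lemma exists_reShift_skewRamp_model :
    ∃ (A : ellTwo →L[ℂ] ellTwo) (W : ℕ → ellTwo →L[ℂ] ellTwo), IsSelfAdjoint A ∧ ‖A‖ ≤ 1 ∧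
      ∀ N, star (W N) = -W N ∧ ‖W N‖ ≤ 8 ^ N ∧ ‖A * W N - W N * A‖ ≤ 2 ∧
        ∀ (α : ℝ) (F : ℂ[X]), derivative F = rieszProduct α N →
          N * α / 8 ≤ ‖aeval A F * W N - W N * aeval A F‖ := by
  obtain ⟨e⟩ := nonempty_ellTwoInt_equiv
  have hnorm : ∀ T, ‖e.conjStarAlgEquiv T‖ = ‖T‖ := fun T =>
    NonUnitalStarAlgHom.norm_map e.conjStarAlgEquiv e.conjStarAlgEquiv.injective T
  have haeval : ∀ (T : EllTwoInt →L[ℂ] EllTwoInt) (F : ℂ[X]),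
      aeval (e.conjStarAlgEquiv T) F = e.conjStarAlgEquiv (aeval T F) := fun T F =>
    aeval_algHom_apply e.conjStarAlgEquiv T F
  refine ⟨e.conjStarAlgEquiv reShift, fun N => e.conjStarAlgEquiv (skewRamp N),
    isSelfAdjoint_reShift.map _, ?_, fun N => ⟨?_, ?_, ?_, fun α F hF => ?_⟩⟩
  · rw [hnorm]
    exact norm_reShift_le
  · rw [← map_star, star_skewRamp, map_neg]
  · rw [hnorm]
    exact norm_skewRamp_le N
  · rw [← map_mul, ← map_mul, ← map_sub, hnorm]
    exact norm_commutator_reShift_skewRamp_le N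
  · rw [haeval, ← map_mul, ← map_mul, ← map_sub, hnorm]
    exact le_norm_commutator_aeval_skewRamp α N F hF

lemma sqrt_log_two_div_le {δ : ℝ} (hδ : 0 < δ) {N : ℕ} (hN : 1 ≤ N) (h : 8 / δ < 8 ^ (N + 1)) :
    √(Real.log (2 / δ)) ≤ 3 * √N := by
  have hN' : (1 : ℝ) ≤ N := by exact_mod_cast hN
  have h1 : Real.log (2 / δ) ≤ (N + 1 : ℕ) * Real.log 8 := by
    rw [← Real.log_pow]
    refine Real.log_le_log (by positivity) (le_trans ?_ h.le)
    gcongr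
    norm_num
  have h8 : Real.log 8 = 3 * Real.log 2 := by
    rw [← Real.log_rpow (by norm_num)]
    norm_num
  have h2 : Real.log (2 / δ) ≤ 3 ^ 2 * N := by
    rw [h8] at h1
    push_cast at h1
    nlinarith [Real.log_two_lt_d9]
  refine Real.sqrt_le_iff.2 ⟨by positivity, ?_⟩
  rwa [mul_pow, Real.sq_sqrt (by positivity)]

end

theorem stmt12 :
    ∃ c : ℝ, 0 < c ∧
      ∃ f : ℝ → ℂ, ContDiff ℝ (⊤ : ℕ∞) f ∧ (∀ x, ‖f x‖ ≤ 1) ∧ (∀ x, ‖deriv f x‖ ≤ 1) ∧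
        ∀ δ : ℝ, 0 < δ → δ ≤ 1 →
          ∃ A B : ellTwo →L[ℂ] ellTwo, IsSelfAdjoint A ∧ IsSelfAdjoint B ∧
            ‖A - B‖ ≤ δ ∧
            c * δ * Real.sqrt (Real.log (2 / δ)) ≤ ‖cfcC f A - cfcC f B‖ := by
  obtain ⟨f, hf1, hf2, hf3, hf4⟩ := exists_smooth_eq_primitive_rieszProduct
  obtain ⟨A, W, hA, hA1, hW⟩ := exists_reShift_skewRamp_model
  refine ⟨1 / 3456, by norm_num, fun x => (1 / 8 : ℂ) * f x, contDiff_const.mul hf1, fun x => ?_,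
    fun x => ?_, fun δ hδ hδ1 => ?_⟩
  · rw [norm_mul]
    norm_num
    linarith [hf2 x]
  · rw [deriv_const_mul _ ((hf1.differentiable (by simp)) x), norm_mul]
    norm_num
    linarith [hf3 x]
  · have h8 : 8 ≤ 8 / δ := by
      rw [le_div_iff₀ hδ]
      linarith
    obtain ⟨N, hN1, hN2⟩ := exists_nat_pow_near (show 1 ≤ 8 / δ by linarith)
      (show (1 : ℝ) < 8 by norm_num)
    have hN : 1 ≤ N := by
      by_contra! h0
      obtain rfl : N = 0 := by omega
      norm_num at hN2
      linarith
    obtain ⟨hW1, hW2, hW3, hW4⟩ := hW N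
    obtain ⟨F, hF, hfF⟩ := hf4 N
    have hlow := hW4 _ F hF
    have hsm : ∀ T : ellTwo →L[ℂ] ellTwo, ‖((δ / 16 : ℝ) : ℂ) • T‖ = δ / 16 * ‖T‖ := fun T => by
      rw [norm_smul, Complex.norm_real, Real.norm_of_nonneg (by positivity)]
    obtain ⟨A', B', hA', hB', hle, hge⟩ := exists_selfAdjoint_pair
      (V := ((δ / 16 : ℝ) : ℂ) • W N) hA hA1 (by rw [star_smul, hW1, smul_neg]; simp) (by
        rw [hsm]
        calc δ / 16 * ‖W N‖ ≤ δ / 16 * (8 / δ) := by gcongr; exact hW2.trans hN1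
          _ = 1 / 2 := by field_simp; norm_num)
      (fun x => (1 / 8 : ℂ) * f x) (10 * N) (.C (1 / 8) * F)
      fun s hs => by simp only [hfF s hs, Polynomial.eval_mul, Polynomial.eval_C]
    refine ⟨A', B', hA', hB', hle.trans ?_, le_trans ?_ hge⟩
    · rw [mul_smul_comm, smul_mul_assoc, ← smul_sub, hsm]
      nlinarith
    · rw [map_mul, Polynomial.aeval_C, mul_smul_comm, smul_mul_assoc, ← smul_sub, hsm,
        Algebra.algebraMap_eq_smul_one, smul_one_mul, smul_mul_assoc, mul_smul_comm, ← smul_sub,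
        norm_smul]
      have hs := sqrt_log_two_div_le hδ hN hN2
      have hroot : (N : ℝ) * (1 / √N) = √N := by
        rw [mul_one_div, Real.div_sqrt]
      rw [hroot] at hlow
      norm_num
      calc 1 / 3456 * δ * √(Real.log (2 / δ)) ≤ 1 / 3456 * δ * (3 * √N) := by gcongr
        _ = 8 / 9 * (δ / 16 * (1 / 8 * (√N / 8))) := by ring
        _ ≤ _ := by gcongr
end
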